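/- (The n/d conjecture of Budur–Mustaţă–Teitler.) Let n ≥ 1 and let f = ∏_{i=1}^r ℓ_i^{d_i} ∈ ℂ[x₁,…,x_n], where ℓ₁,…,ℓ_r are pairwise non-proportional nonzero homogeneous linear forms and d_i ≥ 1, so that f defines a central hyperplane arrangement of total degree d = Σ_{i=1}^r d_i. Assume the arrangement is essential (the ℓ_i span the space of linear forms on ℂⁿ) and indecomposable (there is no partition of {1,…,r} into two nonempty subsets I and J with span_ℂ{ℓ_i : i ∈ I} ∩ span_ℂ{ℓ_j : j ∈ J} = {0}). Then every polynomial b ∈ ℂ[s] lying in the Bernstein–Sato ideal of f, i.e. every b with b·1 ∈ N_f, satisfies b(−n/d) = 0; equivalently, −n/d is a root of the Bernstein–Sato polynomial b_f(s). -/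

import Mathlib

open MvPolynomial

noncomputable section

namespace NDConj

set_option linter.unusedSectionVars false

section Tuples

variable {n : ℕ} {ι : Type} (L : ι → Fin n → ℂ)

/-- The matrix whose rows are the forms indexed by the tuple `c`. -/
def tmat (c : Fin n → ι) : Matrix (Fin n) (Fin n) ℂ := Matrix.of fun k => L (c k)

/-- The coordinates of the form `L i` in the basis given by the tuple `c`. -/
def coord (c : Fin n → ι) (i : ι) : Fin n → ℂ := Matrix.vecMul (L i) (tmat L c)⁻¹

/-- `Layer L c i k`: the last nonzero coordinate of `L i` in the basis `c` is the `k`-th one. -/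
def Layer (c : Fin n → ι) (i : ι) (k : Fin n) : Prop :=
  coord L c i k ≠ 0 ∧ ∀ k', k < k' → coord L c i k' = 0

variable {L} {c : Fin n → ι}

lemma coord_sum (hc : (tmat L c).det ≠ 0) (i : ι) : ∑ k, coord L c i k • L (c k) = L i := by
  have h : Matrix.vecMul (coord L c i) (tmat L c) = L i := by
    rw [coord, Matrix.vecMul_vecMul, Matrix.nonsing_inv_mul _ (isUnit_iff_ne_zero.mpr hc),
      Matrix.vecMul_one]
  rw [← h]
  ext j
  simp [Matrix.vecMul, dotProduct, tmat]

lemma coord_unique (hc : (tmat L c).det ≠ 0) {i : ι} {a : Fin n → ℂ}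
    (h : ∑ k, a k • L (c k) = L i) : coord L c i = a := by
  have h' : Matrix.vecMul a (tmat L c) = L i := by
    rw [← h]
    ext j
    simp [Matrix.vecMul, dotProduct, tmat]
  rw [coord, ← h', Matrix.vecMul_vecMul, Matrix.mul_nonsing_inv _ (isUnit_iff_ne_zero.mpr hc),
    Matrix.vecMul_one]

lemma coord_self (hc : (tmat L c).det ≠ 0) (k : Fin n) : coord L c (c k) = Pi.single k 1 := by
  apply coord_unique hc
  simp [Pi.single_apply]

lemma layer_self (hc : (tmat L c).det ≠ 0) (k : Fin n) : Layer L c (c k) k := by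
  rw [Layer, coord_self hc]
  refine ⟨by simp, fun k' hk => ?_⟩
  rw [Pi.single_eq_of_ne hk.ne']

lemma Layer.unique {i : ι} {k k' : Fin n} (h : Layer L c i k) (h' : Layer L c i k') : k = k' := by
  rcases lt_trichotomy k k' with hk | hk | hk
  · exact absurd (h.2 _ hk) h'.1
  · exact hk
  · exact absurd (h'.2 _ hk) h.1

lemma exists_layer (hc : (tmat L c).det ≠ 0) {i : ι} (hi : L i ≠ 0) : ∃ k, Layer L c i k := by
  classical
  have hne : (Finset.univ.filter fun k => coord L c i k ≠ 0).Nonempty := by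
    by_contra h
    rw [Finset.not_nonempty_iff_eq_empty, Finset.filter_eq_empty_iff] at h
    apply hi
    rw [← coord_sum hc i]
    apply Finset.sum_eq_zero
    intro k _
    have := h (Finset.mem_univ k)
    simp only [not_not] at this
    rw [this, zero_smul]
  refine ⟨_, (Finset.mem_filter.mp (Finset.max'_mem _ hne)).2, fun k' hk => ?_⟩
  by_contra h
  exact absurd (Finset.le_max' _ k' (by simpa using h)) (not_le.mpr hk)

lemma coord_comp_perm (hc : (tmat L c).det ≠ 0) (σ : Equiv.Perm (Fin n)) (i : ι) (k : Fin n) :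
    coord L (c ∘ σ) i k = coord L c i (σ k) := by
  have hc' : (tmat L (c ∘ σ)).det ≠ 0 := by
    have : tmat L (c ∘ σ) = (tmat L c).submatrix σ id := rfl
    rw [this, Matrix.det_permute]
    exact mul_ne_zero (by simp) hc
  have := coord_unique hc' (i := i) (a := fun k => coord L c i (σ k)) (by
    rw [← coord_sum hc i]
    exact Equiv.sum_comp σ (fun k => coord L c i k • L (c k)))
  rw [this]

/-- If every `τ k` lies in the `k`-th layer of `c`, then `τ` and `c` have triangular relation. -/
lemma det_of_layer (hc : (tmat L c).det ≠ 0) {τ : Fin n → ι} (h : ∀ k, Layer L c (τ k) k) :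
    (tmat L τ).det = (∏ k, coord L c (τ k) k) * (tmat L c).det := by
  have hM : tmat L τ = Matrix.of (fun k => coord L c (τ k)) * tmat L c := by
    ext k j
    have := congrFun (coord_sum hc (τ k)) j
    simp only [Finset.sum_apply, Pi.smul_apply, smul_eq_mul] at this
    simp [Matrix.mul_apply, tmat, this]
  rw [hM, Matrix.det_mul, Matrix.det_of_isLowerTriangular]
  · simp
  · intro k l hkl
    exact (h k).2 l hkl

lemma det_ne_zero_of_layer (hc : (tmat L c).det ≠ 0) {τ : Fin n → ι}
    (h : ∀ k, Layer L c (τ k) k) : (tmat L τ).det ≠ 0 := by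
  rw [det_of_layer hc h]
  exact mul_ne_zero (Finset.prod_ne_zero_iff.mpr fun k _ => (h k).1) hc

lemma coord_trans (hc : (tmat L c).det ≠ 0) {τ : Fin n → ι} (hτ : (tmat L τ).det ≠ 0) (i : ι)
    (l : Fin n) : coord L c i l = ∑ k, coord L τ i k * coord L c (τ k) l := by
  have := coord_unique hc (i := i) (a := fun l => ∑ k, coord L τ i k * coord L c (τ k) l) (by
    simp_rw [Finset.sum_smul]
    rw [Finset.sum_comm]
    simp_rw [mul_smul, ← Finset.smul_sum]
    rw [← coord_sum hτ i]
    exact Finset.sum_congr rfl fun k _ => by rw [coord_sum hc])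
  rw [this]

lemma layer_iff_of_layer (hc : (tmat L c).det ≠ 0) {τ : Fin n → ι}
    (h : ∀ k, Layer L c (τ k) k) (i : ι) (k : Fin n) : Layer L τ i k ↔ Layer L c i k := by
  have hτ := det_ne_zero_of_layer hc h
  have key : ∀ k, Layer L τ i k → Layer L c i k := by
    intro k hk
    refine ⟨?_, fun l hl => ?_⟩
    · rw [coord_trans hc hτ, Finset.sum_eq_single k]
      · exact mul_ne_zero hk.1 (h k).1
      · intro p _ hp
        rcases lt_or_gt_of_ne hp with hp | hp
        · rw [(h p).2 k hp, mul_zero]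
        · rw [hk.2 p hp, zero_mul]
      · simp
    · rw [coord_trans hc hτ]
      apply Finset.sum_eq_zero
      intro p _
      rcases lt_or_ge k p with hp | hp
      · rw [hk.2 p hp, zero_mul]
      · rw [(h p).2 l (lt_of_le_of_lt hp hl), mul_zero]
  refine ⟨key k, fun hk => ?_⟩
  have hi : L i ≠ 0 := by
    intro h0
    apply hk.1
    simp [coord, h0]
  obtain ⟨k', hk'⟩ := exists_layer hτ hi
  rwa [(key k' hk').unique hk] at hk'

lemma mem_span_image_iff (hc : (tmat L c).det ≠ 0) (i : ι) (P : Set (Fin n)) :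
    L i ∈ Submodule.span ℂ ((fun k => L (c k)) '' P) ↔ ∀ k, k ∉ P → coord L c i k = 0 := by
  classical
  constructor
  · intro h k hk
    obtain ⟨a, ha, hs⟩ := (Finsupp.mem_span_image_iff_linearCombination ℂ).mp h
    have : coord L c i = a := coord_unique hc (by
      rw [← hs, Finsupp.linearCombination_apply, Finsupp.sum_fintype]
      simp)
    rw [this]
    by_contra h0
    exact hk (ha (Finsupp.mem_support_iff.mpr h0))
  · intro h
    rw [← coord_sum hc i]
    apply Submodule.sum_mem
    intro k _
    by_cases hk : k ∈ P
    · exact Submodule.smul_mem _ _ (Submodule.subset_span ⟨k, hk, rfl⟩)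
    · rw [h k hk, zero_smul]
      exact Submodule.zero_mem _

lemma det_ne_zero_iff : (tmat L c).det ≠ 0 ↔ LinearIndependent ℂ (fun k => L (c k)) := by
  rw [← isUnit_iff_ne_zero, ← Matrix.isUnit_iff_isUnit_det,
    ← Matrix.linearIndependent_rows_iff_isUnit]
  rfl

end Tuples

section Hahn

/-- Exponents of iterated Laurent series, with an extra leading coordinate recording the degree. -/
abbrev LexExp (n : ℕ) := ℤ ×ₗ Lex (Fin n → ℤ)

/-- Iterated Laurent series, as Hahn series. -/
abbrev Laurent (n : ℕ) := HahnSeries (LexExp n) ℂ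

variable {n : ℕ}

/-- The degree of an exponent. -/
def expDeg : LexExp n →+ ℤ where
  toFun g := (ofLex g).1
  map_zero' := rfl
  map_add' _ _ := rfl

/-- The `k`-th component of an exponent. -/
def expComp (k : Fin n) : LexExp n →+ ℤ where
  toFun g := ofLex (ofLex g).2 k
  map_zero' := rfl
  map_add' _ _ := rfl

/-- The exponent of the `k`-th variable. -/
def expVar (k : Fin n) : LexExp n := toLex (1, toLex (Pi.single k 1))

lemma expDeg_mono {a b : LexExp n} (h : a ≤ b) : expDeg a ≤ expDeg b := by
  rcases (Prod.Lex.le_iff).mp h with h | h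
  · exact h.le
  · exact h.1.le

@[simp] lemma expDeg_expVar (k : Fin n) : expDeg (expVar k) = 1 := rfl

lemma expComp_expVar (k l : Fin n) : expComp l (expVar k) = if l = k then 1 else 0 := by
  simp [expComp, expVar, Pi.single_apply]

lemma expVar_lt {k l : Fin n} (h : k < l) : expVar l < expVar k := by
  rw [Prod.Lex.lt_iff]
  right
  refine ⟨rfl, ?_⟩
  refine ⟨k, fun j hj => ?_, ?_⟩
  · simp [expVar, hj.ne, (hj.trans h).ne]
  · simp [expVar, h.ne]

lemma lexExp_lt_of {a b : LexExp n} (hd : expDeg a = expDeg b) (k : Fin n)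
    (h : ∀ j, j < k → expComp j a = expComp j b) (hk : expComp k a < expComp k b) : a < b := by
  rw [Prod.Lex.lt_iff]
  right
  exact ⟨hd, k, h, hk⟩

/-- The logarithmic derivation `x_k ∂/∂x_k` on Laurent series. -/
def euler (k : Fin n) (x : Laurent n) : Laurent n where
  coeff g := (expComp k g : ℂ) * x.coeff g
  isPWO_support' := x.isPWO_support.mono fun g hg => by
    simp only [Function.mem_support, ne_eq, mul_eq_zero, not_or] at hg
    exact hg.2

lemma euler_support (k : Fin n) (x : Laurent n) : (euler k x).support ⊆ x.support := by
  intro g hg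
  have hg : (expComp k g : ℂ) * x.coeff g ≠ 0 := hg
  exact right_ne_zero_of_mul hg

lemma euler_add (k : Fin n) (x y : Laurent n) : euler k (x + y) = euler k x + euler k y := by
  ext g
  simp [euler, mul_add]

lemma euler_mul (k : Fin n) (x y : Laurent n) :
    euler k (x * y) = x * euler k y + y * euler k x := by
  rw [mul_comm y]
  ext g
  rw [HahnSeries.coeff_add,
    HahnSeries.coeff_mul_right' y.isPWO_support (euler_support k y),
    HahnSeries.coeff_mul_left' x.isPWO_support (euler_support k x)]
  change (expComp k g : ℂ) * (x * y).coeff g = _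
  rw [HahnSeries.coeff_mul, Finset.mul_sum, ← Finset.sum_add_distrib]
  refine Finset.sum_congr rfl fun p hp => ?_
  have h := (Finset.mem_antidiagonal.mp hp).2.2
  rw [← h, map_add]
  simp only [euler]
  push_cast
  ring

lemma euler_single (k l : Fin n) (a : ℂ) :
    euler k (HahnSeries.single (expVar l) a) =
      HahnSeries.single (expVar l) (if k = l then a else 0) := by
  ext g
  by_cases hg : g = expVar l
  · subst hg
    simp only [euler, HahnSeries.coeff_single_same, expComp_expVar]
    split_ifs <;> simp
  · simp [euler, HahnSeries.coeff_single_of_ne hg]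

lemma euler_C (k : Fin n) (a : ℂ) : euler k (HahnSeries.C a) = 0 := by
  ext g
  by_cases hg : g = 0
  · subst hg; simp [euler]
  · simp [euler, HahnSeries.C_apply, HahnSeries.coeff_single_of_ne hg]

lemma euler_zero (k : Fin n) : euler k (0 : Laurent n) = 0 := by
  ext g; simp [euler]

lemma order_eq_of_coeff {x : Laurent n} {g : LexExp n} (h : x.coeff g ≠ 0)
    (h' : ∀ g', g' < g → x.coeff g' = 0) : x.order = g := by
  have hx : x ≠ 0 := fun h0 => h (by simp [h0])
  apply le_antisymm
  · exact HahnSeries.order_le_of_coeff_ne_zero h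
  · by_contra hlt
    rw [not_le] at hlt
    exact hx (HahnSeries.coeff_order_eq_zero.mp (h' _ hlt))

end Hahn

section Residue

variable {n : ℕ} {ι : Type} (L : ι → Fin n → ℂ)

/-- The linear polynomial with coefficient vector `v`. -/
def lin (v : Fin n → ℂ) : MvPolynomial (Fin n) ℂ := ∑ k, C (v k) * X k

/-- The change of coordinates attached to the tuple `c`, with values in Laurent series. -/
def chi (c : Fin n → ι) : MvPolynomial (Fin n) ℂ →ₐ[ℂ] Laurent n :=
  aeval fun j => ∑ k, HahnSeries.single (expVar k) ((tmat L c)⁻¹ j k)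

lemma algebraMap_laurent (a : ℂ) : algebraMap ℂ (Laurent n) a = HahnSeries.C a := by
  rw [HahnSeries.algebraMap_apply]; simp

lemma chi_lin (c : Fin n → ι) (v : Fin n → ℂ) :
    chi L c (lin v) =
      ∑ k, HahnSeries.single (expVar k) (Matrix.vecMul v (tmat L c)⁻¹ k) := by
  simp only [lin, chi, map_sum, map_mul, aeval_X, algHom_C, algebraMap_laurent]
  simp only [HahnSeries.C_apply, Finset.mul_sum, HahnSeries.single_mul_single, zero_add]
  rw [Finset.sum_comm]
  refine Finset.sum_congr rfl fun k _ => ?_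
  ext g
  rw [HahnSeries.coeff_sum]
  by_cases hg : g = expVar k
  · subst hg
    simp [Matrix.vecMul, dotProduct]
  · simp [HahnSeries.coeff_single_of_ne hg]

lemma coeff_chi_lin (c : Fin n → ι) (v : Fin n → ℂ) (g : LexExp n) :
    (chi L c (lin v)).coeff g =
      ∑ k, if g = expVar k then Matrix.vecMul v (tmat L c)⁻¹ k else 0 := by
  rw [chi_lin, HahnSeries.coeff_sum]
  refine Finset.sum_congr rfl fun k _ => ?_
  rw [HahnSeries.coeff_single]
  split_ifs <;> rfl

lemma expVar_injective : Function.Injective (expVar (n := n)) := by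
  intro k l h
  by_contra hkl
  rcases lt_or_gt_of_ne hkl with hkl | hkl
  · exact (expVar_lt hkl).ne h.symm
  · exact (expVar_lt hkl).ne h

variable {L}

lemma order_chi_lin {c : Fin n → ι} {i : ι} {t : Fin n} (h : Layer L c i t) :
    chi L c (lin (L i)) ≠ 0 ∧ (chi L c (lin (L i))).order = expVar t ∧
      (chi L c (lin (L i))).leadingCoeff = coord L c i t := by
  have h1 : (chi L c (lin (L i))).coeff (expVar t) = coord L c i t := by
    rw [coeff_chi_lin, Finset.sum_eq_single t]
    · simp [coord]
    · intro k _ hk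
      rw [if_neg (fun h => hk (expVar_injective h.symm))]
    · simp
  have h2 : (chi L c (lin (L i))).order = expVar t := by
    apply order_eq_of_coeff
    · rw [h1]; exact h.1
    · intro g hg
      rw [coeff_chi_lin]
      apply Finset.sum_eq_zero
      intro k _
      split_ifs with hk
      · subst hk
        have : t < k := by
          rcases lt_trichotomy k t with hkt | hkt | hkt
          · exact absurd hg (expVar_lt hkt).asymm
          · subst hkt; exact absurd hg (lt_irrefl _)
          · exact hkt
        exact h.2 k this
      · rfl
  refine ⟨?_, h2, ?_⟩
  · intro h0
    rw [h0] at h1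
    exact h.1 (by simpa using h1.symm)
  · rw [HahnSeries.leadingCoeff_eq, h2, h1]

/-- The exponent of the residue. -/
def resExp (n : ℕ) : LexExp n := - ∑ k, expVar k

lemma expDeg_resExp : expDeg (resExp n) = -n := by
  simp [resExp]

lemma expComp_resExp (k : Fin n) : expComp k (resExp n) = -1 := by
  simp [resExp, expComp_expVar]

variable {Rf : Type} [CommRing Rf] [Algebra ℂ Rf] [Algebra (MvPolynomial (Fin n) ℂ) Rf]
  [IsScalarTower ℂ (MvPolynomial (Fin n) ℂ) Rf] {f : MvPolynomial (Fin n) ℂ}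

lemma exists_chi_extension [IsLocalization.Away f Rf] {c : Fin n → ι} (hfc : chi L c f ≠ 0) :
    ∃ χ : Rf →ₐ[ℂ] Laurent n, ∀ a, χ (algebraMap (MvPolynomial (Fin n) ℂ) Rf a) = chi L c a := by
  have hu : ∀ y : Submonoid.powers f, IsUnit (chi L c y) := by
    rintro ⟨_, k, rfl⟩
    simp only [map_pow]
    exact (isUnit_iff_ne_zero.mpr hfc).pow k
  refine ⟨IsLocalization.liftAlgHom (S := Rf) (M := Submonoid.powers f) (f := chi L c) hu,
    fun a => ?_⟩
  rw [IsLocalization.liftAlgHom_apply, IsLocalization.lift_eq]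
  rfl

variable {c : Fin n → ι}

lemma euler_chi [IsLocalization.Away f Rf] (hfc : chi L c f ≠ 0)
    {χ : Rf →ₐ[ℂ] Laurent n}
    (hχ : ∀ a, χ (algebraMap (MvPolynomial (Fin n) ℂ) Rf a) = chi L c a)
    (D : Fin n → Derivation ℂ Rf Rf)
    (hD : ∀ k (a : MvPolynomial (Fin n) ℂ), D k (algebraMap (MvPolynomial (Fin n) ℂ) Rf a) =
      algebraMap (MvPolynomial (Fin n) ℂ) Rf (pderiv k a)) (k : Fin n) (u : Rf) :
    euler k (χ u) = HahnSeries.single (expVar k) 1 *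
      χ (∑ j, (tmat L c)⁻¹ j k • D j u) := by
  set E : Rf → Rf := fun u => ∑ j, (tmat L c)⁻¹ j k • D j u with hE
  have hEadd : ∀ a b, E (a + b) = E a + E b := by
    intro a b
    simp [hE, Finset.sum_add_distrib]
  have hEmul : ∀ a b, E (a * b) = a * E b + b * E a := by
    intro a b
    simp only [hE, Derivation.leibniz, smul_eq_mul, smul_add, Finset.sum_add_distrib,
      Finset.mul_sum, mul_smul_comm]
  let P : Rf → Prop := fun u => euler k (χ u) = HahnSeries.single (expVar k) 1 * χ (E u)
  have hPadd : ∀ a b, P a → P b → P (a + b) := by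
    intro a b ha hb
    simp only [P] at *
    rw [map_add, euler_add, ha, hb, hEadd, map_add, mul_add]
  have hPmul : ∀ a b, P a → P b → P (a * b) := by
    intro a b ha hb
    simp only [P] at *
    rw [map_mul, euler_mul, ha, hb, hEmul, map_add, map_mul, map_mul]
    ring
  have hPpoly : ∀ a : MvPolynomial (Fin n) ℂ, P (algebraMap (MvPolynomial (Fin n) ℂ) Rf a) := by
    intro a
    induction a using MvPolynomial.induction_on with
    | C a =>
      have h1 : E (algebraMap (MvPolynomial (Fin n) ℂ) Rf (C a)) = 0 := by
        simp [hE, hD]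
      simp only [P]
      rw [h1, hχ, map_zero, mul_zero]
      have : chi L c (C a) = HahnSeries.C a := by
        rw [chi, algHom_C, algebraMap_laurent]
      rw [this, euler_C]
    | add p q hp hq => rw [map_add]; exact hPadd _ _ hp hq
    | mul_X p j hp =>
      rw [map_mul]
      refine hPmul _ _ hp ?_
      have h1 : E (algebraMap (MvPolynomial (Fin n) ℂ) Rf (X j)) =
          algebraMap ℂ Rf ((tmat L c)⁻¹ j k) := by
        simp only [hE, hD]
        rw [Finset.sum_eq_single j]
        · rw [pderiv_X_self, map_one, Algebra.algebraMap_eq_smul_one]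
        · intro l _ hl
          rw [pderiv_X_of_ne hl.symm, map_zero, smul_zero]
        · simp
      simp only [P]
      rw [h1, hχ, AlgHom.commutes, algebraMap_laurent, chi, aeval_X]
      have h2 : ∀ s : Finset (Fin n), euler k (∑ l ∈ s, HahnSeries.single (expVar l)
          ((tmat L c)⁻¹ j l)) = ∑ l ∈ s, euler k (HahnSeries.single (expVar l)
          ((tmat L c)⁻¹ j l)) := by
        intro s
        induction s using Finset.cons_induction with
        | empty => simp [euler_zero]
        | cons a s ha ih => rw [Finset.sum_cons, Finset.sum_cons, euler_add, ih]
      rw [h2]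
      simp only [euler_single]
      rw [Finset.sum_eq_single k]
      · rw [if_pos rfl, HahnSeries.C_apply, HahnSeries.single_mul_single]
        simp
      · intro l _ hl
        rw [if_neg hl.symm, HahnSeries.single_eq_zero]
      · simp
  obtain ⟨⟨a, s⟩, hs⟩ := IsLocalization.surj (Submonoid.powers f) u
  have hs0 : χ (algebraMap (MvPolynomial (Fin n) ℂ) Rf s) ≠ 0 := by
    rw [hχ]
    obtain ⟨_, N, rfl⟩ := s
    simp only [map_pow]
    exact pow_ne_zero _ hfc
  have h1 : P (u * algebraMap (MvPolynomial (Fin n) ℂ) Rf s) := by rw [hs]; exact hPpoly a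
  have h2 := hPpoly s
  simp only [P] at h1 h2
  rw [map_mul, euler_mul, h2, hEmul, map_add, map_mul, map_mul] at h1
  have h3 : χ (algebraMap (MvPolynomial (Fin n) ℂ) Rf s) * euler k (χ u) =
      χ (algebraMap (MvPolynomial (Fin n) ℂ) Rf s) * (HahnSeries.single (expVar k) 1 * χ (E u)) := by
    linear_combination h1
  exact mul_left_cancel₀ hs0 h3

lemma residue_derivation [IsLocalization.Away f Rf] (hc : (tmat L c).det ≠ 0)
    (hfc : chi L c f ≠ 0) {χ : Rf →ₐ[ℂ] Laurent n}
    (hχ : ∀ a, χ (algebraMap (MvPolynomial (Fin n) ℂ) Rf a) = chi L c a)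
    (D : Fin n → Derivation ℂ Rf Rf)
    (hD : ∀ k (a : MvPolynomial (Fin n) ℂ), D k (algebraMap (MvPolynomial (Fin n) ℂ) Rf a) =
      algebraMap (MvPolynomial (Fin n) ℂ) Rf (pderiv k a)) (k : Fin n) (u : Rf) :
    (χ (D k u)).coeff (resExp n) = 0 := by
  have key : ∀ k, (χ (∑ j, (tmat L c)⁻¹ j k • D j u)).coeff (resExp n) = 0 := by
    intro k
    have h1 := euler_chi hfc hχ D hD k u
    have h2 := congrArg (fun x => x.coeff (resExp n + expVar k)) h1
    simp only [HahnSeries.coeff_single_mul_add, one_mul] at h2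
    rw [← h2]
    simp [euler, expComp_resExp, expComp_expVar]
  have h3 : D k u = ∑ l, (tmat L c) l k • ∑ j, (tmat L c)⁻¹ j l • D j u := by
    simp_rw [Finset.smul_sum, smul_smul]
    rw [Finset.sum_comm]
    simp_rw [← Finset.sum_smul]
    have : ∀ j, ∑ l, tmat L c l k * (tmat L c)⁻¹ j l = if j = k then 1 else 0 := by
      intro j
      have := congrFun (congrFun (Matrix.nonsing_inv_mul _ (isUnit_iff_ne_zero.mpr hc)) j) k
      rw [Matrix.mul_apply, Matrix.one_apply] at this
      rw [← this]
      exact Finset.sum_congr rfl fun l _ => mul_comm _ _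
    simp [this]
  rw [h3, map_sum, HahnSeries.coeff_sum]
  apply Finset.sum_eq_zero
  intro l _
  rw [map_smul, HahnSeries.coeff_smul, key, smul_zero]

end Residue

section Values

variable {n : ℕ} {ι : Type} {L : ι → Fin n → ℂ}

lemma card_le_of_mem_span {C D : Finset ι} (hC : LinearIndepOn ℂ L (C : Set ι))
    (h : ∀ i ∈ C, L i ∈ Submodule.span ℂ (L '' D)) : C.card ≤ D.card := by
  classical
  have h1 : Module.finrank ℂ (Submodule.span ℂ (Set.range fun i : C => L i)) = C.card := by
    rw [finrank_span_eq_card (b := fun i : C => L i) hC]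
    simp
  have h2 : Submodule.span ℂ (Set.range fun i : C => L i) ≤ Submodule.span ℂ (L '' D) := by
    rw [Submodule.span_le]
    rintro _ ⟨i, rfl⟩
    exact h i i.2
  have h3 : Module.finrank ℂ (Submodule.span ℂ (L '' D)) ≤ D.card := by
    have := finrank_span_finset_le_card (R := ℂ) (D.image L)
    rw [Set.finrank, Finset.coe_image] at this
    exact this.trans Finset.card_image_le
  have h4 := Submodule.finrank_mono h2
  omega

variable (L) in
open Classical in
/-- The residue along the flag of the tuple `c` of the product of the inverses of the forms
in `C`. -/
def resVal (c : Fin n → ι) (C : Finset ι) : ℂ :=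
  ∏ k, ∑ i ∈ C, if Layer L c i k then (coord L c i k)⁻¹ else 0

variable {Rf : Type} [CommRing Rf] [Algebra ℂ Rf] [Algebra (MvPolynomial (Fin n) ℂ) Rf]
  [IsScalarTower ℂ (MvPolynomial (Fin n) ℂ) Rf] {f : MvPolynomial (Fin n) ℂ}
  {c : Fin n → ι}

lemma order_chi_inv {χ : Rf →ₐ[ℂ] Laurent n}
    (hχ : ∀ a, χ (algebraMap _ Rf a) = chi L c a) {pinv : ι → Rf}
    (hp : ∀ i, algebraMap (MvPolynomial (Fin n) ℂ) Rf (lin (L i)) * pinv i = 1)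
    {t : ι → Fin n} (ht : ∀ i, Layer L c i (t i)) (C : Finset ι) :
    χ (∏ i ∈ C, pinv i) ≠ 0 ∧ (χ (∏ i ∈ C, pinv i)).order = - ∑ i ∈ C, expVar (t i) ∧
      (χ (∏ i ∈ C, pinv i)).leadingCoeff = ∏ i ∈ C, (coord L c i (t i))⁻¹ := by
  induction C using Finset.cons_induction with
  | empty => simp [HahnSeries.order_one]
  | cons a s ha ih =>
    obtain ⟨h1, h2, h3⟩ := ih
    obtain ⟨g1, g2, g3⟩ := order_chi_lin (ht a)
    have hm : chi L c (lin (L a)) * χ (pinv a) = 1 := by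
      rw [← hχ, ← map_mul, hp, map_one]
    have hne : χ (pinv a) ≠ 0 := right_ne_zero_of_mul (by rw [hm]; exact one_ne_zero)
    have ho := congrArg HahnSeries.order hm
    rw [HahnSeries.order_mul g1 hne, g2, HahnSeries.order_one] at ho
    have hl := congrArg HahnSeries.leadingCoeff hm
    rw [HahnSeries.leadingCoeff_mul, g3, HahnSeries.leadingCoeff_one] at hl
    rw [Finset.prod_cons, map_mul, Finset.prod_cons, Finset.sum_cons]
    refine ⟨mul_ne_zero hne h1, ?_, ?_⟩
    · rw [HahnSeries.order_mul hne h1, h2, eq_neg_of_add_eq_zero_right ho]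
      abel
    · rw [HahnSeries.leadingCoeff_mul, h3, eq_inv_of_mul_eq_one_right hl]

lemma coeff_chi_inv (hc : (tmat L c).det ≠ 0) (hL : ∀ i, L i ≠ 0) {χ : Rf →ₐ[ℂ] Laurent n}
    (hχ : ∀ a, χ (algebraMap _ Rf a) = chi L c a) {pinv : ι → Rf}
    (hp : ∀ i, algebraMap (MvPolynomial (Fin n) ℂ) Rf (lin (L i)) * pinv i = 1)
    {C : Finset ι} (hC : LinearIndepOn ℂ L (C : Set ι)) (hCn : C.card = n) :
    (χ (∏ i ∈ C, pinv i)).coeff (resExp n) = resVal L c C := by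
  classical
  choose t ht using fun i => exists_layer hc (hL i)
  have htk : ∀ i k, Layer L c i k ↔ t i = k := fun i k =>
    ⟨fun h => (ht i).unique h, fun h => h ▸ ht i⟩
  obtain ⟨h1, h2, h3⟩ := order_chi_inv hχ hp ht C
  by_cases hall : ∀ k, (C.filter fun i => t i = k).card = 1
  · have ho : (χ (∏ i ∈ C, pinv i)).order = resExp n := by
      rw [h2, resExp, ← Finset.sum_fiberwise C t (fun i => expVar (t i))]
      congr 1
      refine Finset.sum_congr rfl fun k _ => ?_
      obtain ⟨a, ha⟩ := Finset.card_eq_one.mp (hall k)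
      have hak : a ∈ C.filter fun i => t i = k := by rw [ha]; simp
      rw [ha, Finset.sum_singleton, (Finset.mem_filter.mp hak).2]
    rw [← ho, ← HahnSeries.leadingCoeff_eq, h3, resVal,
      ← Finset.prod_fiberwise C t (fun i => (coord L c i (t i))⁻¹)]
    refine Finset.prod_congr rfl fun k _ => ?_
    obtain ⟨a, ha⟩ := Finset.card_eq_one.mp (hall k)
    have hak : a ∈ C.filter fun i => t i = k := by rw [ha]; simp
    simp only [htk]
    rw [← Finset.sum_filter, ha, Finset.sum_singleton, Finset.prod_singleton,
      (Finset.mem_filter.mp hak).2]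
  · push Not at hall
    have hne : (Finset.univ.filter fun k => (C.filter fun i => t i = k).card ≠ 1).Nonempty := by
      obtain ⟨k, hk⟩ := hall
      exact ⟨k, by simpa using hk⟩
    set k := Finset.min' _ hne with hkdef
    have hk1 : (C.filter fun i => t i = k).card ≠ 1 :=
      (Finset.mem_filter.mp (Finset.min'_mem _ hne)).2
    have hk2 : ∀ j, j < k → (C.filter fun i => t i = j).card = 1 := by
      intro j hj
      by_contra h
      exact absurd (Finset.min'_le _ j (by simpa using h)) (not_le.mpr hj)
    have hcount : (C.filter fun i => t i ≤ k).card ≤ (k : ℕ) + 1 := by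
      have := card_le_of_mem_span (L := L) (C := C.filter fun i => t i ≤ k)
        (D := (Finset.Iic k).image c) (hC.mono (fun i hi => (Finset.mem_filter.mp hi).1)) (by
          intro i hi
          have hi' := (Finset.mem_filter.mp hi).2
          rw [Finset.coe_image, ← Set.image_comp]
          refine (mem_span_image_iff hc i _).mpr fun l hl => ?_
          simp only [Finset.coe_Iic, Set.mem_Iic, not_le] at hl
          exact (ht i).2 l (lt_of_le_of_lt hi' hl))
      refine this.trans (Finset.card_image_le.trans ?_)
      simp
    have hsplit : (C.filter fun i => t i ≤ k).card =
        ∑ j ∈ Finset.Iic k, (C.filter fun i => t i = j).card := by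
      rw [Finset.card_eq_sum_card_fiberwise (f := t) (t := Finset.Iic k)
        (fun i hi => by simpa using (Finset.mem_filter.mp hi).2)]
      refine Finset.sum_congr rfl fun j hj => ?_
      rw [Finset.filter_filter]
      congr 1
      ext i
      simp only [Finset.mem_filter]
      have hj' := Finset.mem_Iic.mp hj
      constructor
      · rintro ⟨a, b, d⟩; exact ⟨a, d⟩
      · rintro ⟨a, b⟩; exact ⟨a, b ▸ hj', b⟩
    have hk0 : (C.filter fun i => t i = k).card = 0 := by
      rw [hsplit, ← Finset.Iio_insert k, Finset.sum_insert (by simp),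
        Finset.sum_congr rfl (fun j hj => hk2 j (Finset.mem_Iio.mp hj))] at hcount
      simp only [Finset.sum_const, Fin.card_Iio, smul_eq_mul, mul_one] at hcount
      omega
    have hcomp : ∀ j, expComp j (χ (∏ i ∈ C, pinv i)).order =
        - ((C.filter fun i => t i = j).card : ℤ) := by
      intro j
      rw [h2, map_neg, map_sum]
      simp only [expComp_expVar]
      rw [Finset.sum_ite, Finset.sum_const_zero, add_zero, Finset.sum_const, nsmul_eq_mul, mul_one]
      simp only [eq_comm]
    have hlt : resExp n < (χ (∏ i ∈ C, pinv i)).order := by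
      refine lexExp_lt_of ?_ k ?_ ?_
      · rw [expDeg_resExp, h2, map_neg, map_sum]
        simp [hCn]
      · intro j hj
        rw [expComp_resExp, hcomp, hk2 j hj]
        rfl
      · rw [expComp_resExp, hcomp, hk0]
        norm_num
    rw [HahnSeries.coeff_eq_zero_of_lt_order hlt, resVal]
    symm
    apply Finset.prod_eq_zero (Finset.mem_univ k)
    apply Finset.sum_eq_zero
    intro i hi
    rw [if_neg]
    intro h
    have : i ∈ C.filter fun i => t i = k := Finset.mem_filter.mpr ⟨hi, (htk i k).mp h⟩
    rw [Finset.card_eq_zero.mp hk0] at this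
    simp at this

/-- Multiplying by a power of a linear form raises the degree. -/
lemma coeff_lin_pow_mul (v : Fin n → ℂ) (x : Laurent n) (j : ℕ) (hj : -(n : ℤ) < expDeg x.order + j)
    (hj0 : j ≠ 0) : ((chi L c (lin v)) ^ j * x).coeff (resExp n) = 0 := by
  by_cases hv : chi L c (lin v) = 0
  · rw [hv, zero_pow hj0]; simp
  by_cases hx : x = 0
  · rw [hx]; simp
  have hd : expDeg (chi L c (lin v)).order = 1 := by
    have h : (chi L c (lin v)).coeff (chi L c (lin v)).order ≠ 0 := fun h =>
      hv (HahnSeries.coeff_order_eq_zero.mp h)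
    rw [coeff_chi_lin] at h
    obtain ⟨k, _, hk⟩ := Finset.exists_ne_zero_of_sum_ne_zero h
    have : (chi L c (lin v)).order = expVar k := by
      by_contra h'
      rw [if_neg h'] at hk
      exact hk rfl
    rw [this]; rfl
  apply HahnSeries.coeff_eq_zero_of_lt_order
  by_contra hle
  rw [not_lt] at hle
  have := expDeg_mono hle
  rw [HahnSeries.order_mul (pow_ne_zero _ hv) hx, HahnSeries.order_pow, map_add, map_nsmul, hd,
    expDeg_resExp] at this
  simp at this
  omega

end Values

section Lin

variable {n : ℕ}

lemma lin_add (v w : Fin n → ℂ) : lin (v + w) = lin v + lin w := by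
  simp [lin, add_mul, Finset.sum_add_distrib]

lemma lin_smul (a : ℂ) (v : Fin n → ℂ) : lin (a • v) = C a * lin v := by
  simp [lin, Finset.mul_sum, mul_assoc]

lemma lin_zero : lin (0 : Fin n → ℂ) = 0 := by simp [lin]

lemma lin_sum {κ : Type*} (s : Finset κ) (v : κ → Fin n → ℂ) :
    lin (∑ i ∈ s, v i) = ∑ i ∈ s, lin (v i) := by
  classical
  induction s using Finset.induction_on with
  | empty => simp [lin_zero]
  | insert a s ha ih => rw [Finset.sum_insert ha, Finset.sum_insert ha, lin_add, ih]

lemma lin_single (k : Fin n) : lin (Pi.single k 1) = X k := by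
  rw [lin, Finset.sum_eq_single k]
  · simp
  · intro l _ hl
    simp [Pi.single_eq_of_ne hl]
  · simp

lemma pderiv_lin (k : Fin n) (v : Fin n → ℂ) : pderiv k (lin v) = C (v k) := by
  rw [lin, map_sum, Finset.sum_eq_single k]
  · rw [Derivation.leibniz]
    simp
  · intro l _ hl
    rw [Derivation.leibniz]
    simp [pderiv_X_of_ne hl]
  · simp

lemma coeff_lin (k : Fin n) (v : Fin n → ℂ) : (lin v).coeff (Finsupp.single k 1) = v k := by
  rw [lin, coeff_sum, Finset.sum_eq_single k]
  · simp [coeff_X]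
  · intro l _ hl
    rw [coeff_C_mul, coeff_X, if_neg, mul_zero]
    intro h
    exact hl (Finsupp.single_left_injective one_ne_zero h)
  · simp

end Lin

section Residues

variable {n r : ℕ} {L : Fin r → Fin n → ℂ}
  {Rf : Type} [CommRing Rf] [Algebra ℂ Rf] [Algebra (MvPolynomial (Fin n) ℂ) Rf]
  [IsScalarTower ℂ (MvPolynomial (Fin n) ℂ) Rf] {f : MvPolynomial (Fin n) ℂ}
  [IsLocalization.Away f Rf]
  {D : Fin n → Derivation ℂ Rf Rf} {pinv : Fin r → Rf} {d : Fin r → ℕ}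

lemma exists_residue (hL : ∀ i, L i ≠ 0) (hf : f = ∏ i, lin (L i) ^ d i)
    (hD : ∀ k (a : MvPolynomial (Fin n) ℂ), D k (algebraMap _ Rf a) = algebraMap _ Rf (pderiv k a))
    (hp : ∀ i, algebraMap (MvPolynomial (Fin n) ℂ) Rf (lin (L i)) * pinv i = 1)
    {c : Fin n → Fin r} (hc : (tmat L c).det ≠ 0) :
    ∃ Res : Rf →ₗ[ℂ] ℂ, (∀ k u, Res (D k u) = 0) ∧
      (∀ C : Finset (Fin r), LinearIndepOn ℂ L (C : Set (Fin r)) → C.card = n →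
        Res (∏ i ∈ C, pinv i) = resVal L c C) ∧
      (∀ C : Finset (Fin r), C.card = n → ∀ v j, j ≠ 0 →
        Res (algebraMap (MvPolynomial (Fin n) ℂ) Rf (lin v) ^ j * ∏ i ∈ C, pinv i) = 0) ∧
      (∀ u v, ∃ J, ∀ j, J ≤ j →
        Res (algebraMap (MvPolynomial (Fin n) ℂ) Rf (lin v) ^ j * u) = 0) := by
  choose t ht using fun i => exists_layer hc (hL i)
  have hfc : chi L c f ≠ 0 := by
    rw [hf, map_prod, Finset.prod_ne_zero_iff]
    intro i _
    rw [map_pow]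
    exact pow_ne_zero _ (order_chi_lin (ht i)).1
  obtain ⟨χ, hχ⟩ := exists_chi_extension (Rf := Rf) hfc
  let Res : Rf →ₗ[ℂ] ℂ :=
    { toFun := fun u => (χ u).coeff (resExp n)
      map_add' := fun x y => by simp
      map_smul' := fun a x => by simp }
  refine ⟨Res, fun k u => residue_derivation hc hfc hχ D hD k u,
    fun C hC hCn => coeff_chi_inv hc hL hχ hp hC hCn, fun C hCn v j hj => ?_, fun u v => ?_⟩
  · change (χ _).coeff _ = 0
    rw [map_mul, map_pow, hχ]
    refine coeff_lin_pow_mul v _ j ?_ hj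
    rw [(order_chi_inv hχ hp ht C).2.1]
    simp only [map_neg, map_sum, expDeg_expVar, Finset.sum_const, hCn]
    simp
    omega
  · refine ⟨(-(n : ℤ) - expDeg (χ u).order).toNat + 1, fun j hj => ?_⟩
    change (χ _).coeff _ = 0
    rw [map_mul, map_pow, hχ]
    refine coeff_lin_pow_mul v _ j ?_ (by omega)
    omega

/-- The map whose cokernel is the twisted top de Rham cohomology. -/
def twistMap (D : Fin n → Derivation ℂ Rf Rf) (h : Fin n → ℂ) : (Fin n → Rf) →ₗ[ℂ] Rf :=
  ∑ k, ((D k : Rf →ₗ[ℂ] Rf) - h k • LinearMap.id) ∘ₗ LinearMap.proj k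

lemma twistMap_apply (h : Fin n → ℂ) (w : Fin n → Rf) :
    twistMap D h w = ∑ k, (D k (w k) - h k • w k) := by
  simp [twistMap]

lemma residue_eq_zero_of_twist
    (hD : ∀ k (a : MvPolynomial (Fin n) ℂ), D k (algebraMap _ Rf a) = algebraMap _ Rf (pderiv k a))
    {Res : Rf →ₗ[ℂ] ℂ} (h1 : ∀ k u, Res (D k u) = 0) (h : Fin n → ℂ)
    (h3 : ∀ u, ∃ J, ∀ j, J ≤ j →
        Res (algebraMap (MvPolynomial (Fin n) ℂ) Rf (lin h) ^ j * u) = 0)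
    {w : Fin n → Rf}
    (h2 : ∀ j, j ≠ 0 →
      Res (algebraMap (MvPolynomial (Fin n) ℂ) Rf (lin h) ^ j * twistMap D h w) = 0) :
    Res (twistMap D h w) = 0 := by
  set H := algebraMap (MvPolynomial (Fin n) ℂ) Rf (lin h) with hH
  have hDH : ∀ k, D k H = algebraMap ℂ Rf (h k) := by
    intro k
    rw [hH, hD, pderiv_lin, IsScalarTower.algebraMap_apply ℂ (MvPolynomial (Fin n) ℂ) Rf]
    rfl
  let A : ℕ → ℂ := fun j => ∑ k, h k * Res (H ^ j * w k)
  have hstep : ∀ j : ℕ, Res (H ^ (j + 1) * twistMap D h w) = -((j : ℂ) + 1) * A j - A (j + 1) := by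
    intro j
    rw [twistMap_apply, Finset.mul_sum, map_sum]
    simp only [A, Finset.mul_sum, ← Finset.sum_sub_distrib]
    refine Finset.sum_congr rfl fun k _ => ?_
    have e1 := h1 k (H ^ (j + 1) * w k)
    rw [Derivation.leibniz, Derivation.leibniz_pow, hDH] at e1
    have e2 : w k • (j + 1) • H ^ (j + 1 - 1) • algebraMap ℂ Rf (h k) =
        (((j : ℂ) + 1) * h k) • (H ^ j * w k) := by
      rw [Algebra.smul_def (_ * _ : ℂ), nsmul_eq_mul, smul_eq_mul, smul_eq_mul,
        add_tsub_cancel_right, map_mul, map_add, map_natCast, map_one]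
      push_cast
      ring
    rw [e2, map_add, smul_eq_mul, map_smul, smul_eq_mul] at e1
    rw [mul_sub, map_sub, mul_smul_comm, map_smul, smul_eq_mul]
    linear_combination e1
  have hzero : Res (twistMap D h w) = - A 0 := by
    rw [twistMap_apply, map_sum]
    simp only [A, ← Finset.sum_neg_distrib, pow_zero, one_mul]
    refine Finset.sum_congr rfl fun k _ => ?_
    rw [map_sub, h1, map_smul, smul_eq_mul, zero_sub]
  have hrec : ∀ j : ℕ, A (j + 1) = -((j : ℂ) + 1) * A j := by
    intro j
    have := hstep j
    rw [h2 _ (Nat.succ_ne_zero j)] at this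
    linear_combination this
  choose J hJ using fun k => h3 (w k)
  have hbig : A (∑ k, J k) = 0 := by
    apply Finset.sum_eq_zero
    intro k _
    rw [hJ k _ (Finset.single_le_sum (f := J) (fun _ _ => Nat.zero_le _) (Finset.mem_univ k)),
      mul_zero]
  have hall : ∀ j : ℕ, A j = 0 → A 0 = 0 := by
    intro j
    induction j with
    | zero => exact id
    | succ j ih =>
      intro hj
      rw [hrec] at hj
      rcases mul_eq_zero.mp hj with h0 | h0
      · exfalso
        have : ((j + 1 : ℕ) : ℂ) = 0 := by push_cast; linear_combination -h0
        exact Nat.cast_ne_zero.mpr (Nat.succ_ne_zero j) this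
      · exact ih h0
  rw [hzero, hall _ hbig, neg_zero]

end Residues

section Nbc

variable {n r : ℕ} {L : Fin r → Fin n → ℂ}

variable (L) in
/-- Sets without broken circuits. -/
def IsNbc (C : Finset (Fin r)) : Prop :=
  ∀ c ∈ C, ∀ i, L i ∈ Submodule.span ℂ (L '' {x | x ∈ C ∧ c ≤ x}) → c ≤ i

lemma linearIndepOn_exchange {ι : Type} [DecidableEq ι] {L : ι → Fin n → ℂ} {C : Finset ι}
    (hC : LinearIndepOn ℂ L (C : Set ι))
    {i x : ι} (hi : L i ∉ Submodule.span ℂ (L '' (C.erase x : Finset ι))) :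
    LinearIndepOn ℂ L ((insert i (C.erase x) : Finset ι) : Set ι) := by
  rw [Finset.coe_insert]
  exact (hC.mono (by simp)).insert hi

lemma notMem_span_erase {ι : Type} [DecidableEq ι] {L : ι → Fin n → ℂ} {C : Finset ι}
    (hC : LinearIndepOn ℂ L (C : Set ι)) {x : ι} (hx : x ∈ C) :
    L x ∉ Submodule.span ℂ (L '' (C.erase x : Finset ι)) := by
  rw [Finset.coe_erase]
  exact hC.notMem_span (Finset.mem_coe.mpr hx)

end Nbc

section NbcSeparation

variable {n r : ℕ} {L : Fin r → Fin n → ℂ}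

lemma tuple_det_ne_zero {ι : Type} {L : ι → Fin n → ℂ} {C : Finset ι}
    (hC : LinearIndepOn ℂ L (C : Set ι)) {c : Fin n → ι} (hc : Function.Injective c)
    (hm : ∀ k, c k ∈ C) : (tmat L c).det ≠ 0 := by
  rw [det_ne_zero_iff]
  exact LinearIndependent.comp hC (fun k => (⟨c k, hm k⟩ : (C : Set ι)))
    (fun a b h => hc (by simpa using h))

lemma exists_tuple_of_resVal_ne_zero {ι : Type} {L : ι → Fin n → ℂ} {C : Finset ι} {c : Fin n → ι}
    (h : resVal L c C ≠ 0) : ∃ x : Fin n → ι, (∀ k, x k ∈ C) ∧ ∀ k, Layer L c (x k) k := by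
  classical
  have : ∀ k, ∃ i ∈ C, Layer L c i k := by
    intro k
    have hk := Finset.prod_ne_zero_iff.mp h k (Finset.mem_univ k)
    obtain ⟨i, hi, hi'⟩ := Finset.exists_ne_zero_of_sum_ne_zero hk
    refine ⟨i, hi, ?_⟩
    by_contra hn
    exact hi' (if_neg hn)
  choose x hx using this
  exact ⟨x, fun k => (hx k).1, fun k => (hx k).2⟩

lemma resVal_self {ι : Type} {L : ι → Fin n → ℂ} {C : Finset ι} {c : Fin n → ι}
    (hc : (tmat L c).det ≠ 0) (hm : ∀ i, i ∈ C ↔ ∃ k, c k = i) : resVal L c C = 1 := by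
  classical
  apply Finset.prod_eq_one
  intro k _
  rw [Finset.sum_eq_single (c k)]
  · rw [if_pos (layer_self hc k), coord_self hc]
    simp
  · intro i hi hne
    obtain ⟨j, rfl⟩ := (hm i).mp hi
    rw [if_neg]
    intro h
    exact hne (by rw [h.unique (layer_self hc j)])
  · intro h
    exact absurd ((hm _).mpr ⟨k, rfl⟩) h

/-- The decreasing enumeration of a set of indices. -/
def decTuple {C : Finset (Fin r)} (hCn : C.card = n) (k : Fin n) : Fin r :=
  C.orderEmbOfFin hCn (Fin.rev k)

lemma decTuple_mem {C : Finset (Fin r)} (hCn : C.card = n) (i : Fin r) :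
    i ∈ C ↔ ∃ k, decTuple hCn k = i := by
  have h := Finset.range_orderEmbOfFin C hCn
  rw [← Finset.mem_coe, ← h]
  constructor
  · rintro ⟨k, rfl⟩
    exact ⟨Fin.rev k, by simp [decTuple]⟩
  · rintro ⟨k, rfl⟩
    exact ⟨Fin.rev k, rfl⟩

lemma decTuple_le {C : Finset (Fin r)} (hCn : C.card = n) {k l : Fin n} (h : l ≤ k) :
    decTuple hCn k ≤ decTuple hCn l := by
  simpa [decTuple] using h

lemma decTuple_det {C : Finset (Fin r)} (hC : LinearIndepOn ℂ L (C : Set (Fin r)))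
    (hCn : C.card = n) : (tmat L (decTuple hCn)).det ≠ 0 :=
  tuple_det_ne_zero hC (fun a b h => by simpa [decTuple] using h)
    (fun k => (decTuple_mem hCn _).mpr ⟨k, rfl⟩)

lemma resVal_decTuple_eq_zero {C C' : Finset (Fin r)} (hC : LinearIndepOn ℂ L (C : Set (Fin r)))
    (hCn : C.card = n) (hCn' : C'.card = n) (hb : IsNbc L C) (hb' : IsNbc L C') (hne : C ≠ C') :
    resVal L (decTuple hCn) C' = 0 := by
  classical
  by_contra h
  obtain ⟨x, hx, hl⟩ := exists_tuple_of_resVal_ne_zero h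
  have hdet := decTuple_det hC hCn
  have hxdet := det_ne_zero_of_layer hdet hl
  apply hne
  apply Finset.eq_of_subset_of_card_le _ (by rw [hCn, hCn'])
  intro i hi
  obtain ⟨k, rfl⟩ := (decTuple_mem hCn i).mp hi
  obtain ⟨l, hlk, hmin⟩ := Finset.exists_min_image (Finset.Iic k) x ⟨k, by simp⟩
  rw [Finset.mem_Iic] at hlk
  have h1 : x l ≤ decTuple hCn k := by
    apply hb' _ (hx l)
    have h2 : L (decTuple hCn k) ∈ Submodule.span ℂ ((fun q => L (x q)) '' Set.Iic k) := by
      rw [mem_span_image_iff hxdet]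
      intro q hq
      exact ((layer_iff_of_layer hdet hl _ k).mpr (layer_self hdet k)).2 q (not_le.mp hq)
    refine Submodule.span_mono ?_ h2
    rintro _ ⟨q, hq, rfl⟩
    exact ⟨x q, ⟨hx q, hmin q (by simpa using hq)⟩, rfl⟩
  have h2 : decTuple hCn k ≤ x l := by
    apply hb _ hi
    have h2 : L (x l) ∈ Submodule.span ℂ ((fun q => L (decTuple hCn q)) '' Set.Iic l) := by
      rw [mem_span_image_iff hdet]
      intro q hq
      exact (hl l).2 q (not_le.mp hq)
    refine Submodule.span_mono ?_ h2
    rintro _ ⟨q, hq, rfl⟩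
    exact ⟨_, ⟨(decTuple_mem hCn _).mpr ⟨q, rfl⟩, decTuple_le hCn (le_trans hq hlk)⟩, rfl⟩
  rw [le_antisymm h2 h1]
  exact hx l

/-- Bases of the arrangement. -/
def IsBase {ι : Type} (L : ι → Fin n → ℂ) (C : Finset ι) : Prop :=
  LinearIndepOn ℂ L (C : Set ι) ∧ C.card = n

lemma IsBase.exchange {ι : Type} [DecidableEq ι] {L : ι → Fin n → ℂ} {C : Finset ι}
    (hC : IsBase L C) {i x : ι} (hx : x ∈ C)
    (hi : L i ∉ Submodule.span ℂ (L '' (C.erase x : Finset ι))) :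
    IsBase L (insert i (C.erase x)) := by
  refine ⟨linearIndepOn_exchange hC.1 hi, ?_⟩
  rw [Finset.card_insert_of_notMem, Finset.card_erase_add_one hx, hC.2]
  intro h
  exact hi (Submodule.subset_span ⟨i, h, rfl⟩)

lemma mem_span_nbc {V : Type} [AddCommGroup V] [Module ℂ V] (e : Finset (Fin r) → V)
    (he : ∀ C, ∀ i ∉ C, ∀ β : Fin r → ℂ, L i = ∑ x ∈ C, β x • L x →
      e C = ∑ x ∈ C, β x • e (insert i (C.erase x))) {C : Finset (Fin r)} (hC : IsBase L C) :
    e C ∈ Submodule.span ℂ (e '' {B | IsBase L B ∧ IsNbc L B}) := by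
  induction hN : ∑ i ∈ C, (i : ℕ) using Nat.strong_induction_on generalizing C with
  | _ N ih =>
  by_cases hb : IsNbc L C
  · exact Submodule.subset_span ⟨C, ⟨hC, hb⟩, rfl⟩
  unfold IsNbc at hb
  push Not at hb
  obtain ⟨c, hc, i, hi, hic⟩ := hb
  obtain ⟨β, hβs, hβ⟩ := (Finsupp.mem_span_image_iff_linearCombination ℂ).mp hi
  have hβ' : L i = ∑ x ∈ C, β x • L x := by
    rw [← hβ, Finsupp.linearCombination_apply, Finsupp.sum]
    apply Finset.sum_subset
    · intro x hx
      exact (hβs hx).1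
    · intro x _ hx
      rw [Finsupp.notMem_support_iff.mp hx, zero_smul]
  have hiC : i ∉ C := by
    intro hmem
    have := notMem_span_erase hC.1 hmem
    apply this
    refine Submodule.span_mono ?_ hi
    apply Set.image_mono
    rintro x ⟨hx, hx'⟩
    rw [Finset.mem_coe, Finset.mem_erase]
    exact ⟨fun h => absurd hic (by rw [← h]; exact not_lt.mpr hx'), hx⟩
  rw [he C i hiC β hβ']
  apply Submodule.sum_mem
  intro x hx
  by_cases h0 : β x = 0
  · rw [h0, zero_smul]; exact Submodule.zero_mem _
  apply Submodule.smul_mem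
  have hcx : c ≤ x := (hβs (Finsupp.mem_support_iff.mpr h0)).2
  have hix : L i ∉ Submodule.span ℂ (L '' (C.erase x : Finset (Fin r))) := by
    intro h
    apply notMem_span_erase hC.1 hx
    have : L x = (β x)⁻¹ • (L i - ∑ y ∈ C.erase x, β y • L y) := by
      rw [hβ', ← Finset.add_sum_erase C _ hx, add_sub_cancel_right, smul_smul, inv_mul_cancel₀ h0,
        one_smul]
    rw [this]
    apply Submodule.smul_mem
    apply Submodule.sub_mem _ h
    apply Submodule.sum_mem
    intro y hy
    exact Submodule.smul_mem _ _ (Submodule.subset_span ⟨y, hy, rfl⟩)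
  refine ih _ ?_ (hC.exchange hx hix) rfl
  rw [Finset.sum_insert (fun h => hiC (Finset.mem_of_mem_erase h)), ← hN,
    ← Finset.add_sum_erase C _ hx]
  have : (i : ℕ) < x := lt_of_lt_of_le hic hcx
  omega

/-- An element of the span of the basic elements is determined by its residues. -/
lemma eq_zero_of_residues {V : Type} [AddCommGroup V] [Module ℂ V] (e : Finset (Fin r) → V)
    (he : ∀ C, ∀ i ∉ C, ∀ β : Fin r → ℂ, L i = ∑ x ∈ C, β x • L x →
      e C = ∑ x ∈ C, β x • e (insert i (C.erase x)))
    (Res : (Fin n → Fin r) → V →ₗ[ℂ] ℂ)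
    (hRes : ∀ c, (tmat L c).det ≠ 0 → ∀ C, IsBase L C → Res c (e C) = resVal L c C)
    {σ : V} (hσ : σ ∈ Submodule.span ℂ (e '' {B | IsBase L B}))
    (h0 : ∀ c, (tmat L c).det ≠ 0 → Res c σ = 0) : σ = 0 := by
  have hσ' : σ ∈ Submodule.span ℂ (e '' {B | IsBase L B ∧ IsNbc L B}) := by
    refine (Submodule.span_le.mpr ?_) hσ
    rintro _ ⟨C, hC, rfl⟩
    exact mem_span_nbc e he hC
  obtain ⟨a, ha, rfl⟩ := (Finsupp.mem_span_image_iff_linearCombination ℂ).mp hσ'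
  have : a = 0 := by
    ext C
    by_contra hC
    have hCm := ha (Finsupp.mem_support_iff.mpr hC)
    have h1 := h0 _ (decTuple_det hCm.1.1 hCm.1.2)
    rw [Finsupp.linearCombination_apply, Finsupp.sum, map_sum, Finset.sum_eq_single C] at h1
    · rw [map_smul, hRes _ (decTuple_det hCm.1.1 hCm.1.2) C hCm.1,
        resVal_self (decTuple_det hCm.1.1 hCm.1.2) (decTuple_mem _), smul_eq_mul, mul_one] at h1
      exact hC h1
    · intro C' hC' hne
      have hCm' := ha hC'
      rw [map_smul, hRes _ (decTuple_det hCm.1.1 hCm.1.2) C' hCm'.1,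
        resVal_decTuple_eq_zero hCm.1.1 _ hCm'.1.2 hCm.2 hCm'.2 hne.symm, smul_zero]
    · intro h
      exact absurd (Finsupp.notMem_support_iff.mp h) hC
  rw [this, map_zero]

end NbcSeparation

section Duality

variable {n : ℕ}

lemma exists_dot_ne_zero {W : Submodule ℂ (Fin n → ℂ)} {h : Fin n → ℂ} (hh : h ∉ W) :
    ∃ v : Fin n → ℂ, (∀ w ∈ W, w ⬝ᵥ v = 0) ∧ h ⬝ᵥ v ≠ 0 := by
  obtain ⟨φ, h1, h2⟩ := Submodule.exists_le_ker_of_notMem hh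
  have key : ∀ w, w ⬝ᵥ (fun k => φ (Pi.single k 1)) = φ w := by
    intro w
    conv_rhs => rw [pi_eq_sum_univ' w, map_sum]
    simp [dotProduct]
  refine ⟨fun k => φ (Pi.single k 1), fun w hw => ?_, ?_⟩
  · rw [key]; exact h2 hw
  · rw [key]; exact h1

lemma exists_generic {ι : Type} [Finite ι] (L : ι → Fin n → ℂ) :
    ∃ h : Fin n → ℂ, ∀ Y : Set ι, Submodule.span ℂ (L '' Y) ≠ ⊤ → h ∉ Submodule.span ℂ (L '' Y) := by
  classical
  cases nonempty_fintype ι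
  let S : Finset (Submodule ℂ (Fin n → ℂ)) :=
    (Finset.univ.image fun Y : Finset ι => Submodule.span ℂ (L '' (Y : Set ι))).erase ⊤
  have := Subspace.biUnion_ne_univ_of_top_notMem (s := S) (by simp [S])
  obtain ⟨h, hh⟩ := (Set.ne_univ_iff_exists_notMem _).mp this
  refine ⟨h, fun Y hY hmem => hh ?_⟩
  simp only [Set.mem_iUnion]
  refine ⟨Submodule.span ℂ (L '' Y), ?_, hmem⟩
  rw [Finset.mem_erase]
  refine ⟨hY, Finset.mem_image.mpr ⟨Y.toFinite.toFinset, Finset.mem_univ _, by simp⟩⟩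

lemma dot_eq_zero_of_mem_span {ι : Type} {L : ι → Fin n → ℂ} {Y : Set ι} {v : Fin n → ℂ}
    (hv : ∀ y ∈ Y, L y ⬝ᵥ v = 0) {w : Fin n → ℂ} (hw : w ∈ Submodule.span ℂ (L '' Y)) :
    w ⬝ᵥ v = 0 := by
  induction hw using Submodule.span_induction with
  | mem x hx => obtain ⟨y, hy, rfl⟩ := hx; exact hv y hy
  | zero => simp
  | add x y _ _ hx hy => rw [add_dotProduct, hx, hy, add_zero]
  | smul a x _ hx => rw [smul_dotProduct, hx, smul_zero]

lemma exists_sum_of_mem_span {ι : Type} {L : ι → Fin n → ℂ} {C : Finset ι} {w : Fin n → ℂ}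
    (hw : w ∈ Submodule.span ℂ (L '' (C : Set ι))) : ∃ β : ι → ℂ, w = ∑ x ∈ C, β x • L x := by
  obtain ⟨β, hβs, hβ⟩ := (Finsupp.mem_span_image_iff_linearCombination ℂ).mp hw
  refine ⟨β, ?_⟩
  rw [← hβ, Finsupp.linearCombination_apply, Finsupp.sum]
  apply Finset.sum_subset
  · intro x hx
    exact hβs hx
  · intro x _ hx
    rw [Finsupp.notMem_support_iff.mp hx, zero_smul]

/-- The directional derivative. -/
def dirD (v : Fin n → ℂ) (g : MvPolynomial (Fin n) ℂ) : MvPolynomial (Fin n) ℂ :=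
  ∑ k, v k • pderiv k g

lemma dirD_C (v : Fin n → ℂ) (a : ℂ) : dirD v (C a) = 0 := by
  simp [dirD]

lemma dirD_homogeneous {v : Fin n → ℂ} {g : MvPolynomial (Fin n) ℂ} {N : ℕ}
    (hg : g.IsHomogeneous N) : (dirD v g).IsHomogeneous (N - 1) := by
  apply IsHomogeneous.sum
  intro k _
  rw [smul_eq_C_mul]
  simpa using (isHomogeneous_C _ (v k)).mul hg.pderiv

lemma lin_decomp {ι : Type} {L : ι → Fin n → ℂ} {C : Finset ι}
    (hC : Submodule.span ℂ (L '' (C : Set ι)) = ⊤) {N : ℕ} {g : MvPolynomial (Fin n) ℂ}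
    (hg : g.IsHomogeneous (N + 1)) :
    ∃ G : ι → MvPolynomial (Fin n) ℂ, (∀ c, (G c).IsHomogeneous N) ∧
      g = ∑ c ∈ C, lin (L c) * G c := by
  have : ∀ k : Fin n, ∃ β : ι → ℂ, (Pi.single k 1 : Fin n → ℂ) = ∑ x ∈ C, β x • L x := fun k =>
    exists_sum_of_mem_span (by rw [hC]; trivial)
  choose β hβ using this
  refine ⟨fun c => ∑ k, MvPolynomial.C (((N : ℂ) + 1)⁻¹ * β k c) * pderiv k g, fun c => ?_, ?_⟩
  · apply IsHomogeneous.sum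
    intro k _
    simpa using (isHomogeneous_C _ (((N : ℂ) + 1)⁻¹ * β k c)).mul hg.pderiv
  · have h1 := hg.sum_X_mul_pderiv
    have h2 : ∀ k : Fin n, (X k : MvPolynomial (Fin n) ℂ) =
        ∑ c ∈ C, MvPolynomial.C (β k c) * lin (L c) := by
      intro k
      rw [← lin_single, hβ k, lin_sum]
      exact Finset.sum_congr rfl fun c _ => lin_smul _ _
    have h3 : g = MvPolynomial.C ((N : ℂ) + 1)⁻¹ * ∑ k, X k * pderiv k g := by
      rw [h1, nsmul_eq_mul, ← mul_assoc]
      have : (((N + 1 : ℕ)) : MvPolynomial (Fin n) ℂ) = MvPolynomial.C ((N : ℂ) + 1) := by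
        simp
      rw [this, ← MvPolynomial.C_mul, inv_mul_cancel₀ (by exact_mod_cast Nat.succ_ne_zero N)]
      simp
    conv_lhs => rw [h3]
    simp_rw [Finset.mul_sum]
    rw [Finset.sum_comm]
    refine Finset.sum_congr rfl fun k _ => ?_
    rw [h2 k, Finset.sum_mul, Finset.mul_sum]
    refine Finset.sum_congr rfl fun c _ => ?_
    rw [MvPolynomial.C_mul]
    ring

end Duality

/-- The linear relations between twisted periods of products of inverses of linear forms. -/
structure PeriodSystem {n : ℕ} {ι : Type} [Fintype ι] [DecidableEq ι] (L : ι → Fin n → ℂ) (V : Type)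
    [AddCommGroup V] [Module ℂ V] where
  s : ι → V →ₗ[ℂ] V
  h : Fin n → ℂ
  q : Finset ι → MvPolynomial (Fin n) ℂ →ₗ[ℂ] V
  gen : ∀ Y : Set ι, Submodule.span ℂ (L '' Y) ≠ ⊤ → h ∉ Submodule.span ℂ (L '' Y)
  rel : ∀ (C : Finset ι) (v : Fin n → ℂ) (g : MvPolynomial (Fin n) ℂ), (∀ c ∈ C, L c ⬝ᵥ v = 0) →
    (h ⬝ᵥ v) • q C g = q C (dirD v g) - ∑ i, (L i ⬝ᵥ v) • s i (q (insert i C) g)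
  erase : ∀ (C : Finset ι) (c : ι) (g : MvPolynomial (Fin n) ℂ), c ∈ C →
    q C (lin (L c) * g) = q (C.erase c) g

section Reduction

variable {n : ℕ} {ι : Type} [Fintype ι] [DecidableEq ι] {L : ι → Fin n → ℂ} {V : Type}
  [AddCommGroup V] [Module ℂ V] (S : PeriodSystem L V)

lemma IsBase.span_eq_top {C : Finset ι} (hC : IsBase L C) :
    Submodule.span ℂ (L '' (C : Set ι)) = ⊤ := by
  have h1 : Module.finrank ℂ (Submodule.span ℂ (Set.range fun i : C => L i)) = C.card := by
    rw [finrank_span_eq_card (b := fun i : C => L i) hC.1]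
    simp
  apply Submodule.eq_top_of_finrank_eq
  rw [Set.image_eq_range]
  exact h1.trans (by simp [hC.2])

lemma LinearIndepOn_card_le {C : Finset ι} (hC : LinearIndepOn ℂ L (C : Set ι)) : C.card ≤ n := by
  have := LinearIndependent.fintype_card_le_finrank hC
  simpa using this

lemma isBase_of_span_eq_top {C : Finset ι} (hC : LinearIndepOn ℂ L (C : Set ι))
    (h : Submodule.span ℂ (L '' (C : Set ι)) = ⊤) : IsBase L C := by
  refine ⟨hC, ?_⟩
  have h1 : Module.finrank ℂ (Submodule.span ℂ (Set.range fun i : C => L i)) = C.card := by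
    rw [finrank_span_eq_card (b := fun i : C => L i) hC]
    simp
  rw [Set.image_eq_range] at h
  change Submodule.span ℂ (Set.range fun i : C => L i) = ⊤ at h
  rw [h] at h1
  simpa using h1.symm

variable {S}

lemma PeriodSystem.exchange {C : Finset ι} {i : ι} (hi : i ∉ C) {β : ι → ℂ}
    (hβ : L i = ∑ x ∈ C, β x • L x) (g : MvPolynomial (Fin n) ℂ) :
    S.q C g = ∑ x ∈ C, β x • S.q (insert i (C.erase x)) g := by
  have h1 := S.erase (insert i C) i g (Finset.mem_insert_self _ _)
  rw [Finset.erase_insert hi, hβ, lin_sum, Finset.sum_mul, map_sum] at h1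
  rw [← h1]
  refine Finset.sum_congr rfl fun x hx => ?_
  rw [lin_smul, mul_assoc, ← smul_eq_C_mul, map_smul, S.erase _ _ _ (Finset.mem_insert_of_mem hx),
    Finset.erase_insert_of_ne]
  rintro rfl
  exact hi hx

/-- Relation obtained from a direction killing `C` but not `h`. -/
lemma PeriodSystem.mem_of_step (M : Submodule ℂ V) (hM : ∀ i, ∀ x ∈ M, S.s i x ∈ M)
    {C : Finset ι} {Y : Set ι} (hY : Submodule.span ℂ (L '' Y) ≠ ⊤) (hCY : ↑C ⊆ Y)
    {g : MvPolynomial (Fin n) ℂ} (h1 : ∀ v, S.q C (dirD v g) ∈ M)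
    (h2 : ∀ i, L i ∉ Submodule.span ℂ (L '' Y) → S.q (insert i C) g ∈ M) : S.q C g ∈ M := by
  obtain ⟨v, hv, hv'⟩ := exists_dot_ne_zero (S.gen Y hY)
  have h := S.rel C v g (fun c hc => hv _ (Submodule.subset_span ⟨c, hCY hc, rfl⟩))
  have : S.q C g = (S.h ⬝ᵥ v)⁻¹ • ((S.h ⬝ᵥ v) • S.q C g) := by
    rw [smul_smul, inv_mul_cancel₀ hv', one_smul]
  rw [this, h]
  apply Submodule.smul_mem
  apply Submodule.sub_mem _ (h1 v)
  apply Submodule.sum_mem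
  intro i _
  by_cases hi : L i ∈ Submodule.span ℂ (L '' Y)
  · rw [hv _ hi, zero_smul]; exact M.zero_mem
  · exact M.smul_mem _ (hM _ _ (h2 i hi))

lemma exists_C_of_homogeneous_zero {g : MvPolynomial (Fin n) ℂ} (hg : g.IsHomogeneous 0) :
    ∃ a, g = C a :=
  ⟨_, totalDegree_eq_zero_iff_eq_C.mp (Nat.le_zero.mp hg.totalDegree_le)⟩

lemma mem_of_homogeneous (M : Submodule ℂ V) (q : MvPolynomial (Fin n) ℂ →ₗ[ℂ] V)
    (h : ∀ N g, g.IsHomogeneous N → q g ∈ M) (g : MvPolynomial (Fin n) ℂ) : q g ∈ M := by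
  rw [← sum_homogeneousComponent g, map_sum]
  exact Submodule.sum_mem _ fun i _ => h i _ (homogeneousComponent_isHomogeneous i g)

/-- All periods lie in the module generated by those attached to bases. -/
lemma PeriodSystem.mem_of_bases (M : Submodule ℂ V) (hM : ∀ i, ∀ x ∈ M, S.s i x ∈ M)
    (hb : ∀ C, IsBase L C → S.q C 1 ∈ M) {C : Finset ι} (hC : LinearIndepOn ℂ L (C : Set ι))
    (g : MvPolynomial (Fin n) ℂ) : S.q C g ∈ M := by
  apply mem_of_homogeneous
  intro N
  induction N generalizing C with
  | zero =>
    intro g hg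
    obtain ⟨a, rfl⟩ := exists_C_of_homogeneous_zero hg
    induction hk : n - C.card generalizing C with
    | zero =>
      rw [← mul_one (MvPolynomial.C a), ← smul_eq_C_mul, map_smul]
      exact M.smul_mem _ (hb C ⟨hC, by have := LinearIndepOn_card_le hC; omega⟩)
    | succ k ih =>
      have hne : Submodule.span ℂ (L '' (C : Set ι)) ≠ ⊤ := by
        intro h
        have := (isBase_of_span_eq_top hC h).2
        omega
      refine S.mem_of_step M hM hne subset_rfl (fun v => by rw [dirD_C, map_zero]; exact M.zero_mem)
        fun i hi => ?_
      refine ih ?_ ?_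
      · rw [Finset.coe_insert]; exact hC.insert hi
      · rw [Finset.card_insert_of_notMem (fun h => hi (Submodule.subset_span ⟨i, h, rfl⟩))]
        omega
  | succ N ihN =>
    intro g hg
    induction hk : n - C.card generalizing C with
    | zero =>
      have hCb : IsBase L C := ⟨hC, by have := LinearIndepOn_card_le hC; omega⟩
      obtain ⟨G, hG, hs⟩ := lin_decomp hCb.span_eq_top hg
      rw [hs, map_sum]
      apply Submodule.sum_mem
      intro c hc
      rw [S.erase _ _ _ hc]
      exact ihN (hC.mono (by simp)) _ (hG c)
    | succ k ih =>
      have hne : Submodule.span ℂ (L '' (C : Set ι)) ≠ ⊤ := by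
        intro h
        have := (isBase_of_span_eq_top hC h).2
        omega
      refine S.mem_of_step M hM hne subset_rfl (fun v => ihN hC _ (dirD_homogeneous hg))
        fun i hi => ?_
      refine ih ?_ ?_
      · rw [Finset.coe_insert]; exact hC.insert hi
      · rw [Finset.card_insert_of_notMem (fun h => hi (Submodule.subset_span ⟨i, h, rfl⟩))]
        omega

end Reduction

section Periods

variable {n r : ℕ} {L : Fin r → Fin n → ℂ}
  {Rf : Type} [CommRing Rf] [Algebra ℂ Rf] [Algebra (MvPolynomial (Fin n) ℂ) Rf]
  [IsScalarTower ℂ (MvPolynomial (Fin n) ℂ) Rf] {f : MvPolynomial (Fin n) ℂ}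
  {D : Fin n → Derivation ℂ Rf Rf} {pinv : Fin r → Rf} {d : Fin r → ℕ}

lemma exchange_inv (hp : ∀ i, algebraMap (MvPolynomial (Fin n) ℂ) Rf (lin (L i)) * pinv i = 1)
    (C : Finset (Fin r)) (i : Fin r) (hi : i ∉ C) (β : Fin r → ℂ) (hβ : L i = ∑ x ∈ C, β x • L x) :
    ∏ j ∈ C, pinv j = ∑ x ∈ C, β x • ∏ j ∈ insert i (C.erase x), pinv j := by
  have h1 : ∏ j ∈ C, pinv j =
      algebraMap (MvPolynomial (Fin n) ℂ) Rf (lin (L i)) * (pinv i * ∏ j ∈ C, pinv j) := by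
    rw [← mul_assoc, hp, one_mul]
  rw [h1, hβ, lin_sum, map_sum, Finset.sum_mul]
  refine Finset.sum_congr rfl fun x hx => ?_
  rw [Finset.prod_insert (fun h => hi (Finset.mem_of_mem_erase h)), lin_smul, map_mul,
    ← Finset.mul_prod_erase C pinv hx, Algebra.smul_def,
    IsScalarTower.algebraMap_apply ℂ (MvPolynomial (Fin n) ℂ) Rf]
  have := hp x
  simp only [MvPolynomial.algebraMap_eq]
  linear_combination (algebraMap (MvPolynomial (Fin n) ℂ) Rf (MvPolynomial.C (β x))) *
    (pinv i * ∏ j ∈ C.erase x, pinv j) * this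

lemma derivation_prod {κ : Type*} (δ : Derivation ℂ Rf Rf) {x b : κ → Rf}
    (h : ∀ i, δ (x i) = b i * x i) (C : Finset κ) :
    δ (∏ i ∈ C, x i) = (∑ i ∈ C, b i) * ∏ i ∈ C, x i := by
  classical
  induction C using Finset.induction_on with
  | empty => simp
  | insert a C ha ih =>
    rw [Finset.prod_insert ha, Finset.sum_insert ha, Derivation.leibniz, ih, h]
    simp only [smul_eq_mul]
    ring

/-- Derivative in the direction `v` on the localization. -/
def dirDer (D : Fin n → Derivation ℂ Rf Rf) (v : Fin n → ℂ) : Derivation ℂ Rf Rf :=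
  ∑ k, v k • D k

lemma dirDer_apply (v : Fin n → ℂ) (x : Rf) : dirDer D v x = ∑ k, v k • D k x := by
  rw [dirDer, ← Derivation.coeFnAddMonoidHom_apply, map_sum, Finset.sum_apply]
  rfl

lemma dirDer_algebraMap
    (hD : ∀ k (a : MvPolynomial (Fin n) ℂ), D k (algebraMap _ Rf a) = algebraMap _ Rf (pderiv k a))
    (v : Fin n → ℂ) (g : MvPolynomial (Fin n) ℂ) :
    dirDer D v (algebraMap _ Rf g) = algebraMap _ Rf (dirD v g) := by
  rw [dirDer_apply, dirD, map_sum]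
  refine Finset.sum_congr rfl fun k _ => ?_
  rw [hD]
  exact (map_smul (IsScalarTower.toAlgHom ℂ (MvPolynomial (Fin n) ℂ) Rf) _ _).symm

lemma dirDer_inv
    (hD : ∀ k (a : MvPolynomial (Fin n) ℂ), D k (algebraMap _ Rf a) = algebraMap _ Rf (pderiv k a))
    (hp : ∀ i, algebraMap (MvPolynomial (Fin n) ℂ) Rf (lin (L i)) * pinv i = 1)
    (v : Fin n → ℂ) (i : Fin r) :
    dirDer D v (pinv i) = -(algebraMap ℂ Rf (L i ⬝ᵥ v) * pinv i) * pinv i := by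
  have h1 := congrArg (dirDer D v) (hp i)
  rw [Derivation.leibniz, dirDer_algebraMap hD, Derivation.map_one_eq_zero, smul_eq_mul,
    smul_eq_mul] at h1
  have h2 : dirD v (lin (L i)) = MvPolynomial.C (L i ⬝ᵥ v) := by
    rw [dirD, dotProduct, map_sum]
    refine Finset.sum_congr rfl fun k _ => ?_
    rw [pderiv_lin, smul_eq_C_mul, ← MvPolynomial.C_mul, mul_comm]
  have h3 : algebraMap (MvPolynomial (Fin n) ℂ) Rf (dirD v (lin (L i))) =
      algebraMap ℂ Rf (L i ⬝ᵥ v) := by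
    rw [h2, IsScalarTower.algebraMap_apply ℂ (MvPolynomial (Fin n) ℂ) Rf]
    rfl
  rw [h3] at h1
  linear_combination pinv i * h1 - (dirDer D v (pinv i)) * hp i

variable (pinv) in
/-- The inverse of the product of powers of the linear forms. -/
def uinv (m : Fin r → ℕ) : Rf := ∏ i, pinv i ^ m i

lemma dirDer_period
    (hD : ∀ k (a : MvPolynomial (Fin n) ℂ), D k (algebraMap _ Rf a) = algebraMap _ Rf (pderiv k a))
    (hp : ∀ i, algebraMap (MvPolynomial (Fin n) ℂ) Rf (lin (L i)) * pinv i = 1)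
    {C : Finset (Fin r)} {v : Fin n → ℂ} (hv : ∀ c ∈ C, L c ⬝ᵥ v = 0) (m : Fin r → ℕ)
    (g : MvPolynomial (Fin n) ℂ) :
    dirDer D v (uinv pinv m * (algebraMap _ Rf g * ∏ i ∈ C, pinv i)) =
      uinv pinv m * (algebraMap _ Rf (dirD v g) * ∏ i ∈ C, pinv i) -
      ∑ i, (L i ⬝ᵥ v) • ((m i : ℂ) •
        (uinv pinv m * (algebraMap _ Rf g * ∏ i ∈ insert i C, pinv i))) := by
  have h1 : dirDer D v (∏ i ∈ C, pinv i) = 0 := by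
    rw [derivation_prod (dirDer D v) (dirDer_inv hD hp v) C, Finset.sum_eq_zero, zero_mul]
    intro c hc
    rw [hv c hc]
    simp
  have h2 : dirDer D v (uinv pinv m) =
      (∑ i, -((m i : Rf) * algebraMap ℂ Rf (L i ⬝ᵥ v) * pinv i)) * uinv pinv m := by
    rw [uinv, derivation_prod (dirDer D v) (b := fun i =>
      -((m i : Rf) * algebraMap ℂ Rf (L i ⬝ᵥ v) * pinv i))]
    intro i
    rw [Derivation.leibniz_pow, dirDer_inv hD hp]
    rcases Nat.eq_zero_or_pos (m i) with h | h
    · simp [h]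
    · rw [nsmul_eq_mul, smul_eq_mul]
      conv_rhs => rw [← Nat.sub_add_cancel h, pow_succ]
      rw [Nat.sub_add_cancel h]
      ring
  rw [Derivation.leibniz, Derivation.leibniz, h1, h2, dirDer_algebraMap hD]
  have h3 : ∑ i, (L i ⬝ᵥ v) • ((m i : ℂ) •
        (uinv pinv m * (algebraMap _ Rf g * ∏ i ∈ insert i C, pinv i))) =
      (∑ i, (m i : Rf) * algebraMap ℂ Rf (L i ⬝ᵥ v) * pinv i) *
        (uinv pinv m * (algebraMap _ Rf g * ∏ i ∈ C, pinv i)) := by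
    rw [Finset.sum_mul]
    refine Finset.sum_congr rfl fun i _ => ?_
    by_cases hi : i ∈ C
    · rw [hv i hi]; simp
    · rw [Finset.prod_insert hi, Algebra.smul_def, Algebra.smul_def, map_natCast]
      ring
  rw [h3, Finset.sum_neg_distrib]
  simp only [smul_eq_mul]
  ring

lemma twist_dirDer (h v : Fin n → ℂ) (x : Rf) :
    twistMap D h (fun k => v k • x) = dirDer D v x - (h ⬝ᵥ v) • x := by
  rw [twistMap_apply, Finset.sum_sub_distrib, dirDer_apply, dotProduct, Finset.sum_smul]
  congr 1
  · exact Finset.sum_congr rfl fun k _ => (D k).map_smul _ _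
  · exact Finset.sum_congr rfl fun k _ => by rw [smul_smul]

/-- The system of classes in the twisted cohomology. -/
def cohomologySystem
    (hD : ∀ k (a : MvPolynomial (Fin n) ℂ), D k (algebraMap _ Rf a) = algebraMap _ Rf (pderiv k a))
    (hp : ∀ i, algebraMap (MvPolynomial (Fin n) ℂ) Rf (lin (L i)) * pinv i = 1)
    {h : Fin n → ℂ}
    (hgen : ∀ Y : Set (Fin r), Submodule.span ℂ (L '' Y) ≠ ⊤ → h ∉ Submodule.span ℂ (L '' Y))
    (m : Fin r → ℕ) : PeriodSystem L (Rf ⧸ LinearMap.range (twistMap D h)) where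
  s i := (m i : ℂ) • LinearMap.id
  h := h
  q C := (LinearMap.range (twistMap D h)).mkQ ∘ₗ
    (LinearMap.mulLeft ℂ (uinv pinv m) ∘ₗ LinearMap.mulRight ℂ (∏ i ∈ C, pinv i)) ∘ₗ
      (IsScalarTower.toAlgHom ℂ (MvPolynomial (Fin n) ℂ) Rf).toLinearMap
  gen := hgen
  rel := by
    intro C v g hv
    have key := twist_dirDer (D := D) h v (uinv pinv m * (algebraMap _ Rf g * ∏ i ∈ C, pinv i))
    rw [dirDer_period hD hp hv] at key
    have h2 : (LinearMap.range (twistMap D h)).mkQ (twistMap D h (fun k => v k •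
        (uinv pinv m * (algebraMap _ Rf g * ∏ i ∈ C, pinv i)))) = 0 := by
      rw [Submodule.mkQ_apply, Submodule.Quotient.mk_eq_zero]
      exact ⟨_, rfl⟩
    rw [key, map_sub, sub_eq_zero, map_sub, map_sum] at h2
    simp only [map_smul] at h2
    exact h2.symm
  erase := by
    intro C c g hc
    simp only [LinearMap.comp_apply, LinearMap.mulLeft_apply, LinearMap.mulRight_apply,
      AlgHom.toLinearMap_apply, IsScalarTower.coe_toAlgHom', map_mul]
    rw [← Finset.mul_prod_erase C pinv hc]
    congr 2
    linear_combination (algebraMap (MvPolynomial (Fin n) ℂ) Rf g) * (∏ i ∈ C.erase c, pinv i) * hp c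

/-- Existence of twisted periods with prescribed values on the basic forms. -/
lemma exists_period [IsLocalization.Away f Rf] (hL : ∀ i, L i ≠ 0)
    (hf : f = ∏ i, lin (L i) ^ d i)
    (hD : ∀ k (a : MvPolynomial (Fin n) ℂ), D k (algebraMap _ Rf a) = algebraMap _ Rf (pderiv k a))
    (hp : ∀ i, algebraMap (MvPolynomial (Fin n) ℂ) Rf (lin (L i)) * pinv i = 1)
    {h : Fin n → ℂ}
    (hgen : ∀ Y : Set (Fin r), Submodule.span ℂ (L '' Y) ≠ ⊤ → h ∉ Submodule.span ℂ (L '' Y))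
    (m : Fin r → ℕ) (W : (Fin n → Fin r) → ℂ) (hW : ∀ c, (tmat L c).det = 0 → W c = 0) :
    ∃ J : Rf →ₗ[ℂ] ℂ, (∀ w, J (twistMap D h w) = 0) ∧ ∀ C, IsBase L C →
      J (uinv pinv m * ∏ i ∈ C, pinv i) = ∑ c, W c * resVal L c C := by
  classical
  let e : Finset (Fin r) → Rf := fun C => ∏ i ∈ C, pinv i
  have hex : ∀ c : Fin n → Fin r, ∃ Res : Rf →ₗ[ℂ] ℂ, (tmat L c).det ≠ 0 →
      (∀ k u, Res (D k u) = 0) ∧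
      (∀ C : Finset (Fin r), LinearIndepOn ℂ L (C : Set (Fin r)) → C.card = n →
        Res (∏ i ∈ C, pinv i) = resVal L c C) ∧
      (∀ C : Finset (Fin r), C.card = n → ∀ v (j : ℕ), j ≠ 0 →
        Res (algebraMap (MvPolynomial (Fin n) ℂ) Rf (lin v) ^ j * ∏ i ∈ C, pinv i) = 0) ∧
      (∀ u v, ∃ J : ℕ, ∀ j, J ≤ j →
        Res (algebraMap (MvPolynomial (Fin n) ℂ) Rf (lin v) ^ j * u) = 0) := by
    intro c
    by_cases hc : (tmat L c).det ≠ 0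
    · obtain ⟨Res, h⟩ := exists_residue (D := D) (pinv := pinv) hL hf hD hp hc
      exact ⟨Res, fun _ => h⟩
    · exact ⟨0, fun h => absurd h hc⟩
  choose Res hRes using hex
  let formSpan : Submodule ℂ Rf := Submodule.span ℂ (e '' {B | IsBase L B})
  let π := (LinearMap.range (twistMap D h)).mkQ
  have hdisj : ∀ σ ∈ formSpan, π σ = 0 → σ = 0 := by
    intro σ hσ h0
    obtain ⟨w, hw⟩ := (Submodule.Quotient.mk_eq_zero _).mp h0
    refine eq_zero_of_residues e (exchange_inv hp) Res
      (fun c hc C hC => (hRes c hc).2.1 C hC.1 hC.2) hσ fun c hc => ?_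
    obtain ⟨h1, _, h3, h4⟩ := hRes c hc
    rw [← hw]
    refine residue_eq_zero_of_twist hD h1 h (fun u => h4 u h) fun j hj => ?_
    rw [hw]
    clear hw h0
    induction hσ using Submodule.span_induction with
    | mem x hx => obtain ⟨C, hC, rfl⟩ := hx; exact h3 C hC.2 h j hj
    | zero => simp
    | add x y _ _ hx hy => rw [mul_add, map_add, hx, hy, add_zero]
    | smul a x _ hx => rw [mul_smul_comm, map_smul, hx, smul_zero]
  let T : formSpan →ₗ[ℂ] (Rf ⧸ LinearMap.range (twistMap D h)) :=
    π ∘ₗ LinearMap.mulLeft ℂ (uinv pinv m) ∘ₗ formSpan.subtype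
  let T0 : formSpan →ₗ[ℂ] (Rf ⧸ LinearMap.range (twistMap D h)) := π ∘ₗ formSpan.subtype
  have hfin : FiniteDimensional ℂ formSpan :=
    FiniteDimensional.span_of_finite ℂ (Set.toFinite _)
  have hT0 : Function.Injective T0 := by
    rw [injective_iff_map_eq_zero]
    intro σ hσ
    exact Subtype.ext (hdisj σ σ.2 hσ)
  have hle : LinearMap.range T0 ≤ LinearMap.range T := by
    have hall : ∀ σ ∈ formSpan, π σ ∈ LinearMap.range T := by
      intro σ hσ
      induction hσ using Submodule.span_induction with
      | mem x hx =>
        obtain ⟨C, hC, rfl⟩ := hx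
        have := (cohomologySystem hD hp hgen m).mem_of_bases (LinearMap.range T)
          (fun i x hx => Submodule.smul_mem _ _ hx) (fun C hC => ⟨⟨e C, Submodule.subset_span
            ⟨C, hC, rfl⟩⟩, by simp [cohomologySystem, T, e, π]⟩) hC.1 (∏ i, lin (L i) ^ m i)
        have h2 : uinv pinv m * (algebraMap _ Rf (∏ i, lin (L i) ^ m i) * e C) = e C := by
          rw [← mul_assoc, uinv, map_prod, ← Finset.prod_mul_distrib, Finset.prod_eq_one, one_mul]
          intro i _
          rw [map_pow, ← mul_pow, mul_comm, hp, one_pow]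
        rw [← h2]
        exact this
      | zero => rw [map_zero]; exact Submodule.zero_mem _
      | add x y _ _ hx hy => rw [map_add]; exact Submodule.add_mem _ hx hy
      | smul a x _ hx => rw [map_smul]; exact Submodule.smul_mem _ _ hx
    rintro _ ⟨σ, rfl⟩
    exact hall σ σ.2
  have hT : LinearMap.ker T = ⊥ := by
    have h1 := LinearMap.finrank_range_add_finrank_ker T
    have h2 := LinearMap.finrank_range_of_inj hT0
    have h3 := Submodule.finrank_mono hle
    rw [← Submodule.finrank_eq_zero (R := ℂ)]
    omega
  obtain ⟨G, hG⟩ := LinearMap.exists_leftInverse_of_injective T hT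
  refine ⟨(∑ c, W c • Res c) ∘ₗ formSpan.subtype ∘ₗ G ∘ₗ π, fun w => ?_, fun C hC => ?_⟩
  · have : π (twistMap D h w) = 0 := (Submodule.Quotient.mk_eq_zero _).mpr ⟨_, rfl⟩
    simp [this]
  · have h1 := LinearMap.congr_fun hG ⟨e C, Submodule.subset_span ⟨C, hC, rfl⟩⟩
    have h2 : G (π (uinv pinv m * ∏ i ∈ C, pinv i)) =
        ⟨e C, Submodule.subset_span ⟨C, hC, rfl⟩⟩ := h1
    simp only [LinearMap.comp_apply, h2, Submodule.subtype_apply, LinearMap.sum_apply,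
      LinearMap.smul_apply, smul_eq_mul]
    refine Finset.sum_congr rfl fun c _ => ?_
    by_cases hc : (tmat L c).det = 0
    · rw [hW c hc, zero_mul, zero_mul]
    · rw [(hRes c hc).2.1 C hC.1 hC.2]

end Periods

section Forests

variable {n : ℕ} {ι : Type} [DecidableEq ι] {L : ι → Fin n → ℂ}

variable (L) in
/-- The span of the forms indexed by a finite set. -/
def sp (C : Finset ι) : Submodule ℂ (Fin n → ℂ) := Submodule.span ℂ (L '' (C : Set ι))

lemma mem_sp {C : Finset ι} {i : ι} (h : i ∈ C) : L i ∈ sp L C :=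
  Submodule.subset_span ⟨i, h, rfl⟩

lemma sp_le {C : Finset ι} {U : Submodule ℂ (Fin n → ℂ)} (h : ∀ i ∈ C, L i ∈ U) : sp L C ≤ U := by
  rw [sp, Submodule.span_le]
  rintro _ ⟨i, hi, rfl⟩
  exact h i hi

lemma sp_mono {C C' : Finset ι} (h : C ⊆ C') : sp L C ≤ sp L C' :=
  sp_le fun _ hi => mem_sp (h hi)

lemma sp_union (C C' : Finset ι) : sp L (C ∪ C') = sp L C ⊔ sp L C' := by
  rw [sp, Finset.coe_union, Set.image_union, Submodule.span_union]
  rfl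

lemma sp_insert (i : ι) (C : Finset ι) : sp L (insert i C) = Submodule.span ℂ {L i} ⊔ sp L C := by
  rw [sp, Finset.coe_insert, Set.image_insert_eq, Submodule.span_insert]
  rfl

lemma sp_empty : sp L ∅ = ⊥ := by simp [sp]

lemma notMem_sup_of_disjoint {A U U' : Submodule ℂ (Fin n → ℂ)} {w : Fin n → ℂ} (hw : w ∈ U)
    (hA : A ≤ U) (hd : Disjoint U U') (h : w ∉ A) : w ∉ A ⊔ U' := by
  intro hmem
  obtain ⟨a, ha, u, hu, rfl⟩ := Submodule.mem_sup.mp hmem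
  have : u ∈ U := by simpa using U.sub_mem hw (hA ha)
  have hu0 : u = 0 := Submodule.disjoint_def.mp hd u this hu
  rw [hu0, add_zero] at h
  exact h ha

variable (L) in
/-- A set of forms which is not a direct sum of two proper parts. -/
def Conn (F : Finset ι) : Prop :=
  ∀ I ⊆ F, I.Nonempty → (F \ I).Nonempty → ¬ Disjoint (sp L I) (sp L (F \ I))

variable (L) in
/-- A forest structure on a basis `B` of the set of forms `F`. -/
structure Forest (F : Finset ι) (W : Submodule ℂ (Fin n → ℂ)) (Z : Finset ι) where
  B : Finset ι
  par : ι → Option ι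
  j : ι → ι
  sub : ι → Finset ι
  B_sub : B ⊆ F
  indep : LinearIndepOn ℂ L (B : Set ι)
  span : ∀ i ∈ F, L i ∈ sp L B
  mem_sub : ∀ b ∈ B, b ∈ sub b
  sub_sub : ∀ b ∈ B, sub b ⊆ B
  sub_trans : ∀ b ∈ B, ∀ c ∈ sub b, sub c ⊆ sub b
  par_of_mem : ∀ c ∈ B, ∀ b ∈ sub c, b ≠ c → ∃ p, par b = some p ∧ p ∈ sub c
  par_mem : ∀ b ∈ B, ∀ p, par b = some p → p ∈ B ∧ p ∉ sub b ∧ b ∈ sub p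
  laminar : ∀ b ∈ B, ∀ c ∈ B, ∀ x, x ∈ sub b → x ∈ sub c → b ∈ sub c ∨ c ∈ sub b
  sep : ∀ i ∈ F, ∃ c ∈ B, L i ∉ sp L (B.erase c) ∧ L i ∈ sp L (sub c)
  link : ∀ b ∈ B, ∀ p, par b = some p → L (j b) ∉ sp L (B.erase b) ∧ L (j b) ∉ sp L (B.erase p) ∧
    L (j b) ∈ sp L (sub p)
  root : ∀ b ∈ B, par b = none → ∃ z ∈ Z, L z ∉ sp L (B.erase b) ⊔ W
  conn : Conn L F → F.Nonempty → ∃ ρ ∈ B, sub ρ = B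

variable {F : Finset ι} {W : Submodule ℂ (Fin n → ℂ)} {Z : Finset ι}

/-- Two forests on complementary parts can be glued. -/
lemma Forest.glue {I I' : Finset ι} (hI : Disjoint (sp L I) (sp L I')) (hII : Disjoint I I')
    (hI0 : I.Nonempty) (hI'0 : I'.Nonempty)
    (T : Forest L I (W ⊔ sp L I') Z) (T' : Forest L I' (W ⊔ sp L I) Z) :
    Nonempty (Forest L (I ∪ I') W Z) := by
  have hB : ∀ b ∈ T.B, b ∈ I := fun b hb => T.B_sub hb
  have hB' : ∀ b ∈ T'.B, b ∉ I := fun b hb h => Finset.disjoint_left.mp hII h (T'.B_sub hb)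
  have hsp : sp L T.B = sp L I := le_antisymm (sp_mono T.B_sub) (sp_le T.span)
  have hsp' : sp L T'.B = sp L I' := le_antisymm (sp_mono T'.B_sub) (sp_le T'.span)
  have her : ∀ b ∈ T.B, sp L ((T.B ∪ T'.B).erase b) ≤ sp L (T.B.erase b) ⊔ sp L I' := by
    intro b _
    rw [Finset.erase_union_distrib, sp_union]
    exact sup_le_sup le_rfl (sp_mono ((Finset.erase_subset _ _).trans T'.B_sub))
  have her' : ∀ b ∈ T'.B, sp L ((T.B ∪ T'.B).erase b) ≤ sp L (T'.B.erase b) ⊔ sp L I := by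
    intro b _
    rw [Finset.erase_union_distrib, sp_union, sup_comm]
    exact sup_le_sup le_rfl (sp_mono ((Finset.erase_subset _ _).trans T.B_sub))
  have hn : ∀ b ∈ T.B, ∀ w ∈ sp L I, w ∉ sp L (T.B.erase b) → w ∉ sp L ((T.B ∪ T'.B).erase b) :=
    fun b hb w hw h hmem => notMem_sup_of_disjoint hw
      (sp_mono ((Finset.erase_subset _ _).trans T.B_sub)) hI h (her b hb hmem)
  have hn' : ∀ b ∈ T'.B, ∀ w ∈ sp L I', w ∉ sp L (T'.B.erase b) →
      w ∉ sp L ((T.B ∪ T'.B).erase b) :=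
    fun b hb w hw h hmem => notMem_sup_of_disjoint hw
      (sp_mono ((Finset.erase_subset _ _).trans T'.B_sub)) hI.symm h (her' b hb hmem)
  have hsI : ∀ b ∈ T.B, ∀ x ∈ T.sub b, x ∈ I := fun b hb x hx => hB _ (T.sub_sub b hb hx)
  have hsI' : ∀ b ∈ T'.B, ∀ x ∈ T'.sub b, x ∉ I := fun b hb x hx => hB' _ (T'.sub_sub b hb hx)
  refine ⟨{
    B := T.B ∪ T'.B
    par := fun b => if b ∈ I then T.par b else T'.par b
    j := fun b => if b ∈ I then T.j b else T'.j b
    sub := fun b => if b ∈ I then T.sub b else T'.sub b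
    B_sub := Finset.union_subset_union T.B_sub T'.B_sub
    indep := ?_
    span := ?_
    mem_sub := ?_
    sub_sub := ?_
    sub_trans := ?_
    par_of_mem := ?_
    par_mem := ?_
    laminar := ?_
    sep := ?_
    link := ?_
    root := ?_
    conn := ?_ }⟩
  · rw [Finset.coe_union]
    apply LinearIndepOn.union T.indep T'.indep
    change Disjoint (sp L T.B) (sp L T'.B)
    rw [hsp, hsp']
    exact hI
  · intro i hi
    rcases Finset.mem_union.mp hi with hi | hi
    · exact sp_mono Finset.subset_union_left (T.span i hi)
    · exact sp_mono Finset.subset_union_right (T'.span i hi)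
  · intro b hb
    rcases Finset.mem_union.mp hb with hb | hb
    · simp only [hB b hb, if_true]; exact T.mem_sub b hb
    · simp only [hB' b hb, if_false]; exact T'.mem_sub b hb
  · intro b hb
    rcases Finset.mem_union.mp hb with hb | hb
    · simp only [hB b hb, if_true]; exact (T.sub_sub b hb).trans Finset.subset_union_left
    · simp only [hB' b hb, if_false]; exact (T'.sub_sub b hb).trans Finset.subset_union_right
  · intro b hb c
    rcases Finset.mem_union.mp hb with hb | hb
    · simp only [hB b hb, if_true]
      intro hc
      simp only [hsI b hb c hc, if_true]
      exact T.sub_trans b hb c hc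
    · simp only [hB' b hb, if_false]
      intro hc
      simp only [hsI' b hb c hc, if_false]
      exact T'.sub_trans b hb c hc
  · intro c hc b
    rcases Finset.mem_union.mp hc with hc | hc
    · simp only [hB c hc, if_true]
      intro hb
      simp only [hsI c hc b hb, if_true]
      exact T.par_of_mem c hc b hb
    · simp only [hB' c hc, if_false]
      intro hb
      simp only [hsI' c hc b hb, if_false]
      exact T'.par_of_mem c hc b hb
  · intro b hb p
    rcases Finset.mem_union.mp hb with hb | hb
    · simp only [hB b hb, if_true]
      intro hp
      obtain ⟨h1, h2, h3⟩ := T.par_mem b hb p hp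
      simp only [hB p h1, if_true]
      exact ⟨Finset.mem_union_left _ h1, h2, h3⟩
    · simp only [hB' b hb, if_false]
      intro hp
      obtain ⟨h1, h2, h3⟩ := T'.par_mem b hb p hp
      simp only [hB' p h1, if_false]
      exact ⟨Finset.mem_union_right _ h1, h2, h3⟩
  · intro b hb c hc x
    rcases Finset.mem_union.mp hb with hb | hb <;> rcases Finset.mem_union.mp hc with hc | hc
    · simp only [hB b hb, hB c hc, if_true]
      exact T.laminar b hb c hc x
    · simp only [hB b hb, hB' c hc, if_true, if_false]
      intro h1 h2
      exact absurd (hsI b hb x h1) (hsI' c hc x h2)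
    · simp only [hB' b hb, hB c hc, if_true, if_false]
      intro h1 h2
      exact absurd (hsI c hc x h2) (hsI' b hb x h1)
    · simp only [hB' b hb, hB' c hc, if_false]
      exact T'.laminar b hb c hc x
  · intro i hi
    rcases Finset.mem_union.mp hi with hi | hi
    · obtain ⟨c, hc, h1, h2⟩ := T.sep i hi
      refine ⟨c, Finset.mem_union_left _ hc, hn c hc _ (mem_sp hi) h1, ?_⟩
      simp only [hB c hc, if_true]; exact h2
    · obtain ⟨c, hc, h1, h2⟩ := T'.sep i hi
      refine ⟨c, Finset.mem_union_right _ hc, hn' c hc _ (mem_sp hi) h1, ?_⟩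
      simp only [hB' c hc, if_false]; exact h2
  · intro b hb p
    rcases Finset.mem_union.mp hb with hb | hb
    · simp only [hB b hb, if_true]
      intro hp
      obtain ⟨h1, h2, h3⟩ := T.link b hb p hp
      have hpB := (T.par_mem b hb p hp).1
      have hw : L (T.j b) ∈ sp L I := sp_mono ((T.sub_sub p hpB).trans T.B_sub) h3
      simp only [hB p hpB, if_true]
      exact ⟨hn b hb _ hw h1, hn p hpB _ hw h2, h3⟩
    · simp only [hB' b hb, if_false]
      intro hp
      obtain ⟨h1, h2, h3⟩ := T'.link b hb p hp
      have hpB := (T'.par_mem b hb p hp).1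
      have hw : L (T'.j b) ∈ sp L I' := sp_mono ((T'.sub_sub p hpB).trans T'.B_sub) h3
      simp only [hB' p hpB, if_false]
      exact ⟨hn' b hb _ hw h1, hn' p hpB _ hw h2, h3⟩
  · intro b hb
    rcases Finset.mem_union.mp hb with hb | hb
    · simp only [hB b hb, if_true]
      intro hp
      obtain ⟨z, hz, h⟩ := T.root b hb hp
      refine ⟨z, hz, fun hmem => h ?_⟩
      have h' := sup_le_sup_right (her b hb) W hmem
      rwa [sup_assoc, sup_comm (sp L I')] at h'
    · simp only [hB' b hb, if_false]
      intro hp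
      obtain ⟨z, hz, h⟩ := T'.root b hb hp
      refine ⟨z, hz, fun hmem => h ?_⟩
      have h' := sup_le_sup_right (her' b hb) W hmem
      rwa [sup_assoc, sup_comm (sp L I)] at h'
  · intro hc _
    have hd : (I ∪ I') \ I = I' := by
      rw [Finset.union_sdiff_left, Finset.sdiff_eq_self_of_disjoint hII.symm]
    exact absurd (by rw [hd]; exact hI)
      (hc I Finset.subset_union_left hI0 (by rw [hd]; exact hI'0))

/-- A forest on a hyperplane section of a connected set is completed by a root. -/
lemma Forest.addRoot {F' : Finset ι} {ρ z : ι} (hρ : ρ ∈ F) (hF' : F' ⊆ F)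
    (hρF' : L ρ ∉ sp L F') (hmem : ∀ i ∈ F, L i ∈ sp L F' → i ∈ F')
    (hspan : ∀ i ∈ F, L i ∈ Submodule.span ℂ {L ρ} ⊔ sp L F')
    (hz : z ∈ Z) (hzW : L z ∉ sp L F' ⊔ W)
    (T : Forest L F' (Submodule.span ℂ {L ρ}) (F \ F')) : Nonempty (Forest L F W Z) := by
  have hρ0 : L ρ ≠ 0 := fun h => hρF' (h ▸ Submodule.zero_mem _)
  have hdis : Disjoint (sp L F') (Submodule.span ℂ {L ρ}) :=
    (Submodule.disjoint_span_singleton' hρ0).mpr hρF'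
  have hsp : sp L T.B = sp L F' := le_antisymm (sp_mono T.B_sub) (sp_le T.span)
  have hρB : ρ ∉ T.B := fun h => hρF' (mem_sp (T.B_sub h))
  have hne : ∀ b ∈ T.B, b ≠ ρ := fun b hb h => hρB (h ▸ hb)
  have her : ∀ b ∈ T.B, sp L ((insert ρ T.B).erase b) =
      sp L (T.B.erase b) ⊔ Submodule.span ℂ {L ρ} := by
    intro b hb
    rw [Finset.erase_insert_of_ne (hne b hb).symm, sp_insert, sup_comm]
  have hn : ∀ b ∈ T.B, ∀ w ∈ sp L F', w ∉ sp L (T.B.erase b) → w ∉ sp L ((insert ρ T.B).erase b) :=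
    fun b hb w hw h hm => notMem_sup_of_disjoint hw
      (sp_mono ((Finset.erase_subset _ _).trans T.B_sub)) hdis h (her b hb ▸ hm)
  have hroot : ∀ b, ∃ y, b ∈ T.B → T.par b = none →
      y ∈ F \ F' ∧ L y ∉ sp L (T.B.erase b) ⊔ Submodule.span ℂ {L ρ} := by
    intro b
    by_cases h : b ∈ T.B ∧ T.par b = none
    · obtain ⟨y, hy, hy'⟩ := T.root b h.1 h.2
      exact ⟨y, fun _ _ => ⟨hy, hy'⟩⟩
    · exact ⟨b, fun h1 h2 => absurd ⟨h1, h2⟩ h⟩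
  choose y hy using hroot
  have hfull : ∀ i ∈ F, L i ∈ sp L (insert ρ T.B) := by
    intro i hi
    rw [sp_insert, hsp]
    exact hspan i hi
  have hsubne : ∀ b ∈ T.B, ∀ x ∈ T.sub b, x ≠ ρ := fun b hb x hx => hne x (T.sub_sub b hb hx)
  refine ⟨{
    B := insert ρ T.B
    par := fun b => if b = ρ then none else some ((T.par b).getD ρ)
    j := fun b => if T.par b = none then y b else T.j b
    sub := fun b => if b = ρ then insert ρ T.B else T.sub b
    B_sub := Finset.insert_subset hρ (T.B_sub.trans hF')
    indep := ?_
    span := hfull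
    mem_sub := ?_
    sub_sub := ?_
    sub_trans := ?_
    par_of_mem := ?_
    par_mem := ?_
    laminar := ?_
    sep := ?_
    link := ?_
    root := ?_
    conn := fun _ _ => ⟨ρ, Finset.mem_insert_self _ _, if_pos rfl⟩ }⟩
  · rw [Finset.coe_insert]
    exact T.indep.insert (show L ρ ∉ sp L T.B by rw [hsp]; exact hρF')
  · intro b hb
    rcases Finset.mem_insert.mp hb with rfl | hb
    · simp
    · simp only [hne b hb, if_false]; exact T.mem_sub b hb
  · intro b hb
    rcases Finset.mem_insert.mp hb with rfl | hb
    · simp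
    · simp only [hne b hb, if_false]; exact (T.sub_sub b hb).trans (Finset.subset_insert _ _)
  · intro b hb c
    rcases Finset.mem_insert.mp hb with rfl | hb
    · simp only [if_true]
      intro hc
      rcases Finset.mem_insert.mp hc with rfl | hc
      · simp
      · simp only [hne c hc, if_false]; exact (T.sub_sub c hc).trans (Finset.subset_insert _ _)
    · simp only [hne b hb, if_false]
      intro hc
      simp only [hsubne b hb c hc, if_false]
      exact T.sub_trans b hb c hc
  · intro c hc b
    rcases Finset.mem_insert.mp hc with rfl | hc
    · simp only [if_true]
      intro hb hbc
      simp only [hbc, if_false]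
      refine ⟨_, rfl, ?_⟩
      have hb' : b ∈ T.B := Finset.mem_of_mem_insert_of_ne hb hbc
      cases hpar : T.par b with
      | none => simp
      | some p => exact Finset.mem_insert_of_mem (T.par_mem b hb' p hpar).1
    · simp only [hne c hc, if_false]
      intro hb hbc
      simp only [hsubne c hc b hb, if_false]
      obtain ⟨p, hp, hp'⟩ := T.par_of_mem c hc b hb hbc
      exact ⟨p, by simp [hp], hp'⟩
  · intro b hb p
    rcases Finset.mem_insert.mp hb with rfl | hb
    · simp
    · simp only [hne b hb, if_false, Option.some.injEq]
      rintro rfl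
      cases hpar : T.par b with
      | none =>
        simp only [Option.getD_none, if_true]
        exact ⟨Finset.mem_insert_self _ _, fun h => hsubne b hb _ h rfl, Finset.mem_insert_of_mem hb⟩
      | some p =>
        obtain ⟨h1, h2, h3⟩ := T.par_mem b hb p hpar
        simp only [Option.getD_some, hne p h1, if_false]
        exact ⟨Finset.mem_insert_of_mem h1, h2, h3⟩
  · intro b hb c hc x h1 h2
    rcases Finset.mem_insert.mp hb with rfl | hb'
    · right; simpa using hc
    rcases Finset.mem_insert.mp hc with rfl | hc'
    · left; simp [hb']
    · simp only [hne b hb', if_false] at h1 ⊢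
      simp only [hne c hc', if_false] at h2 ⊢
      exact T.laminar b hb' c hc' x h1 h2
  · intro i hi
    by_cases hiF : i ∈ F'
    · obtain ⟨c, hc, h1, h2⟩ := T.sep i hiF
      refine ⟨c, Finset.mem_insert_of_mem hc, hn c hc _ (mem_sp hiF) h1, ?_⟩
      simp only [hne c hc, if_false]; exact h2
    · refine ⟨ρ, Finset.mem_insert_self _ _, ?_, ?_⟩
      · rw [Finset.erase_insert hρB, hsp]
        exact fun h => hiF (hmem i hi h)
      · simp only [if_true]; exact hfull i hi
  · intro b hb p
    rcases Finset.mem_insert.mp hb with rfl | hb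
    · simp
    · simp only [hne b hb, if_false, Option.some.injEq]
      rintro rfl
      cases hpar : T.par b with
      | none =>
        obtain ⟨h1, h2⟩ := hy b hb hpar
        rw [Finset.mem_sdiff] at h1
        simp only [Option.getD_none, if_true]
        refine ⟨by rw [her b hb]; exact h2, ?_, hfull _ h1.1⟩
        rw [Finset.erase_insert hρB, hsp]
        exact fun h => h1.2 (hmem _ h1.1 h)
      | some p =>
        obtain ⟨h1, h2, h3⟩ := T.link b hb p hpar
        have hpB := (T.par_mem b hb p hpar).1
        have hw : L (T.j b) ∈ sp L F' := sp_mono ((T.sub_sub p hpB).trans T.B_sub) h3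
        simp only [Option.getD_some, hne p hpB, if_false, reduceCtorEq]
        exact ⟨hn b hb _ hw h1, hn p hpB _ hw h2, h3⟩
  · intro b hb
    rcases Finset.mem_insert.mp hb with rfl | hb
    · intro _
      refine ⟨z, hz, ?_⟩
      rw [Finset.erase_insert hρB, hsp]
      exact hzW
    · simp [hne b hb]

lemma exists_basis_of_finset (F : Finset ι) :
    ∃ B ⊆ F, LinearIndepOn ℂ L (B : Set ι) ∧ sp L B = sp L F := by
  obtain ⟨b, hb, _, h2, h3⟩ := exists_linearIndepOn_extension (K := ℂ) (v := L) (s := ∅)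
    (t := (F : Set ι)) (by simp) (Set.empty_subset _)
  have hfin : b.Finite := F.finite_toSet.subset hb
  refine ⟨hfin.toFinset, by simpa using hb, by simpa using h3, ?_⟩
  apply le_antisymm
  · exact sp_mono (by simpa using hb)
  · rw [sp, sp, Submodule.span_le]
    simpa using h2

theorem exists_forest (hdis : Disjoint (sp L F) W) (hZ : ∀ z ∈ Z, L z ∈ sp L F ⊔ W)
    (hcond : ∀ I ⊆ F, I.Nonempty → Disjoint (sp L I) (sp L (F \ I)) →
      ∃ z ∈ Z, L z ∉ sp L (F \ I) ⊔ W) : Nonempty (Forest L F W Z) := by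
  induction hN : F.card using Nat.strong_induction_on generalizing F W Z with
  | _ N ih =>
  by_cases hF : F = ∅
  · subst hF
    exact ⟨{ B := ∅, par := fun _ => none, j := id, sub := fun _ => ∅, B_sub := by simp,
             indep := by simp, span := by simp, mem_sub := by simp, sub_sub := by simp,
             sub_trans := by simp, par_of_mem := by simp, par_mem := by simp, laminar := by simp,
             sep := by simp, link := by simp, root := by simp, conn := by simp }⟩
  have hF0 := Finset.nonempty_iff_ne_empty.mpr hF
  by_cases hc : Conn L F
  · obtain ⟨z, hz, hzW⟩ := hcond F subset_rfl hF0 (by simp [sp_empty])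
    rw [Finset.sdiff_self, sp_empty, bot_sup_eq] at hzW
    obtain ⟨B0, hB0, hind, hspB⟩ := exists_basis_of_finset (L := L) F
    obtain ⟨x, hx, w, hw, hxw⟩ := Submodule.mem_sup.mp (hZ z hz)
    rw [← hspB] at hx
    obtain ⟨β, hβ⟩ := exists_sum_of_mem_span hx
    have hρ : ∃ ρ ∈ B0, β ρ ≠ 0 := by
      by_contra h
      push Not at h
      apply hzW
      rw [← hxw, hβ, Finset.sum_eq_zero (fun b hb => by rw [h b hb, zero_smul]), zero_add]
      exact hw
    obtain ⟨ρ, hρ, hβρ⟩ := hρ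
    have hρn : L ρ ∉ sp L (B0.erase ρ) := notMem_span_erase hind hρ
    have hxn : x ∉ sp L (B0.erase ρ) := by
      intro h
      apply hρn
      rw [← Finset.add_sum_erase B0 _ hρ] at hβ
      have : L ρ = (β ρ)⁻¹ • (x - ∑ b ∈ B0.erase ρ, β b • L b) := by
        rw [hβ, add_sub_cancel_right, smul_smul, inv_mul_cancel₀ hβρ, one_smul]
      rw [this]
      apply Submodule.smul_mem
      apply Submodule.sub_mem _ h
      exact Submodule.sum_mem _ fun b hb => Submodule.smul_mem _ _ (mem_sp hb)
    classical
    set F' := F.filter (fun i => L i ∈ sp L (B0.erase ρ)) with hF'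
    have hspF' : sp L F' = sp L (B0.erase ρ) := by
      apply le_antisymm
      · exact sp_le fun i hi => (Finset.mem_filter.mp hi).2
      · exact sp_mono fun i hi =>
          Finset.mem_filter.mpr ⟨hB0 (Finset.mem_of_mem_erase hi), mem_sp hi⟩
    have hρF : ρ ∈ F := hB0 hρ
    have hρ' : ρ ∉ F' := fun h => hρn (Finset.mem_filter.mp h).2
    have hρ0 : L ρ ≠ 0 := fun h => hρn (h ▸ Submodule.zero_mem _)
    have hspan : ∀ i ∈ F, L i ∈ Submodule.span ℂ {L ρ} ⊔ sp L F' := by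
      intro i hi
      rw [hspF', ← sp_insert, Finset.insert_erase hρ, hspB]
      exact mem_sp hi
    have hdisρ : Disjoint (sp L F') (Submodule.span ℂ {L ρ}) := by
      rw [Submodule.disjoint_span_singleton' hρ0, hspF']
      exact hρn
    obtain ⟨T⟩ := ih F'.card (by
      rw [← hN]
      exact Finset.card_lt_card ((Finset.ssubset_iff_of_subset (Finset.filter_subset _ _)).mpr
        ⟨ρ, hρF, hρ'⟩)) (F := F') (W := Submodule.span ℂ {L ρ}) (Z := F \ F') hdisρ
      (fun i hi => by rw [sup_comm]; exact hspan i (Finset.mem_sdiff.mp hi).1) (by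
        intro I hI hI0 hId
        by_contra hall
        push Not at hall
        have h1 : sp L (F \ I) ≤ sp L (F' \ I) ⊔ Submodule.span ℂ {L ρ} := by
          refine sp_le fun i hi => ?_
          rw [Finset.mem_sdiff] at hi
          by_cases hiF : i ∈ F'
          · exact Submodule.mem_sup_left (mem_sp (Finset.mem_sdiff.mpr ⟨hiF, hi.2⟩))
          · exact hall i (Finset.mem_sdiff.mpr ⟨hi.1, hiF⟩)
        refine hc I (hI.trans (Finset.filter_subset _ _)) hI0
          ⟨ρ, Finset.mem_sdiff.mpr ⟨hρF, fun h => hρ' (hI h)⟩⟩ (Disjoint.mono_right h1 ?_)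
        apply Disjoint.disjoint_sup_right_of_disjoint_sup_left hId
        refine hdisρ.mono_left ?_
        exact sup_le (sp_mono hI) (sp_mono Finset.sdiff_subset)) rfl
    refine Forest.addRoot hρF (Finset.filter_subset _ _) (by rw [hspF']; exact hρn) ?_ hspan hz ?_ T
    · intro i hi h
      rw [hspF'] at h
      exact Finset.mem_filter.mpr ⟨hi, h⟩
    · rw [hspF']
      intro h
      obtain ⟨x', hx', w', hw', e⟩ := Submodule.mem_sup.mp h
      apply hxn
      have hx'B : x' ∈ sp L B0 := sp_mono (Finset.erase_subset _ _) hx'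
      have : x - x' = w' - w := by
        rw [← hxw] at e
        linear_combination (exp := 1) -e
      have h0 := Submodule.disjoint_def.mp hdis (x - x')
        (by rw [← hspB]; exact Submodule.sub_mem _ hx hx'B)
        (by rw [this]; exact W.sub_mem hw' hw)
      rw [sub_eq_zero.mp h0]
      exact hx'
  · unfold Conn at hc
    push Not at hc
    obtain ⟨I, hI, hI0, hI'0, hId⟩ := hc
    have hU : I ∪ (F \ I) = F := Finset.union_sdiff_of_subset hI
    have hspU : sp L I ⊔ sp L (F \ I) = sp L F := by rw [← sp_union, hU]
    have hcard1 : I.card < N := by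
      rw [← hN]
      refine Finset.card_lt_card ((Finset.ssubset_iff_of_subset hI).mpr ?_)
      obtain ⟨x, hx⟩ := hI'0
      exact ⟨x, Finset.mem_sdiff.mp hx⟩
    have hcard2 : (F \ I).card < N := by
      rw [← hN]
      refine Finset.card_lt_card ((Finset.ssubset_iff_of_subset Finset.sdiff_subset).mpr ?_)
      obtain ⟨x, hx⟩ := hI0
      exact ⟨x, hI hx, fun h => (Finset.mem_sdiff.mp h).2 hx⟩
    have aux : ∀ A A' : Finset ι, A ∪ A' = F → Disjoint A A' → Disjoint (sp L A) (sp L A') →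
        A.card < N → Nonempty (Forest L A (W ⊔ sp L A') Z) := by
      intro A A' hAA hAd hd hcard
      have hAF : A ⊆ F := hAA ▸ Finset.subset_union_left
      have hsA : sp L A ⊔ sp L A' = sp L F := by rw [← sp_union, hAA]
      refine ih A.card hcard ?_ ?_ ?_ rfl
      · rw [sup_comm]
        apply Disjoint.disjoint_sup_right_of_disjoint_sup_left hd
        rw [hsA]
        exact hdis
      · intro z hz
        rw [sup_comm W, ← sup_assoc, hsA]
        exact hZ z hz
      · intro I1 hI1 hI10 hI1d
        have hsd : F \ I1 = (A \ I1) ∪ A' := by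
          rw [← hAA, Finset.union_sdiff_distrib]
          congr 1
          exact Finset.sdiff_eq_self_of_disjoint (hAd.mono_left hI1).symm
        obtain ⟨z, hz, hz'⟩ := hcond I1 (hI1.trans hAF) hI10 (by
          rw [hsd, sp_union]
          apply Disjoint.disjoint_sup_right_of_disjoint_sup_left hI1d
          rw [← sp_union, Finset.union_sdiff_of_subset hI1]
          exact hd)
        refine ⟨z, hz, ?_⟩
        rw [hsd, sp_union, sup_assoc, sup_comm (sp L A')] at hz'
        exact hz'
    obtain ⟨T⟩ := aux I (F \ I) hU Finset.disjoint_sdiff hId hcard1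
    obtain ⟨T'⟩ := aux (F \ I) I (by rw [Finset.union_comm, hU]) Finset.sdiff_disjoint hId.symm hcard2
    rw [← hU]
    exact Forest.glue hId Finset.disjoint_sdiff hI0 hI'0 T T'

end Forests

section Regularity

variable {n : ℕ} {ι : Type} [Fintype ι] [DecidableEq ι] {L : ι → Fin n → ℂ} {V : Type}
  [AddCommGroup V] [Module ℂ V] {S : PeriodSystem L V}

lemma exists_dual {C : Finset ι} (hC : LinearIndepOn ℂ L (C : Set ι)) :
    ∃ v : ι → Fin n → ℂ, ∀ x ∈ C, ∀ y ∈ C, L x ⬝ᵥ v y = if x = y then 1 else 0 := by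
  have : ∀ y, ∃ v : Fin n → ℂ, y ∈ C → ∀ x ∈ C, L x ⬝ᵥ v = if x = y then 1 else 0 := by
    intro y
    by_cases hy : y ∈ C
    · obtain ⟨v, h1, h2⟩ := exists_dot_ne_zero (notMem_span_erase hC hy)
      refine ⟨(L y ⬝ᵥ v)⁻¹ • v, fun _ x hx => ?_⟩
      rw [dotProduct_smul]
      split_ifs with h
      · rw [h, smul_eq_mul, inv_mul_cancel₀ h2]
      · rw [h1 _ (Submodule.subset_span ⟨x, by simp [h, hx], rfl⟩), smul_zero]
    · exact ⟨0, fun h => absurd h hy⟩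
  choose v hv using this
  exact ⟨v, fun x hx y hy => hv y hy x hx⟩

lemma dot_eq_of_mem_sp {C : Finset ι} {v v' : Fin n → ℂ} (h : ∀ c ∈ C, L c ⬝ᵥ v = L c ⬝ᵥ v')
    {w : Fin n → ℂ} (hw : w ∈ sp L C) : w ⬝ᵥ v = w ⬝ᵥ v' := by
  rw [← sub_eq_zero, ← dotProduct_sub]
  refine dot_eq_zero_of_mem_span (Y := (C : Set ι)) (fun c hc => ?_) hw
  rw [dotProduct_sub, sub_eq_zero]
  exact h c hc

lemma finrank_sp {C : Finset ι} (hC : LinearIndepOn ℂ L (C : Set ι)) :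
    Module.finrank ℂ (sp L C) = C.card := by
  have h1 : Module.finrank ℂ (Submodule.span ℂ (Set.range fun i : C => L i)) = C.card := by
    rw [finrank_span_eq_card (b := fun i : C => L i) hC]
    simp
  rw [sp, Set.image_eq_range]
  exact h1

lemma sp_eq_of_card {C X : Finset ι} (hC : LinearIndepOn ℂ L (C : Set ι)) (hCX : C ⊆ X)
    (h : Module.finrank ℂ (sp L X) ≤ C.card) : sp L C = sp L X :=
  Submodule.eq_of_le_of_finrank_le (sp_mono hCX) (by rw [finrank_sp hC]; exact h)

lemma linearIndepOn_union {K C : Finset ι} (hK : LinearIndepOn ℂ L (K : Set ι))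
    (hC : LinearIndepOn ℂ L (C : Set ι)) (h : Disjoint (sp L K) (sp L C)) :
    LinearIndepOn ℂ L ((K ∪ C : Finset ι) : Set ι) := by
  rw [Finset.coe_union]
  exact hK.union hC h

lemma disjoint_sp {K C : Finset ι} (h : LinearIndepOn ℂ L ((K ∪ C : Finset ι) : Set ι))
    (hd : Disjoint K C) : Disjoint (sp L K) (sp L C) := by
  rw [Finset.coe_union] at h
  exact ((linearIndepOn_union_iff (by exact_mod_cast hd)).mp h).2.2

lemma isBase_union {K C : Finset ι} (hK : LinearIndepOn ℂ L (K : Set ι))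
    (hC : LinearIndepOn ℂ L (C : Set ι)) (h : Disjoint (sp L K) (sp L C))
    (ht : sp L K ⊔ sp L C = ⊤) : IsBase L (K ∪ C) :=
  isBase_of_span_eq_top (linearIndepOn_union hK hC h) (by rw [← ht, ← sp_union]; rfl)

variable (S) in
/-- Periods of independent sets not spanning `X` are in `M`, in degree `N`. -/
def SmallReg (M : Submodule ℂ V) (X : Finset ι) (N : ℕ) : Prop :=
  ∀ C : Finset ι, LinearIndepOn ℂ L (C : Set ι) → sp L (C ∩ X) ≠ sp L X → ∀ g,
    IsHomogeneous g N → S.q C g ∈ M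

variable (S) in
/-- Combinations of periods regular for all completions stay in `M`, in degree `N`. -/
def FamilyReg (M : Submodule ℂ V) (X : Finset ι) (N : ℕ) : Prop :=
  ∀ (A : Finset ι) (K : ι → Finset ι) (α : ι → V →ₗ[ℂ] V), (∀ j ∈ A, K j ⊆ X) →
    (∀ j ∈ A, LinearIndepOn ℂ L (K j : Set ι)) → (∀ j ∈ A, sp L (K j) = sp L X) →
    (∀ j ∈ A, ∀ x ∈ M, α j x ∈ M) → (∀ j ∈ A, ∀ i x, α j (S.s i x) = S.s i (α j x)) →
    (∀ C : Finset ι, LinearIndepOn ℂ L (C : Set ι) → Disjoint (sp L X) (sp L C) →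
      sp L X ⊔ sp L C = ⊤ → ∑ j ∈ A, α j (S.q (K j ∪ C) 1) ∈ M) →
    ∀ C : Finset ι, LinearIndepOn ℂ L (C : Set ι) → Disjoint (sp L X) (sp L C) →
      ∀ g, IsHomogeneous g N → ∑ j ∈ A, α j (S.q (K j ∪ C) g) ∈ M

lemma dirD_mem {M : Submodule ℂ V} {N : ℕ} {Q : MvPolynomial (Fin n) ℂ →ₗ[ℂ] V}
    (h : ∀ N' < N, ∀ g, IsHomogeneous g N' → Q g ∈ M) {g : MvPolynomial (Fin n) ℂ}
    (hg : g.IsHomogeneous N) (v : Fin n → ℂ) : Q (dirD v g) ∈ M := by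
  rcases Nat.eq_zero_or_pos N with rfl | hN
  · obtain ⟨a, rfl⟩ := exists_C_of_homogeneous_zero hg
    rw [dirD_C, map_zero]
    exact M.zero_mem
  · exact h (N - 1) (by omega) _ (dirD_homogeneous hg)

lemma familyReg_step (M : Submodule ℂ V) (hM : ∀ i, ∀ x ∈ M, S.s i x ∈ M) {X : Finset ι}
    {N : ℕ} (ihb : ∀ N' < N, SmallReg S M X N') (ihc : ∀ N' < N, FamilyReg S M X N') :
    FamilyReg S M X N := by
  intro A K α hKX hKi hKs hα hcomm hcompl C hC hd
  let Q : Finset ι → MvPolynomial (Fin n) ℂ →ₗ[ℂ] V := fun C => ∑ j ∈ A, α j ∘ₗ S.q (K j ∪ C)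
  have hQ : ∀ C g, Q C g = ∑ j ∈ A, α j (S.q (K j ∪ C) g) := fun C g => by
    simp [Q]
  have hlow : ∀ C : Finset ι, LinearIndepOn ℂ L (C : Set ι) → Disjoint (sp L X) (sp L C) →
      ∀ N' < N, ∀ g, IsHomogeneous g N' → Q C g ∈ M := by
    intro C hC hd N' hN' g hg
    rw [hQ]
    exact ihc N' hN' A K α hKX hKi hKs hα hcomm hcompl C hC hd g hg
  suffices h : ∀ g, IsHomogeneous g N → Q C g ∈ M by
    intro g hg
    rw [← hQ]
    exact h g hg
  induction hk : n - C.card using Nat.strong_induction_on generalizing C with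
  | _ k ih =>
  subst hk
  intro g hg
  by_cases ht : sp L X ⊔ sp L C = ⊤
  · rcases Nat.eq_zero_or_pos N with rfl | hN
    · obtain ⟨a, rfl⟩ := exists_C_of_homogeneous_zero hg
      rw [← mul_one (MvPolynomial.C a), ← smul_eq_C_mul, map_smul, hQ]
      exact M.smul_mem _ (hcompl C hC hd ht)
    · obtain ⟨N, rfl⟩ : ∃ N', N = N' + 1 := ⟨N - 1, by omega⟩
      rcases A.eq_empty_or_nonempty with rfl | ⟨j0, hj0⟩
      · rw [hQ, Finset.sum_empty]; exact M.zero_mem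
      have hKC : ∀ j ∈ A, Disjoint (K j) C := by
        intro j hj
        rw [Finset.disjoint_left]
        intro x hx hxC
        have := Submodule.disjoint_def.mp hd (L x) (mem_sp (hKX j hj hx)) (mem_sp hxC)
        exact hC.ne_zero hxC this
      have hspan : Submodule.span ℂ (L '' ((K j0 ∪ C : Finset ι) : Set ι)) = ⊤ := by
        change sp L (K j0 ∪ C) = ⊤
        rw [sp_union, hKs j0 hj0, ht]
      obtain ⟨G, hG, hs⟩ := lin_decomp hspan hg
      rw [hs, map_sum]
      apply Submodule.sum_mem
      intro c hc
      rcases Finset.mem_union.mp hc with hc | hc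
      · rw [hQ]
        apply Submodule.sum_mem
        intro j hj
        apply hα j hj
        have hcX : L c ∈ sp L (K j) := by rw [hKs j hj]; exact mem_sp (hKX j0 hj0 hc)
        obtain ⟨β, hβ⟩ := exists_sum_of_mem_span hcX
        rw [hβ, lin_sum, Finset.sum_mul, map_sum]
        apply Submodule.sum_mem
        intro x hx
        rw [lin_smul, mul_assoc, ← smul_eq_C_mul, map_smul, S.erase _ _ _ (Finset.mem_union_left _ hx)]
        apply M.smul_mem
        have hind := linearIndepOn_union (hKi j hj) hC (by rw [hKs j hj]; exact hd)
        refine ihb N (by omega) _ (hind.mono (by simp)) ?_ _ (hG c)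
        have hsub : (K j ∪ C).erase x ∩ X ⊆ (K j).erase x := by
          intro y hy
          simp only [Finset.mem_inter, Finset.mem_erase, Finset.mem_union] at hy ⊢
          refine ⟨hy.1.1, hy.1.2.resolve_right fun hyC => ?_⟩
          exact hC.ne_zero hyC (Submodule.disjoint_def.mp hd _ (mem_sp hy.2) (mem_sp hyC))
        intro h
        have : L x ∈ sp L ((K j).erase x) :=
          sp_mono hsub (h ▸ mem_sp (hKX j hj hx))
        exact notMem_span_erase (hKi j hj) hx this
      · have : Q C (lin (L c) * G c) = Q (C.erase c) (G c) := by
          rw [hQ, hQ]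
          refine Finset.sum_congr rfl fun j hj => ?_
          rw [S.erase _ _ _ (Finset.mem_union_right _ hc), Finset.erase_union_distrib,
            Finset.erase_eq_of_notMem (Finset.disjoint_right.mp (hKC j hj) hc)]
        rw [this]
        exact hlow _ (hC.mono (by simp)) (hd.mono_right (sp_mono (Finset.erase_subset _ _))) N
          (by omega) _ (hG c)
  · have hY : Submodule.span ℂ (L '' ((X ∪ C : Finset ι) : Set ι)) ≠ ⊤ := by
      change sp L (X ∪ C) ≠ ⊤
      rwa [sp_union]
    obtain ⟨v, hv, hv'⟩ := exists_dot_ne_zero (S.gen _ hY)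
    have hrel : (S.h ⬝ᵥ v) • Q C g = Q C (dirD v g) -
        ∑ i, (L i ⬝ᵥ v) • S.s i (Q (insert i C) g) := by
      simp only [hQ, Finset.smul_sum, map_sum]
      rw [Finset.sum_comm, ← Finset.sum_sub_distrib]
      refine Finset.sum_congr rfl fun j hj => ?_
      rw [← map_smul, S.rel (K j ∪ C) v g, map_sub, map_sum]
      · congr 1
        refine Finset.sum_congr rfl fun i _ => ?_
        rw [map_smul, hcomm j hj, Finset.union_insert]
      · intro c hc
        apply hv
        apply Submodule.subset_span
        refine ⟨c, ?_, rfl⟩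
        exact Finset.mem_coe.mpr (Finset.union_subset_union (hKX j hj) subset_rfl hc)
    have : Q C g = (S.h ⬝ᵥ v)⁻¹ • ((S.h ⬝ᵥ v) • Q C g) := by
      rw [smul_smul, inv_mul_cancel₀ hv', one_smul]
    rw [this, hrel]
    apply Submodule.smul_mem
    apply Submodule.sub_mem _ (dirD_mem (hlow C hC hd) hg v)
    apply Submodule.sum_mem
    intro i _
    by_cases hi : L i ∈ sp L (X ∪ C)
    · rw [hv _ hi, zero_smul]; exact M.zero_mem
    · apply M.smul_mem _ (hM _ _ _)
      have hiC : L i ∉ sp L C := fun h => hi (sp_mono Finset.subset_union_right h)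
      have hiC' : i ∉ C := fun h => hiC (mem_sp h)
      have hins : LinearIndepOn ℂ L ((insert i C : Finset ι) : Set ι) := by
        rw [Finset.coe_insert]; exact hC.insert hiC
      have hle := LinearIndepOn_card_le hins
      rw [Finset.card_insert_of_notMem hiC'] at hle
      refine ih (n - (insert i C).card) ?_ (insert i C) hins ?_ rfl g hg
      · rw [Finset.card_insert_of_notMem hiC']; omega
      · rw [sp_insert, sup_comm]
        apply Disjoint.disjoint_sup_right_of_disjoint_sup_left hd
        rw [← sp_union]
        have hi0 : L i ≠ 0 := fun h => hi (h ▸ Submodule.zero_mem _)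
        exact (Submodule.disjoint_span_singleton' hi0).mpr hi

lemma smallReg_step (hs : ∀ i j x, S.s i (S.s j x) = S.s j (S.s i x)) (M : Submodule ℂ V)
    (hM : ∀ i, ∀ x ∈ M, S.s i x ∈ M) {X : Finset ι}
    (h1 : ∀ C, IsBase L C → sp L (C ∩ X) ≠ sp L X → S.q C 1 ∈ M)
    (h2 : ∀ C : Finset ι, LinearIndepOn ℂ L (C : Set ι) → C.card + 1 = n → ∀ v : Fin n → ℂ,
      (∀ c ∈ C, L c ⬝ᵥ v = 0) → ∑ i ∈ X, (L i ⬝ᵥ v) • S.s i (S.q (insert i C) 1) ∈ M)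
    {N : ℕ} (ihb : ∀ N' < N, SmallReg S M X N') (hc : FamilyReg S M X N) : SmallReg S M X N := by
  intro C hC hCX
  induction hk : n - C.card using Nat.strong_induction_on generalizing C with
  | _ k ih =>
  subst hk
  intro g hg
  by_cases ht : sp L C = ⊤
  · have hCb := isBase_of_span_eq_top hC ht
    rcases Nat.eq_zero_or_pos N with rfl | hN
    · obtain ⟨a, rfl⟩ := exists_C_of_homogeneous_zero hg
      rw [← mul_one (MvPolynomial.C a), ← smul_eq_C_mul, map_smul]
      exact M.smul_mem _ (h1 C hCb hCX)
    · obtain ⟨N, rfl⟩ : ∃ N', N = N' + 1 := ⟨N - 1, by omega⟩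
      obtain ⟨G, hG, hs'⟩ := lin_decomp ht hg
      rw [hs', map_sum]
      apply Submodule.sum_mem
      intro c hc
      rw [S.erase _ _ _ hc]
      refine ihb N (by omega) _ (hC.mono (by simp)) (fun h => hCX ?_) _ (hG c)
      apply le_antisymm (sp_mono Finset.inter_subset_right)
      rw [← h]
      exact sp_mono (Finset.inter_subset_inter_right (Finset.erase_subset _ _))
  · obtain ⟨v, hv, hv'⟩ := exists_dot_ne_zero (S.gen _ ht)
    have hvC : ∀ c ∈ C, L c ⬝ᵥ v = 0 := fun c hc => hv _ (mem_sp hc)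
    have : S.q C g = (S.h ⬝ᵥ v)⁻¹ • ((S.h ⬝ᵥ v) • S.q C g) := by
      rw [smul_smul, inv_mul_cancel₀ hv', one_smul]
    rw [this, S.rel C v g hvC]
    apply Submodule.smul_mem
    apply Submodule.sub_mem _ (dirD_mem (fun N' hN' g hg => ihb N' hN' C hC hCX g hg) hg v)
    have hterm : ∀ i, sp L (insert i C ∩ X) ≠ sp L X →
        (L i ⬝ᵥ v) • S.s i (S.q (insert i C) g) ∈ M := by
      intro i hi
      by_cases hiC : L i ∈ sp L C
      · rw [hv _ hiC, zero_smul]; exact M.zero_mem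
      · have hiC' : i ∉ C := fun h => hiC (mem_sp h)
        have hins : LinearIndepOn ℂ L ((insert i C : Finset ι) : Set ι) := by
          rw [Finset.coe_insert]; exact hC.insert hiC
        have hle := LinearIndepOn_card_le hins
        rw [Finset.card_insert_of_notMem hiC'] at hle
        refine M.smul_mem _ (hM _ _ (ih (n - (insert i C).card) ?_ (insert i C) hins hi rfl g hg))
        rw [Finset.card_insert_of_notMem hiC']; omega
    rw [← Finset.sum_filter_add_sum_filter_not Finset.univ (· ∈ X)]
    apply M.add_mem
    swap
    · apply Submodule.sum_mem
      intro i hi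
      apply hterm
      rw [Finset.insert_inter_of_notMem (Finset.mem_filter.mp hi).2]
      exact hCX
    rw [Finset.filter_mem_eq_inter, Finset.univ_inter]
    by_cases hall : ∀ i ∈ X, L i ∉ sp L C → sp L (insert i C ∩ X) ≠ sp L X
    · apply Submodule.sum_mem
      intro i hi
      by_cases hiC : L i ∈ sp L C
      · rw [hv _ hiC, zero_smul]; exact M.zero_mem
      · exact hterm i (hall i hi hiC)
    push Not at hall
    obtain ⟨i0, hi0X, hi0C, hi0s⟩ := hall
    rw [Finset.insert_inter_of_mem hi0X] at hi0s
    have hind : ∀ i, L i ∉ sp L C → LinearIndepOn ℂ L ((insert i C : Finset ι) : Set ι) := by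
      intro i hi; rw [Finset.coe_insert]; exact hC.insert hi
    have hindX : ∀ i, L i ∉ sp L C → LinearIndepOn ℂ L ((insert i (C ∩ X) : Finset ι) : Set ι) :=
      fun i hi => (hind i hi).mono (by
        exact_mod_cast Finset.insert_subset_insert i Finset.inter_subset_left)
    have hcard : ∀ i, L i ∉ sp L C → (insert i (C ∩ X)).card = (C ∩ X).card + 1 := fun i hi =>
      Finset.card_insert_of_notMem fun h => hi (mem_sp (Finset.mem_of_mem_inter_left h))
    have hrk : Module.finrank ℂ (sp L X) = (C ∩ X).card + 1 := by
      rw [← hi0s, finrank_sp (hindX i0 hi0C), hcard i0 hi0C]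
    have hspX : ∀ i ∈ X, L i ∉ sp L C → sp L (insert i (C ∩ X)) = sp L X := fun i hi hiC =>
      sp_eq_of_card (hindX i hiC) (Finset.insert_subset hi Finset.inter_subset_right)
        (by rw [hrk, hcard i hiC])
    have hdX : Disjoint (sp L X) (sp L (C \ X)) := by
      rw [← hi0s]
      apply disjoint_sp
      · refine (hind i0 hi0C).mono ?_
        rw [Finset.insert_union]
        exact_mod_cast Finset.insert_subset_insert i0 (Finset.union_subset Finset.inter_subset_left
          Finset.sdiff_subset)
      · rw [Finset.disjoint_left]
        intro x hx hx'
        rw [Finset.mem_sdiff] at hx'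
        rcases Finset.mem_insert.mp hx with rfl | hx
        · exact hx'.2 hi0X
        · exact hx'.2 (Finset.mem_of_mem_inter_right hx)
    classical
    have key := hc (X.filter fun i => L i ∉ sp L C) (fun i => insert i (C ∩ X))
      (fun i => (L i ⬝ᵥ v) • S.s i)
      (fun i hi => Finset.insert_subset (Finset.mem_filter.mp hi).1 Finset.inter_subset_right)
      (fun i hi => hindX i (Finset.mem_filter.mp hi).2)
      (fun i hi => hspX i (Finset.mem_filter.mp hi).1 (Finset.mem_filter.mp hi).2)
      (fun i _ x hx => M.smul_mem _ (hM _ _ hx))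
      (fun i _ j x => by simp only [LinearMap.smul_apply, map_smul, hs])
      ?_ (C \ X) (hC.mono (by exact_mod_cast Finset.sdiff_subset)) hdX g hg
    · rw [Finset.sum_filter] at key
      convert key using 2 with i hi
      split_ifs with hiC
      · rw [hv _ hiC, zero_smul]
      · have hU : C ∩ X ∪ C \ X = C := by
          ext x
          simp only [Finset.mem_union, Finset.mem_inter, Finset.mem_sdiff]
          tauto
        rw [LinearMap.smul_apply, Finset.insert_union, hU]
    · intro E hE hdE htE
      have hEb : IsBase L (insert i0 (C ∩ X) ∪ E) :=
        isBase_union (hindX i0 hi0C) hE (by rw [hi0s]; exact hdE) (by rw [hi0s]; exact htE)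
      have hdis : Disjoint X E := by
        rw [Finset.disjoint_left]
        intro x hx hxE
        exact hE.ne_zero hxE (Submodule.disjoint_def.mp hdE _ (mem_sp hx) (mem_sp hxE))
      obtain ⟨w, hw⟩ := exists_dual hEb.1
      have hi0m : i0 ∈ insert i0 (C ∩ X) ∪ E := by simp
      set v' := (L i0 ⬝ᵥ v) • w i0 with hv'def
      have hv'K : ∀ c ∈ insert i0 (C ∩ X) ∪ E, L c ⬝ᵥ v' = if c = i0 then L i0 ⬝ᵥ v else 0 := by
        intro c hc
        rw [hv'def, dotProduct_smul, hw c hc i0 hi0m]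
        simp
      have hi0ne : ∀ c ∈ C, c ≠ i0 := fun c hc h => hi0C (mem_sp (h ▸ hc))
      have hv'X : ∀ i ∈ X, L i ⬝ᵥ v' = L i ⬝ᵥ v := by
        intro i hi
        refine dot_eq_of_mem_sp (L := L) (C := insert i0 (C ∩ X)) (fun c hc => ?_) ?_
        · rw [hv'K c (Finset.mem_union_left _ hc)]
          split_ifs with h
          · rw [h]
          · rw [hvC c (Finset.mem_of_mem_inter_left (Finset.mem_of_mem_insert_of_ne hc h))]
        · rw [hi0s]; exact mem_sp hi
      have hCE : C ∩ X ∪ E ⊆ insert i0 (C ∩ X) ∪ E :=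
        Finset.union_subset_union (Finset.subset_insert _ _) subset_rfl
      have h2' := h2 (C ∩ X ∪ E) (hEb.1.mono (by exact_mod_cast hCE)) ?_ v' ?_
      · rw [Finset.sum_filter]
        convert h2' using 2 with i hi
        rw [hv'X i hi]
        split_ifs with hiC
        · rw [hv _ hiC, zero_smul]
        · rw [LinearMap.smul_apply, Finset.insert_union]
      · rw [← hEb.2, Finset.insert_union, Finset.card_insert_of_notMem]
        intro h
        rcases Finset.mem_union.mp h with h | h
        · exact hi0ne _ (Finset.mem_of_mem_inter_left h) rfl
        · exact Finset.disjoint_left.mp hdis hi0X h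
      · intro c hc
        rw [hv'K c (hCE hc), if_neg]
        rintro rfl
        rcases Finset.mem_union.mp hc with h | h
        · exact hi0ne _ (Finset.mem_of_mem_inter_left h) rfl
        · exact Finset.disjoint_left.mp hdis hi0X h

theorem regular_of_bases (hs : ∀ i j x, S.s i (S.s j x) = S.s j (S.s i x)) (M : Submodule ℂ V)
    (hM : ∀ i, ∀ x ∈ M, S.s i x ∈ M) {X : Finset ι}
    (h1 : ∀ C, IsBase L C → sp L (C ∩ X) ≠ sp L X → S.q C 1 ∈ M)
    (h2 : ∀ C : Finset ι, LinearIndepOn ℂ L (C : Set ι) → C.card + 1 = n → ∀ v : Fin n → ℂ,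
      (∀ c ∈ C, L c ⬝ᵥ v = 0) → ∑ i ∈ X, (L i ⬝ᵥ v) • S.s i (S.q (insert i C) 1) ∈ M) (N : ℕ) :
    SmallReg S M X N ∧ FamilyReg S M X N := by
  induction N using Nat.strong_induction_on with
  | _ N ih =>
    have hc := familyReg_step M hM (fun N' h => (ih N' h).1) fun N' h => (ih N' h).2
    exact ⟨smallReg_step hs M hM h1 h2 (fun N' h => (ih N' h).1) hc, hc⟩

end Regularity

section FunctionsOfExponents

variable {ι : Type} [Fintype ι] [DecidableEq ι]

/-- The evaluation of polynomials at natural number exponents. -/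
def pev : MvPolynomial ι ℂ →ₐ[ℂ] ((ι → ℕ) → ℂ) := aeval fun i m => (m i : ℂ)

lemma pev_apply (P : MvPolynomial ι ℂ) (m : ι → ℕ) :
    pev P m = eval (fun i => (m i : ℂ)) P := by
  have : (Pi.evalAlgHom ℂ (fun _ : ι → ℕ => ℂ) m).comp pev
      = aeval (fun i => (m i : ℂ)) := by
    ext i
    simp [pev]
  have h := congrArg (fun F : MvPolynomial ι ℂ →ₐ[ℂ] ℂ => F P) this
  simpa [aeval_eq_eval] using h

/-- The sum of the exponents over a set of indices. -/
def ssum (X : Finset ι) : (ι → ℕ) → ℂ := fun m => ∑ i ∈ X, (m i : ℂ)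

/-- The sum of the variables over a set of indices. -/
def spol (X : Finset ι) : MvPolynomial ι ℂ := ∑ i ∈ X, MvPolynomial.X i

lemma pev_spol (X : Finset ι) : pev (spol X) = ssum X := by
  ext m
  simp [pev_apply, spol, ssum]

lemma ssum_ne_zero {X : Finset ι} (hX : X.Nonempty) {m : ι → ℕ} (hm : ∀ i, 0 < m i) :
    ssum X m ≠ 0 := by
  rw [ssum, ← Nat.cast_sum]
  exact_mod_cast (Finset.sum_pos (fun i _ => hm i) hX).ne'

lemma eq_of_pev_eq {P Q : MvPolynomial ι ℂ}
    (h : ∀ m : ι → ℕ, (∀ i, 0 < m i) → pev P m = pev Q m) : P = Q := by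
  refine MvPolynomial.funext_set (s := fun _ => (fun k : ℕ => (k : ℂ)) '' Set.Ioi 0) (fun i => ?_)
    fun x hx => ?_
  · exact (Set.Ioi_infinite 0).image Nat.cast_injective.injOn
  · simp only [Set.mem_pi, Set.mem_univ, forall_true_left, Set.mem_image, Set.mem_Ioi] at hx
    choose m hm hx using hx
    have := h m hm
    rw [pev_apply, pev_apply] at this
    rwa [show x = fun i => (m i : ℂ) from (funext hx).symm]

lemma prime_spol {X : Finset ι} (hX : X.Nonempty) : Prime (spol X : MvPolynomial ι ℂ) := by
  obtain ⟨x, hx⟩ := hX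
  have hcoef : (spol X : MvPolynomial ι ℂ).coeff (Finsupp.single x 1) = 1 := by
    rw [spol, coeff_sum, Finset.sum_eq_single x]
    · simp
    · intro i _ hi
      rw [coeff_X, if_neg]
      rwa [Finsupp.single_left_inj one_ne_zero]
    · exact fun h => absurd hx h
  have hhom : (spol X : MvPolynomial ι ℂ).IsHomogeneous 1 :=
    IsHomogeneous.sum _ _ _ fun i _ => isHomogeneous_X _ _
  have hne : (spol X : MvPolynomial ι ℂ) ≠ 0 := by
    intro h0
    rw [h0] at hcoef
    simp at hcoef
  apply Irreducible.prime
  refine irreducible_of_totalDegree_eq_one (hhom.totalDegree hne) fun a ha => ?_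
  have := ha (Finsupp.single x 1)
  rw [hcoef] at this
  exact isUnit_of_dvd_one this

lemma spol_not_dvd {X Y : Finset ι} (hY : Y.Nonempty) (hXY : Y ≠ X) :
    ¬ (spol X : MvPolynomial ι ℂ) ∣ spol Y := by
  rintro ⟨Q, hQ⟩
  have key : ∀ p : ι → ℂ, ∑ i ∈ X, p i = 0 → ∑ i ∈ Y, p i = 0 := by
    intro p hp
    have := congrArg (eval p) hQ
    simpa [spol, hp] using this
  by_cases h : Y ⊆ X
  · obtain ⟨y, hy⟩ := hY
    obtain ⟨x, hx, hxY⟩ := Finset.exists_of_ssubset (Finset.ssubset_iff_subset_ne.mpr ⟨h, hXY⟩)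
    have := key (fun i => (if i = y then 1 else 0) - if i = x then 1 else 0) (by
      simp [Finset.sum_sub_distrib, h hy, hx])
    simp [Finset.sum_sub_distrib, hy, hxY] at this
  · obtain ⟨y, hy, hyX⟩ := Finset.not_subset.mp h
    have := key (fun i => if i = y then 1 else 0) (by simp [hyX])
    simp [hy] at this

/-- The functions of positive exponents which agree with a fraction whose denominator lies in a
given submonoid. -/
def fracAlg (T : Submonoid (MvPolynomial ι ℂ)) : Subalgebra ℂ ((ι → ℕ) → ℂ) where
  carrier := {φ | ∃ D ∈ T, ∃ P : MvPolynomial ι ℂ, ∀ m, (∀ i, 0 < m i) → pev D m * φ m = pev P m}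
  mul_mem' := by
    rintro φ ψ ⟨D, hD, P, h⟩ ⟨D', hD', P', h'⟩
    refine ⟨D * D', T.mul_mem hD hD', P * P', fun m hm => ?_⟩
    rw [map_mul, map_mul, Pi.mul_apply, Pi.mul_apply, Pi.mul_apply, ← h m hm, ← h' m hm]
    ring
  add_mem' := by
    rintro φ ψ ⟨D, hD, P, h⟩ ⟨D', hD', P', h'⟩
    refine ⟨D * D', T.mul_mem hD hD', D' * P + D * P', fun m hm => ?_⟩
    rw [map_mul, map_add, map_mul, map_mul, Pi.mul_apply, Pi.add_apply, Pi.add_apply,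
      Pi.mul_apply, Pi.mul_apply, ← h m hm, ← h' m hm]
    ring
  algebraMap_mem' := fun a => ⟨1, T.one_mem, C a, fun m _ => by simp [pev_apply]⟩

lemma pev_mem_fracAlg (T : Submonoid (MvPolynomial ι ℂ)) (P : MvPolynomial ι ℂ) :
    pev P ∈ fracAlg T := ⟨1, T.one_mem, P, fun m _ => by simp⟩

lemma mem_fracAlg_of_mul {T : Submonoid (MvPolynomial ι ℂ)} {D : MvPolynomial ι ℂ} (hD : D ∈ T)
    {φ : (ι → ℕ) → ℂ} (h : pev D * φ ∈ fracAlg T) : φ ∈ fracAlg T := by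
  obtain ⟨D', hD', P, h'⟩ := h
  refine ⟨D' * D, T.mul_mem hD' hD, P, fun m hm => ?_⟩
  rw [← h' m hm, map_mul, Pi.mul_apply, Pi.mul_apply, mul_assoc]

lemma mem_fracAlg_congr {T : Submonoid (MvPolynomial ι ℂ)} {φ ψ : (ι → ℕ) → ℂ}
    (h : ∀ m, (∀ i, 0 < m i) → φ m = ψ m) (hψ : ψ ∈ fracAlg T) : φ ∈ fracAlg T := by
  obtain ⟨D, hD, P, h'⟩ := hψ
  exact ⟨D, hD, P, fun m hm => by rw [h m hm, h' m hm]⟩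

/-- Functions without pole along the hyperplane where the exponents in `X` sum to zero. -/
def regAlg (X : Finset ι) (hX : X.Nonempty) : Subalgebra ℂ ((ι → ℕ) → ℂ) :=
  fracAlg (@Ideal.primeCompl _ _ (Ideal.span {(spol X : MvPolynomial ι ℂ)})
    ((Ideal.span_singleton_prime (prime_spol hX).ne_zero).mpr (prime_spol hX)))

lemma mem_regAlg {X : Finset ι} {hX : X.Nonempty} {φ : (ι → ℕ) → ℂ} : φ ∈ regAlg X hX ↔
    ∃ D, ¬ (spol X : MvPolynomial ι ℂ) ∣ D ∧ ∃ P : MvPolynomial ι ℂ,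
      ∀ m, (∀ i, 0 < m i) → pev D m * φ m = pev P m := by
  change (∃ D, _ ∧ _) ↔ _
  refine exists_congr fun D => and_congr ?_ Iff.rfl
  change ¬ _ ↔ _
  rw [SetLike.mem_coe, Ideal.mem_span_singleton]

lemma pev_mem_regAlg {X : Finset ι} {hX : X.Nonempty} (P : MvPolynomial ι ℂ) :
    pev P ∈ regAlg X hX := pev_mem_fracAlg _ _

lemma ssum_mem_regAlg {X : Finset ι} {hX : X.Nonempty} (Y : Finset ι) :
    ssum Y ∈ regAlg X hX := pev_spol Y ▸ pev_mem_regAlg _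

lemma inv_ssum_mem_regAlg {X Y : Finset ι} {hX : X.Nonempty} (hXY : Y ≠ X) :
    (fun m => (ssum Y m)⁻¹) ∈ regAlg X hX := by
  rcases Y.eq_empty_or_nonempty with rfl | hY
  · convert Subalgebra.zero_mem (regAlg X hX)
    simp [ssum]
  · refine mem_regAlg.mpr ⟨spol Y, spol_not_dvd hY hXY, 1, fun m hm => ?_⟩
    rw [pev_spol, mul_inv_cancel₀ (ssum_ne_zero hY hm)]
    simp

theorem exists_pev_of_regular {A : Finset (Finset ι)} (hA : ∀ X ∈ A, X.Nonempty)
    {φ : (ι → ℕ) → ℂ} (h1 : φ ∈ fracAlg (Submonoid.powers (∏ X ∈ A, spol X)))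
    (h2 : ∀ X (hX : X ∈ A), φ ∈ regAlg X (hA X hX)) :
    ∃ P : MvPolynomial ι ℂ, ∀ m, (∀ i, 0 < m i) → φ m = pev P m := by
  obtain ⟨D, ⟨e, he⟩, P, h⟩ := h1
  have key : ∀ s : Multiset (Finset ι), (∀ X ∈ s, X ∈ A) → ∀ P : MvPolynomial ι ℂ,
      (∀ m, (∀ i, 0 < m i) → pev (s.map spol).prod m * φ m = pev P m) →
      ∃ P : MvPolynomial ι ℂ, ∀ m, (∀ i, 0 < m i) → φ m = pev P m := by
    intro s
    induction s using Multiset.induction_on with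
    | empty =>
      intro _ P hP
      exact ⟨P, fun m hm => by rw [← hP m hm]; simp⟩
    | cons X s ih =>
      intro hs P hP
      have hXA := hs X (Multiset.mem_cons_self X s)
      obtain ⟨D, hD, Q, hQ⟩ := mem_regAlg.mp (h2 X hXA)
      have heq : D * P = spol X * ((s.map spol).prod * Q) := by
        apply eq_of_pev_eq
        intro m hm
        have h3 := hP m hm
        have h4 := hQ m hm
        simp only [Multiset.map_cons, Multiset.prod_cons, map_mul, Pi.mul_apply] at h3 h4 ⊢
        rw [← h3, ← h4]
        ring
      obtain ⟨P', rfl⟩ : spol X ∣ P :=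
        ((prime_spol (hA X hXA)).dvd_or_dvd ⟨_, heq⟩).resolve_left hD
      refine ih (fun Y hY => hs Y (Multiset.mem_cons_of_mem hY)) P' fun m hm => ?_
      have h3 := hP m hm
      simp only [Multiset.map_cons, Multiset.prod_cons, map_mul, Pi.mul_apply, pev_spol,
        mul_assoc] at h3
      exact mul_left_cancel₀ (ssum_ne_zero (hA X hXA) hm) h3
  refine key (e • A.val) (fun X hX => Multiset.mem_of_mem_nsmul hX) P fun m hm => ?_
  rw [← h m hm, ← he, Multiset.map_nsmul, Multiset.prod_nsmul]
  rfl

end FunctionsOfExponents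

section Weights

variable {n : ℕ} {ι : Type} [Fintype ι] [DecidableEq ι] (L : ι → Fin n → ℂ)

open Classical in
/-- The forms lying in the span of the first forms of the tuple `c`. -/
def cl (c : Fin n → ι) (k : Fin n) : Finset ι :=
  Finset.univ.filter fun i => ∀ k', k < k' → coord L c i k' = 0

/-- The weight of the tuple `c`. -/
def wt (θ : Fin n → ι → ℂ) (c : Fin n → ι) : (ι → ℕ) → ℂ := fun m =>
  (Matrix.of fun a k => θ a (c k)).det * (tmat L c).det⁻¹ * ∏ k, (ssum (cl L c k) m)⁻¹

open Classical in
/-- The contribution of one layer to the iterated residue. -/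
def lres (c : Fin n → ι) (C : Finset ι) (k : Fin n) : ℂ :=
  ∑ x ∈ C, if Layer L c x k then (coord L c x k)⁻¹ else 0

variable {L} {c : Fin n → ι}

lemma resVal_eq (C : Finset ι) : resVal L c C = ∏ k, lres L c C k := rfl

lemma mem_cl {i : ι} {k : Fin n} : i ∈ cl L c k ↔ ∀ k', k < k' → coord L c i k' = 0 := by
  simp [cl]

lemma mem_cl_iff_layer (hc : (tmat L c).det ≠ 0) {i : ι} {k : Fin n} :
    i ∈ cl L c k ↔ ∀ l, Layer L c i l → l ≤ k := by
  rw [mem_cl]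
  constructor
  · intro h l hl
    by_contra hkl
    exact hl.1 (h l (not_le.mp hkl))
  · intro h k' hk'
    by_contra h0
    have hi : L i ≠ 0 := fun hi => h0 (by simp [coord, hi])
    obtain ⟨l, hl⟩ := exists_layer hc hi
    exact h0 (hl.2 k' (lt_of_le_of_lt (h l hl) hk'))

lemma cl_eq_of_layer (hc : (tmat L c).det ≠ 0) {τ : Fin n → ι} (h : ∀ k, Layer L c (τ k) k)
    (k : Fin n) : cl L τ k = cl L c k := by
  ext i
  rw [mem_cl_iff_layer hc, mem_cl_iff_layer (det_ne_zero_of_layer hc h)]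
  simp_rw [layer_iff_of_layer hc h]

lemma self_mem_cl (hc : (tmat L c).det ≠ 0) {j k : Fin n} : c j ∈ cl L c k ↔ j ≤ k := by
  rw [mem_cl_iff_layer hc]
  exact ⟨fun h => h j (layer_self hc j), fun h l hl => hl.unique (layer_self hc j) ▸ h⟩

lemma cl_injective (hc : (tmat L c).det ≠ 0) : Function.Injective (cl L c) := by
  intro k k' h
  apply le_antisymm
  · rw [← self_mem_cl hc, ← h, self_mem_cl hc]
  · rw [← self_mem_cl hc, h, self_mem_cl hc]

lemma cl_nonempty (hc : (tmat L c).det ≠ 0) (k : Fin n) : (cl L c k).Nonempty :=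
  ⟨c k, (self_mem_cl hc).mpr le_rfl⟩

lemma wt_eq_zero {θ : Fin n → ι → ℂ} (hc : (tmat L c).det = 0) : wt L θ c = 0 := by
  ext m
  simp [wt, hc]

lemma prod_inv_ssum_mem {X : Finset ι} {hX : X.Nonempty} {κ : Type} {s : Finset κ}
    {Y : κ → Finset ι} (h : ∀ k ∈ s, Y k ≠ X) :
    (fun m => ∏ k ∈ s, (ssum (Y k) m)⁻¹) ∈ regAlg X hX := by
  have := Subalgebra.prod_mem (regAlg X hX) (t := s) (f := fun k m => (ssum (Y k) m)⁻¹)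
    fun k hk => inv_ssum_mem_regAlg (h k hk)
  convert this using 1
  ext m
  simp

lemma const_mul_mem {A : Subalgebra ℂ ((ι → ℕ) → ℂ)} {φ : (ι → ℕ) → ℂ} (a : ℂ) (h : φ ∈ A) :
    (fun m => a * φ m) ∈ A := Subalgebra.smul_mem A h a

lemma fun_mul_mem {A : Subalgebra ℂ ((ι → ℕ) → ℂ)} {φ ψ : (ι → ℕ) → ℂ} (hφ : φ ∈ A)
    (hψ : ψ ∈ A) : (fun m => φ m * ψ m) ∈ A := Subalgebra.mul_mem A hφ hψ

lemma fun_sum_mem {A : Subalgebra ℂ ((ι → ℕ) → ℂ)} {κ : Type} {s : Finset κ}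
    {φ : κ → (ι → ℕ) → ℂ} (h : ∀ k ∈ s, φ k ∈ A) : (fun m => ∑ k ∈ s, φ k m) ∈ A := by
  have := Subalgebra.sum_mem A h
  convert this using 1
  ext m
  simp

lemma wt_mem_regAlg {X : Finset ι} {hX : X.Nonempty} {θ : Fin n → ι → ℂ}
    (h : ∀ k, cl L c k ≠ X) : wt L θ c ∈ regAlg X hX :=
  const_mul_mem _ (prod_inv_ssum_mem fun k _ => h k)

lemma ssum_mul_wt {θ : Fin n → ι → ℂ} (hc : (tmat L c).det ≠ 0) (p : Fin n) {m : ι → ℕ}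
    (hm : ∀ i, 0 < m i) : ssum (cl L c p) m * wt L θ c m =
      (Matrix.of fun a k => θ a (c k)).det * (tmat L c).det⁻¹ *
        ∏ k ∈ Finset.univ.erase p, (ssum (cl L c k) m)⁻¹ := by
  rw [wt, ← Finset.mul_prod_erase Finset.univ _ (Finset.mem_univ p)]
  have := ssum_ne_zero (cl_nonempty hc p) hm
  field_simp

lemma ssum_mul_wt_mem {X : Finset ι} {hX : X.Nonempty} {θ : Fin n → ι → ℂ}
    (hc : (tmat L c).det ≠ 0) {p : Fin n} (hp : cl L c p = X) :
    (fun m => ssum X m * wt L θ c m) ∈ regAlg X hX := by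
  subst hp
  refine mem_fracAlg_congr (fun m hm => ssum_mul_wt hc p hm)
    (const_mul_mem _ (prod_inv_ssum_mem (hX := hX) fun k hk => ?_))
  exact fun h => Finset.ne_of_mem_erase hk (cl_injective hc h)

lemma mem_span_tuple (hc : (tmat L c).det ≠ 0) {i : ι} {k : Fin n} (hi : i ∈ cl L c k) :
    L i ∈ Submodule.span ℂ ((fun k => L (c k)) '' {l | l ≤ k}) :=
  (mem_span_image_iff hc i _).mpr fun l hl => mem_cl.mp hi l (not_le.mp hl)

lemma resVal_eq_zero_of_cl (hc : (tmat L c).det ≠ 0) {X C : Finset ι} {p : Fin n}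
    (hp : cl L c p = X) (hCX : sp L (C ∩ X) ≠ sp L X) : resVal L c C = 0 := by
  by_contra h
  obtain ⟨x, hxC, hx⟩ := exists_tuple_of_resVal_ne_zero h
  refine hCX (le_antisymm (sp_mono Finset.inter_subset_right) ?_)
  refine sp_le fun i hi => ?_
  have hi' : i ∈ cl L x p := by rwa [cl_eq_of_layer hc hx, hp]
  refine Submodule.span_mono ?_ (mem_span_tuple (det_ne_zero_of_layer hc hx) hi')
  rintro _ ⟨l, hl, rfl⟩
  refine ⟨x l, ?_, rfl⟩
  rw [Finset.mem_coe, Finset.mem_inter]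
  refine ⟨hxC l, ?_⟩
  rw [← hp, ← cl_eq_of_layer hc hx]
  exact (self_mem_cl (det_ne_zero_of_layer hc hx)).mpr hl

lemma resVal_wt_mem {X C : Finset ι} {hX : X.Nonempty} {θ : Fin n → ι → ℂ}
    (hCX : sp L (C ∩ X) ≠ sp L X) : (fun m => resVal L c C * wt L θ c m) ∈ regAlg X hX := by
  by_cases hc : (tmat L c).det = 0
  · simp only [wt_eq_zero hc, Pi.zero_apply, mul_zero]
    exact Subalgebra.zero_mem _
  · by_cases h : ∃ p, cl L c p = X
    · obtain ⟨p, hp⟩ := h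
      simp only [resVal_eq_zero_of_cl hc hp hCX, zero_mul]
      exact Subalgebra.zero_mem _
    · push Not at h
      exact const_mul_mem _ (wt_mem_regAlg h)

lemma dot_of_layer (hc : (tmat L c).det ≠ 0) {x : ι} {k : Fin n} {v : Fin n → ℂ}
    (hx : ∀ l, k < l → coord L c x l = 0) (hv : ∀ l, l < k → L (c l) ⬝ᵥ v = 0) :
    L x ⬝ᵥ v = coord L c x k * (L (c k) ⬝ᵥ v) := by
  rw [← coord_sum hc x, sum_dotProduct, Finset.sum_eq_single k]
  · rw [smul_dotProduct, smul_eq_mul]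
  · intro l _ hl
    rw [smul_dotProduct]
    rcases lt_or_gt_of_ne hl with h | h
    · rw [hv l h, smul_zero]
    · rw [hx l h, zero_smul]
  · simp

lemma exists_layer_of_lres {C : Finset ι} {k : Fin n} (h : lres L c C k ≠ 0) :
    ∃ x ∈ C, Layer L c x k := by
  by_contra! h'
  exact h (Finset.sum_eq_zero fun x hx => if_neg (h' x hx))

lemma dot_eq_zero_of_lres (hc : (tmat L c).det ≠ 0) {C : Finset ι} {v : Fin n → ℂ}
    (hv : ∀ x ∈ C, L x ⬝ᵥ v = 0) {j : Fin n} (hR : ∀ k, k < j → lres L c C k ≠ 0) (k : Fin n)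
    (hk : k < j) : L (c k) ⬝ᵥ v = 0 := by
  induction k using WellFoundedLT.induction with
  | _ k ih =>
    obtain ⟨x, hx, hl⟩ := exists_layer_of_lres (hR k hk)
    have h := dot_of_layer hc hl.2 fun l hl' => ih l hl' (hl'.trans hk)
    rw [hv x hx] at h
    exact (mul_eq_zero.mp h.symm).resolve_left hl.1

/-- The residue of an `n`-tuple obtained by adding an element of a given layer. -/
def hterm (L : ι → Fin n → ℂ) (c : Fin n → ι) (C : Finset ι) (v : Fin n → ℂ) (j : Fin n) : ℂ :=
  (L (c j) ⬝ᵥ v) * ∏ k ∈ Finset.univ.erase j, lres L c C k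

lemma resVal_eq_zero_of_card {C : Finset ι} (hn : C.card < n) :
    resVal L c C = 0 := by
  by_contra h
  obtain ⟨x, hxC, hx⟩ := exists_tuple_of_resVal_ne_zero h
  have hinj : Function.Injective x := fun k l hkl =>
    (hx k).unique (hkl ▸ hx l)
  have := Finset.card_le_card_of_injOn x (s := Finset.univ) (t := C) (fun k _ => hxC k)
    hinj.injOn
  simp at this
  omega

lemma dot_mul_resVal_insert (hc : (tmat L c).det ≠ 0) {C : Finset ι} (hn : C.card < n)
    {v : Fin n → ℂ} (hv : ∀ x ∈ C, L x ⬝ᵥ v = 0) {i : ι} {j : Fin n} (hi : Layer L c i j) :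
    (L i ⬝ᵥ v) * resVal L c (insert i C) = hterm L c C v j := by
  have hdot : (∏ k ∈ Finset.univ.erase j, lres L c C k) ≠ 0 →
      L i ⬝ᵥ v = coord L c i j * (L (c j) ⬝ᵥ v) := fun h =>
    dot_of_layer hc hi.2 (dot_eq_zero_of_lres hc hv fun k hk =>
      Finset.prod_ne_zero_iff.mp h k (by simp [hk.ne]))
  by_cases hiC : i ∈ C
  · rw [hv i hiC, zero_mul, hterm]
    by_cases h : (∏ k ∈ Finset.univ.erase j, lres L c C k) = 0
    · rw [h, mul_zero]
    · have := hdot h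
      rw [hv i hiC] at this
      rw [(mul_eq_zero.mp this.symm).resolve_left hi.1, zero_mul]
  · have h1 : ∀ k, k ≠ j → lres L c (insert i C) k = lres L c C k := by
      intro k hk
      rw [lres, Finset.sum_insert hiC, if_neg (fun h => hk (h.unique hi)), zero_add, lres]
    have h2 : lres L c (insert i C) j = (coord L c i j)⁻¹ + lres L c C j := by
      rw [lres, Finset.sum_insert hiC, if_pos hi, lres]
    have h3 := resVal_eq_zero_of_card (L := L) (c := c) hn
    rw [resVal_eq, ← Finset.mul_prod_erase Finset.univ _ (Finset.mem_univ j)] at h3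
    rw [resVal_eq, ← Finset.mul_prod_erase Finset.univ _ (Finset.mem_univ j), h2,
      Finset.prod_congr rfl fun k hk => h1 k (Finset.ne_of_mem_erase hk), add_mul, h3, add_zero,
      hterm]
    by_cases h : (∏ k ∈ Finset.univ.erase j, lres L c C k) = 0
    · rw [h]; ring
    · rw [hdot h]
      have := hi.1
      field_simp

section Swap

variable {a b : Fin n}

lemma swap_gt (hab : b.val = a.val + 1) {k : Fin n} (hk : k ≠ a) (l : Fin n) :
    k < Equiv.swap a b l ↔ k < l := by
  have hk' : k.val ≠ a.val := fun h => hk (Fin.ext h)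
  rw [Equiv.swap_apply_def]
  split_ifs with h1 h2
  · subst h1; simp only [Fin.lt_def]; omega
  · subst h2; simp only [Fin.lt_def]; omega
  · rfl

lemma coord_swap_vanish (hc : (tmat L c).det ≠ 0) (hab : b.val = a.val + 1) {k : Fin n}
    (hk : k ≠ a) (i : ι) : (∀ k', k < k' → coord L (c ∘ Equiv.swap a b) i k' = 0) ↔
      ∀ k', k < k' → coord L c i k' = 0 := by
  simp_rw [coord_comp_perm hc]
  constructor
  · intro h k' hk'
    have := h (Equiv.swap a b k') ((swap_gt hab hk k').mpr hk')
    rwa [Equiv.swap_apply_self] at this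
  · intro h k' hk'
    exact h _ ((swap_gt hab hk k').mpr hk')

lemma cl_swap (hc : (tmat L c).det ≠ 0) (hab : b.val = a.val + 1) {k : Fin n} (hk : k ≠ a) :
    cl L (c ∘ Equiv.swap a b) k = cl L c k := by
  ext i
  rw [mem_cl, mem_cl, coord_swap_vanish hc hab hk]

lemma lres_swap (hc : (tmat L c).det ≠ 0) (hab : b.val = a.val + 1) {k : Fin n} (hka : k ≠ a)
    (hkb : k ≠ b) (C : Finset ι) : lres L (c ∘ Equiv.swap a b) C k = lres L c C k := by
  refine Finset.sum_congr rfl fun x _ => ?_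
  have h1 : coord L (c ∘ Equiv.swap a b) x k = coord L c x k := by
    rw [coord_comp_perm hc, Equiv.swap_apply_of_ne_of_ne hka hkb]
  have h2 : Layer L (c ∘ Equiv.swap a b) x k ↔ Layer L c x k := by
    rw [Layer, Layer, h1, coord_swap_vanish hc hab hka]
  by_cases h : Layer L c x k
  · rw [if_pos h, if_pos (h2.mpr h), h1]
  · rw [if_neg h, if_neg (mt h2.mp h)]

lemma tmat_comp_perm (σ : Equiv.Perm (Fin n)) :
    (tmat L (c ∘ σ)).det = Equiv.Perm.sign σ * (tmat L c).det := by
  have : tmat L (c ∘ σ) = (tmat L c).submatrix σ id := rfl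
  rw [this, Matrix.det_permute]

lemma det_weight_comp_perm (θ : Fin n → ι → ℂ) (σ : Equiv.Perm (Fin n)) :
    (Matrix.of fun a k => θ a ((c ∘ σ) k)).det * (tmat L (c ∘ σ)).det⁻¹ =
      (Matrix.of fun a k => θ a (c k)).det * (tmat L c).det⁻¹ := by
  have : (Matrix.of fun a k => θ a ((c ∘ σ) k)) =
    (Matrix.of fun a k => θ a (c k)).submatrix id σ := rfl
  rw [this, Matrix.det_permute', tmat_comp_perm, mul_inv]
  rcases Int.units_eq_one_or (Equiv.Perm.sign σ) with h | h <;> simp [h]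

lemma hterm_swap (hc : (tmat L c).det ≠ 0) (hab : b.val = a.val + 1) {C : Finset ι}
    {v : Fin n → ℂ} (hv : ∀ x ∈ C, L x ⬝ᵥ v = 0) :
    (hterm L c C v a - hterm L c C v b) + (hterm L (c ∘ Equiv.swap a b) C v a -
      hterm L (c ∘ Equiv.swap a b) C v b) = 0 := by
  have hne : a ≠ b := fun h => by rw [h] at hab; omega
  have hlt : a < b := Fin.lt_def.mpr (by omega)
  set c' := c ∘ Equiv.swap a b with hc'
  set Q := ∏ k ∈ (Finset.univ.erase a).erase b, lres L c C k with hQ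
  have hP : ∀ f : Fin n → ℂ, ∏ k ∈ Finset.univ.erase a, f k =
      f b * ∏ k ∈ (Finset.univ.erase a).erase b, f k := fun f =>
    (Finset.mul_prod_erase _ f (by simp [hne.symm])).symm
  have hP' : ∀ f : Fin n → ℂ, ∏ k ∈ Finset.univ.erase b, f k =
      f a * ∏ k ∈ (Finset.univ.erase a).erase b, f k := fun f => by
    rw [Finset.erase_right_comm]
    exact (Finset.mul_prod_erase _ f (by simp [hne])).symm
  have hQ' : ∏ k ∈ (Finset.univ.erase a).erase b, lres L c' C k = Q := by
    refine Finset.prod_congr rfl fun k hk => ?_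
    simp only [Finset.mem_erase] at hk
    exact lres_swap hc hab hk.2.1 hk.1 C
  have hca : c' a = c b := by simp [hc']
  have hcb : c' b = c a := by simp [hc']
  simp only [hterm, hP, hP', hQ', ← hQ, hca, hcb]
  by_cases hQ0 : Q = 0
  · rw [hQ0]; ring
  have hlow : ∀ k, k < a → L (c k) ⬝ᵥ v = 0 :=
    dot_eq_zero_of_lres hc hv fun k hk => Finset.prod_ne_zero_iff.mp hQ0 k (by
      simp [hk.ne, (hk.trans hlt).ne])
  suffices h : (L (c a) ⬝ᵥ v) * (lres L c C b - lres L c' C a) =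
      (L (c b) ⬝ᵥ v) * (lres L c C a - lres L c' C b) by linear_combination Q * h
  rw [lres, lres, lres, lres, ← Finset.sum_sub_distrib, ← Finset.sum_sub_distrib, Finset.mul_sum,
    Finset.mul_sum]
  refine Finset.sum_congr rfl fun x hx => ?_
  have h1 : coord L c' x a = coord L c x b := by rw [hc', coord_comp_perm hc]; simp
  have h2 : coord L c' x b = coord L c x a := by rw [hc', coord_comp_perm hc]; simp
  have hbv : (∀ k', b < k' → coord L c' x k' = 0) ↔ ∀ k', b < k' → coord L c x k' = 0 :=
    coord_swap_vanish hc hab hne.symm x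
  have hav : ∀ c : Fin n → ι, (∀ k', a < k' → coord L c x k' = 0) ↔
      coord L c x b = 0 ∧ ∀ k', b < k' → coord L c x k' = 0 := by
    intro c
    constructor
    · exact fun h => ⟨h b hlt, fun k' hk' => h k' (hlt.trans hk')⟩
    · rintro ⟨h, h'⟩ k' hk'
      rcases eq_or_ne k' b with rfl | hne'
      · exact h
      · apply h'
        have : k'.val ≠ b.val := fun h => hne' (Fin.ext h)
        rw [Fin.lt_def] at hk' ⊢
        omega
  simp only [Layer, hav, hbv, h1, h2]
  by_cases hhigh : ∀ k', b < k' → coord L c x k' = 0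
  swap
  · simp [hhigh]
  have hrel : coord L c x a * (L (c a) ⬝ᵥ v) + coord L c x b * (L (c b) ⬝ᵥ v) = 0 := by
    have h0 := hv x hx
    rw [← coord_sum hc x, sum_dotProduct, ← Finset.add_sum_erase _ _ (Finset.mem_univ a),
      ← Finset.add_sum_erase _ _ (show b ∈ Finset.univ.erase a by simp [hne.symm]),
      Finset.sum_eq_zero (s := (Finset.univ.erase a).erase b)] at h0
    · simpa [smul_dotProduct] using h0
    · intro k hk
      simp only [Finset.mem_erase] at hk
      rw [smul_dotProduct]
      have h3 : k.val ≠ a.val := fun h => hk.2.1 (Fin.ext h)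
      have h4 : k.val ≠ b.val := fun h => hk.1 (Fin.ext h)
      rcases lt_or_ge k a with h | h
      · rw [hlow k h, smul_zero]
      · rw [hhigh k (by rw [Fin.lt_def]; rw [Fin.le_def] at h; omega), zero_smul]
  by_cases hp : coord L c x a = 0
  · by_cases hq : coord L c x b = 0
    · simp [hp, hq]
    · simp only [hp, zero_mul, zero_add, mul_eq_zero, hq, false_or] at hrel
      simp [hp, hq, hrel]
  · by_cases hq : coord L c x b = 0
    · simp [hp, hq]
    · simp only [ne_eq, hq, hp, not_false_eq_true, and_false, false_and, if_false, true_and,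
        if_pos hhigh]
      field_simp
      linear_combination hrel

end Swap

end Weights

section Telescope

variable {N : ℕ} {ι : Type} [Fintype ι] [DecidableEq ι] {L : ι → Fin (N + 1) → ℂ}

lemma sum_telescope (h : Fin (N + 1) → ℂ) (l p : Fin (N + 1)) (hlp : l ≤ p) :
    h l = h p + ∑ j : Fin N, if l ≤ j.castSucc ∧ j.succ ≤ p then h j.castSucc - h j.succ else 0 := by
  induction p using Fin.induction with
  | zero =>
    rw [Finset.sum_eq_zero, add_zero, Fin.le_zero_iff.mp hlp]
    intro j _
    rw [if_neg]
    rintro ⟨_, h⟩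
    exact absurd (Fin.le_zero_iff.mp h) (Fin.succ_ne_zero j)
  | succ q ih =>
    rcases eq_or_lt_of_le hlp with rfl | hlt
    · rw [Finset.sum_eq_zero, add_zero]
      intro j _
      rw [if_neg]
      rintro ⟨h1, h2⟩
      exact absurd (h2.trans h1) (not_le.mpr Fin.castSucc_lt_succ)
    · have hle : l ≤ q.castSucc := by
        rw [Fin.lt_def] at hlt; rw [Fin.le_def]; simp at hlt ⊢; omega
      rw [ih hle, ← Finset.add_sum_erase Finset.univ _ (Finset.mem_univ q),
        ← Finset.add_sum_erase Finset.univ (fun j : Fin N =>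
          if l ≤ j.castSucc ∧ j.succ ≤ q.succ then h j.castSucc - h j.succ else 0)
          (Finset.mem_univ q), if_neg, if_pos]
      · have : ∀ j ∈ Finset.univ.erase q, (if l ≤ j.castSucc ∧ j.succ ≤ q.castSucc then
            h j.castSucc - h j.succ else 0) = if l ≤ j.castSucc ∧ j.succ ≤ q.succ then
            h j.castSucc - h j.succ else 0 := by
          intro j hj
          have hne : j.val ≠ q.val := fun h => Finset.ne_of_mem_erase hj (Fin.ext h)
          have : j.succ ≤ q.castSucc ↔ j.succ ≤ q.succ := by
            simp only [Fin.le_def, Fin.val_succ, Fin.val_castSucc]; omega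
          simp only [this]
        rw [Finset.sum_congr rfl this]
        ring
      · exact ⟨hle, le_rfl⟩
      · rintro ⟨_, h⟩
        exact absurd h (not_le.mpr Fin.castSucc_lt_succ)

variable (L) in
/-- The tuple `c` passes through the flat `X` strictly after the index `j`. -/
def Through (X : Finset ι) (c : Fin (N + 1) → ι) (j : Fin N) : Prop :=
  (tmat L c).det ≠ 0 ∧ ∃ p, j.succ ≤ p ∧ cl L c p = X

open Classical in
variable (L) in
/-- The contribution cancelling under exchange of consecutive elements of tuples. -/
def cancelTerm (X : Finset ι) (θ : Fin (N + 1) → ι → ℂ) (C : Finset ι) (v : Fin (N + 1) → ℂ)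
    (j : Fin N) (c : Fin (N + 1) → ι) (m : ι → ℕ) : ℂ :=
  if Through L X c j then
    (hterm L c C v j.castSucc - hterm L c C v j.succ) *
      (ssum (cl L c j.castSucc) m * wt L θ c m)
  else 0

lemma det_comp_swap_ne {c : Fin (N + 1) → ι} {a b : Fin (N + 1)} :
    (tmat L (c ∘ Equiv.swap a b)).det ≠ 0 ↔ (tmat L c).det ≠ 0 := by
  rw [tmat_comp_perm]
  simp

lemma Through.swap {X : Finset ι} {c : Fin (N + 1) → ι} {j : Fin N} (h : Through L X c j) :
    Through L X (c ∘ Equiv.swap j.castSucc j.succ) j := by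
  obtain ⟨hc, p, hp, hX⟩ := h
  refine ⟨det_comp_swap_ne.mpr hc, p, hp, ?_⟩
  rw [cl_swap hc (by simp), hX]
  rintro rfl
  exact absurd hp (not_le.mpr Fin.castSucc_lt_succ)

lemma swap_swap (c : Fin (N + 1) → ι) (a b : Fin (N + 1)) :
    (c ∘ Equiv.swap a b) ∘ Equiv.swap a b = c := by
  ext k; simp

lemma sum_cancelTerm {X : Finset ι} {θ : Fin (N + 1) → ι → ℂ} {C : Finset ι}
    {v : Fin (N + 1) → ℂ} (hv : ∀ x ∈ C, L x ⬝ᵥ v = 0) (j : Fin N) {m : ι → ℕ}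
    (hm : ∀ i, 0 < m i) : ∑ c, cancelTerm L X θ C v j c m = 0 := by
  have key : ∀ c, cancelTerm L X θ C v j c m +
      cancelTerm L X θ C v j (c ∘ Equiv.swap j.castSucc j.succ) m = 0 := by
    intro c
    by_cases h : Through L X c j
    · have h' := h.swap
      rw [cancelTerm, cancelTerm, if_pos h, if_pos h', ssum_mul_wt h.1 _ hm,
        ssum_mul_wt h'.1 _ hm, det_weight_comp_perm]
      have : ∏ k ∈ Finset.univ.erase j.castSucc,
          (ssum (cl L (c ∘ Equiv.swap j.castSucc j.succ) k) m)⁻¹ =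
          ∏ k ∈ Finset.univ.erase j.castSucc, (ssum (cl L c k) m)⁻¹ :=
        Finset.prod_congr rfl fun k hk => by
          rw [cl_swap h.1 (by simp) (Finset.ne_of_mem_erase hk)]
      rw [this, ← add_mul, hterm_swap h.1 (by simp) hv, zero_mul]
    · have h' : ¬ Through L X (c ∘ Equiv.swap j.castSucc j.succ) j := fun h' =>
        h (by simpa only [swap_swap] using h'.swap)
      rw [cancelTerm, cancelTerm, if_neg h, if_neg h', add_zero]
  have h2 : ∑ c, cancelTerm L X θ C v j (c ∘ Equiv.swap j.castSucc j.succ) m =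
      ∑ c, cancelTerm L X θ C v j c m := by
    refine Fintype.sum_bijective (fun c => c ∘ Equiv.swap j.castSucc j.succ) ?_ _ _ fun c => rfl
    exact Function.Involutive.bijective fun c => swap_swap c _ _
  have h3 : ∑ c, cancelTerm L X θ C v j c m +
      ∑ c, cancelTerm L X θ C v j (c ∘ Equiv.swap j.castSucc j.succ) m = 0 := by
    rw [← Finset.sum_add_distrib]
    exact Finset.sum_eq_zero fun c _ => key c
  rw [h2] at h3
  simpa using h3

lemma residue_term_mem (hL : ∀ i, L i ≠ 0) {X : Finset ι} {hX : X.Nonempty}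
    {θ : Fin (N + 1) → ι → ℂ} {C : Finset ι} (hn : C.card = N)
    {v : Fin (N + 1) → ℂ} (hv : ∀ x ∈ C, L x ⬝ᵥ v = 0) (c : Fin (N + 1) → ι) :
    (fun m => (∑ i ∈ X, (L i ⬝ᵥ v) * resVal L c (insert i C) * (m i : ℂ)) * wt L θ c m -
      ∑ j, cancelTerm L X θ C v j c m) ∈ regAlg X hX := by
  classical
  by_cases hc : (tmat L c).det = 0
  · convert Subalgebra.zero_mem (regAlg X hX) using 1
    ext m
    simp [cancelTerm, wt_eq_zero hc]
  by_cases hp : ∃ p, cl L c p = X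
  · obtain ⟨p, hp⟩ := hp
    refine mem_fracAlg_congr (ψ := fun m => hterm L c C v p * (ssum X m * wt L θ c m))
      (fun m hm => ?_) (const_mul_mem _ (ssum_mul_wt_mem (hX := hX) hc hp))
    choose lay hlay using fun i => exists_layer hc (hL i)
    have hcl : ∀ i k, i ∈ cl L c k ↔ lay i ≤ k := by
      intro i k
      rw [mem_cl_iff_layer hc]
      exact ⟨fun h => h _ (hlay i), fun h l hl => hl.unique (hlay i) ▸ h⟩
    have hT : ∀ j : Fin N, Through L X c j ↔ j.succ ≤ p := by
      intro j
      refine ⟨?_, fun h => ⟨hc, p, h, hp⟩⟩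
      rintro ⟨_, q, hq, hqX⟩
      rwa [← cl_injective hc (hqX.trans hp.symm)]
    have h1 : ∀ i ∈ X, (L i ⬝ᵥ v) * resVal L c (insert i C) * (m i : ℂ) =
        hterm L c C v p * (m i : ℂ) + ∑ j : Fin N, if j.succ ≤ p then
          (hterm L c C v j.castSucc - hterm L c C v j.succ) *
            (if i ∈ cl L c j.castSucc then (m i : ℂ) else 0) else 0 := by
      intro i hi
      rw [dot_mul_resVal_insert hc (by omega) hv (hlay i),
        sum_telescope (hterm L c C v) (lay i) p ((hcl i p).mp (hp ▸ hi)), add_mul, Finset.sum_mul]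
      congr 1
      refine Finset.sum_congr rfl fun j _ => ?_
      simp only [hcl]
      by_cases h1 : lay i ≤ j.castSucc <;> by_cases h2 : j.succ ≤ p <;> simp [h1, h2]
    have h2 : ∀ j : Fin N, (∑ i ∈ X, if j.succ ≤ p then
          (hterm L c C v j.castSucc - hterm L c C v j.succ) *
            (if i ∈ cl L c j.castSucc then (m i : ℂ) else 0) else 0) * wt L θ c m =
        cancelTerm L X θ C v j c m := by
      intro j
      rw [cancelTerm]
      by_cases h : j.succ ≤ p
      · have hsub : X.filter (fun i => i ∈ cl L c j.castSucc) = cl L c j.castSucc := by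
          ext i
          rw [Finset.mem_filter, and_iff_right_iff_imp]
          intro hi
          rw [← hp, hcl]
          exact (((hcl _ _).mp hi).trans Fin.castSucc_lt_succ.le).trans h
        rw [if_pos ((hT j).mpr h)]
        simp only [h, if_true]
        rw [← Finset.mul_sum, ← Finset.sum_filter, hsub, ssum, mul_assoc]
      · rw [if_neg (mt (hT j).mp h)]
        simp [h]
    rw [Finset.sum_congr rfl h1, Finset.sum_add_distrib, Finset.sum_comm, add_mul,
      Finset.sum_mul Finset.univ, Finset.sum_congr rfl fun j _ => h2 j, add_sub_cancel_right,
      ← Finset.mul_sum, ssum, mul_assoc]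
  · have hB : ∀ j m, cancelTerm L X θ C v j c m = 0 := fun j m =>
      if_neg fun h => hp ⟨_, h.2.choose_spec.2⟩
    simp only [hB, Finset.sum_const_zero, sub_zero]
    push Not at hp
    refine fun_mul_mem (φ := fun m => ∑ i ∈ X, (L i ⬝ᵥ v) * resVal L c (insert i C) * (m i : ℂ))
      (fun_sum_mem fun i _ => const_mul_mem _ ?_) (wt_mem_regAlg hp)
    convert pev_mem_regAlg (X := X) (hX := hX) (MvPolynomial.X i) using 1
    ext m
    simp [pev_apply]

end Telescope

theorem sum_resVal_insert_mem {n : ℕ} {ι : Type} [Fintype ι] [DecidableEq ι]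
    {L : ι → Fin n → ℂ} (hL : ∀ i, L i ≠ 0) {X : Finset ι} {hX : X.Nonempty}
    {θ : Fin n → ι → ℂ} {C : Finset ι} (hn : C.card + 1 = n)
    {v : Fin n → ℂ} (hv : ∀ x ∈ C, L x ⬝ᵥ v = 0) :
    (fun m => ∑ i ∈ X, (L i ⬝ᵥ v) *
      ((m i : ℂ) * ∑ c, resVal L c (insert i C) * wt L θ c m)) ∈ regAlg X hX := by
  subst hn
  refine mem_fracAlg_congr (ψ := fun m => ∑ c,
    ((∑ i ∈ X, (L i ⬝ᵥ v) * resVal L c (insert i C) * (m i : ℂ)) * wt L θ c m -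
      ∑ j, cancelTerm L X θ C v j c m)) (fun m hm => ?_) ?_
  · rw [Finset.sum_sub_distrib, Finset.sum_comm (f := fun c j => cancelTerm L X θ C v j c m),
      Finset.sum_congr rfl fun j _ => sum_cancelTerm hv j hm]
    simp only [Finset.sum_const_zero, sub_zero, Finset.sum_mul, Finset.mul_sum]
    rw [Finset.sum_comm]
    refine Finset.sum_congr rfl fun c _ => Finset.sum_congr rfl fun i _ => ?_
    ring
  · exact fun_sum_mem fun c _ => residue_term_mem (hX := hX) hL rfl hv c

section Expansion

variable {n : ℕ} {ι : Type} [Fintype ι] [DecidableEq ι] {L : ι → Fin n → ℂ}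

open Classical in
variable (L) in
/-- The matrix of sums of `θ` over the layers of a tuple. -/
def layerMat (θ : Fin n → ι → ℂ) (τ : Fin n → ι) : Matrix (Fin n) (Fin n) ℂ :=
  Matrix.of fun a k => ∑ i with Layer L τ i k, θ a i

lemma layer_tuple_symm {c τ : Fin n → ι} (hc : (tmat L c).det ≠ 0)
    (h : ∀ k, Layer L c (τ k) k) (k : Fin n) : Layer L τ (c k) k :=
  (layer_iff_of_layer hc h _ _).mpr (layer_self hc k)

lemma sum_det_layers (θ : Fin n → ι → ℂ) {τ : Fin n → ι} [∀ k, DecidablePred (Layer L τ · k)] :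
    ∑ c ∈ Fintype.piFinset fun k => Finset.univ.filter (Layer L τ · k),
      (Matrix.of fun a k => θ a (c k)).det = (layerMat L θ τ).det := by
  have h := (Matrix.detRowAlternating (R := ℂ) (n := Fin n)).toMultilinearMap.map_sum_finset
    (fun k i => fun a => θ a i) (fun k => Finset.univ.filter (Layer L τ · k))
  have h1 : (Matrix.detRowAlternating (R := ℂ) (n := Fin n)).toMultilinearMap
      (fun k => ∑ i ∈ Finset.univ.filter (Layer L τ · k), fun a => θ a i) =
      (layerMat L θ τ).det := by
    rw [← Matrix.det_transpose]
    change Matrix.det _ = _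
    congr 1
    ext k a
    simp only [layerMat, Matrix.transpose_apply, Matrix.of_apply, Finset.sum_apply]
    congr!
  rw [← h1, h]
  refine Finset.sum_congr rfl fun c _ => ?_
  rw [← Matrix.det_transpose]
  rfl

theorem sum_resVal_wt (θ : Fin n → ι → ℂ) (C : Finset ι) (m : ι → ℕ) :
    ∑ c, resVal L c C * wt L θ c m = ∑ τ ∈ Fintype.piFinset fun _ : Fin n => C,
      (tmat L τ).det⁻¹ * (layerMat L θ τ).det * ∏ k, (ssum (cl L τ k) m)⁻¹ := by
  classical
  have h1 : ∀ c : Fin n → ι, resVal L c C * wt L θ c m = ∑ τ ∈ Fintype.piFinset fun _ : Fin n => C,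
      if (tmat L c).det ≠ 0 ∧ ∀ k, Layer L c (τ k) k then (tmat L τ).det⁻¹ *
        (Matrix.of fun a k => θ a (c k)).det * ∏ k, (ssum (cl L τ k) m)⁻¹ else 0 := by
    intro c
    by_cases hc : (tmat L c).det = 0
    · simp [hc, wt_eq_zero]
    · rw [resVal, Finset.prod_univ_sum, Finset.sum_mul]
      refine Finset.sum_congr rfl fun τ _ => ?_
      by_cases h : ∀ k, Layer L c (τ k) k
      · have hcl : ∏ k, (ssum (cl L τ k) m)⁻¹ = ∏ k, (ssum (cl L c k) m)⁻¹ :=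
          Finset.prod_congr rfl fun k _ => by rw [cl_eq_of_layer hc h]
        rw [if_pos ⟨hc, h⟩, Finset.prod_congr rfl fun k _ => if_pos (h k), wt, det_of_layer hc h,
          mul_inv, Finset.prod_inv_distrib, hcl]
        ring
      · rw [if_neg (fun h' => h h'.2)]
        push Not at h
        obtain ⟨k, hk⟩ := h
        rw [Finset.prod_eq_zero (Finset.mem_univ k) (if_neg hk), zero_mul]
  rw [Finset.sum_congr rfl fun c _ => h1 c, Finset.sum_comm]
  refine Finset.sum_congr rfl fun τ _ => ?_
  by_cases hτ : (tmat L τ).det = 0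
  · simp [hτ]
  · rw [← sum_det_layers, Finset.mul_sum, Finset.sum_mul, ← Finset.sum_filter]
    refine Finset.sum_congr ?_ fun c _ => rfl
    ext c
    simp only [Finset.mem_filter, Finset.mem_univ, true_and, Fintype.mem_piFinset]
    constructor
    · rintro ⟨hc, h⟩ k
      exact layer_tuple_symm hc h k
    · intro h
      exact ⟨det_ne_zero_of_layer hτ h, layer_tuple_symm hτ h⟩

end Expansion

section Trees

variable {n : ℕ} {ι : Type} [Fintype ι] [DecidableEq ι] (L : ι → Fin n → ℂ)

/-- A rooted tree structure on a basis of forms. -/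
structure BasisTree where
  B : Finset ι
  ρ : ι
  par : ι → ι
  j : ι → ι
  sub : ι → Finset ι
  base : IsBase L B
  root_mem : ρ ∈ B
  sub_root : sub ρ = B
  mem_sub : ∀ b ∈ B, b ∈ sub b
  sub_sub : ∀ b ∈ B, sub b ⊆ B
  sub_trans : ∀ b ∈ B, ∀ c ∈ sub b, sub c ⊆ sub b
  par_of_mem : ∀ c ∈ B, ∀ b ∈ sub c, b ≠ c → b ≠ ρ ∧ par b ∈ sub c
  par_mem : ∀ b ∈ B, b ≠ ρ → par b ∈ B ∧ par b ∉ sub b ∧ b ∈ sub (par b)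
  laminar : ∀ b ∈ B, ∀ c ∈ B, ∀ x, x ∈ sub b → x ∈ sub c → b ∈ sub c ∨ c ∈ sub b
  sep : ∀ i, ∃ c ∈ B, L i ∉ sp L (B.erase c) ∧ L i ∈ sp L (sub c)
  link : ∀ b ∈ B, b ≠ ρ → L (j b) ∉ sp L (B.erase b) ∧ L (j b) ∉ sp L (B.erase (par b)) ∧
    L (j b) ∈ sp L (sub (par b))

variable {L}

theorem exists_basisTree [Nonempty ι] (hspan : sp L Finset.univ = ⊤)
    (hL : ∀ i, L i ≠ 0) (hconn : Conn L Finset.univ) : Nonempty (BasisTree L) := by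
  obtain ⟨T⟩ := exists_forest (L := L) (F := Finset.univ) (W := ⊥) (Z := Finset.univ)
    disjoint_bot_right (fun z _ => by rw [hspan]; simp) (by
      intro I _ hI0 hdis
      obtain ⟨i, hi⟩ := hI0
      refine ⟨i, Finset.mem_univ _, ?_⟩
      rw [sup_bot_eq]
      exact fun h => hL i (Submodule.disjoint_def.mp hdis _ (mem_sp hi) h))
  obtain ⟨ρ, hρ, hsub⟩ := T.conn hconn Finset.univ_nonempty
  have hnone : T.par ρ = none := by
    by_contra h
    obtain ⟨p, hp⟩ := Option.ne_none_iff_exists'.mp h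
    have := T.par_mem ρ hρ p hp
    rw [hsub] at this
    exact this.2.1 this.1
  have hpar : ∀ b ∈ T.B, b ≠ ρ → ∃ p, T.par b = some p := fun b hb hne =>
    (T.par_of_mem ρ hρ b (by rwa [hsub]) hne).imp fun p h => h.1
  refine ⟨{ B := T.B, ρ := ρ, par := fun b => (T.par b).getD ρ, j := T.j, sub := T.sub,
            base := isBase_of_span_eq_top T.indep ?_, root_mem := hρ, sub_root := hsub,
            mem_sub := T.mem_sub, sub_sub := T.sub_sub, sub_trans := T.sub_trans,
            par_of_mem := ?_, par_mem := ?_, laminar := T.laminar,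
            sep := fun i => T.sep i (Finset.mem_univ i), link := ?_ }⟩
  · rw [eq_top_iff, ← hspan]
    exact sp_le T.span
  · intro c hc b hb hne
    obtain ⟨p, hp, hpc⟩ := T.par_of_mem c hc b hb hne
    refine ⟨?_, by simpa [hp] using hpc⟩
    rintro rfl
    rw [hnone] at hp
    simp at hp
  · intro b hb hne
    obtain ⟨p, hp⟩ := hpar b hb hne
    simpa [hp] using T.par_mem b hb p hp
  · intro b hb hne
    obtain ⟨p, hp⟩ := hpar b hb hne
    simpa [hp] using T.link b hb p hp

namespace BasisTree

variable (T : BasisTree L)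

/-- An enumeration of the basis of the tree. -/
def enum : Fin n ≃ T.B := (T.B.equivFinOfCardEq T.base.2).symm

/-- The functions defining the twisted period associated with a tree. -/
def theta (a : Fin n) (i : ι) : ℂ :=
  (if i = T.enum a then 1 else 0) - if (T.enum a : ι) ≠ T.ρ ∧ i = T.j (T.enum a) then 1 else 0

lemma sp_erase {K : Finset ι} (hK : K ⊆ T.B) {b : ι} (hb : b ∉ K) : sp L K ≤ sp L (T.B.erase b) :=
  sp_mono (Finset.subset_erase.mpr ⟨hK, hb⟩)

lemma notMem_sp {K : Finset ι} (hK : K ⊆ T.B) {b : ι} (hbB : b ∈ T.B) (hb : b ∉ K) :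
    L b ∉ sp L K := fun h => notMem_span_erase T.base.1 hbB (T.sp_erase hK hb h)

variable {T}

lemma layerMat_row {τ : Fin n → ι} {a k k' : Fin n} (hk : Layer L τ (T.enum a) k)
    (hρ : (T.enum a : ι) ≠ T.ρ) (hk' : Layer L τ (T.j (T.enum a)) k') :
    layerMat L T.theta τ a = Pi.single k 1 - Pi.single k' 1 := by
  classical
  ext l
  simp only [layerMat, Matrix.of_apply, theta, Finset.sum_sub_distrib, Pi.sub_apply,
    Pi.single_apply]
  congr 1
  · simp only [Finset.sum_ite_eq', Finset.mem_filter, Finset.mem_univ, true_and]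
    exact if_congr ⟨fun h => h.unique hk, fun h => h ▸ hk⟩ rfl rfl
  · simp only [hρ, ne_eq, not_false_eq_true, true_and, Finset.sum_ite_eq', Finset.mem_filter,
      Finset.mem_univ]
    exact if_congr ⟨fun h => h.unique hk', fun h => h ▸ hk'⟩ rfl rfl

/-- The span of the first `q` forms of a tuple. -/
abbrev prefSpan (L : ι → Fin n → ℂ) (τ : Fin n → ι) (q : ℕ) : Submodule ℂ (Fin n → ℂ) :=
  Submodule.span ℂ ((fun k => L (τ k)) '' {k | k.val < q})

lemma finrank_span_tuple {τ : Fin n → ι} (hτ : (tmat L τ).det ≠ 0) (s : Finset (Fin n)) :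
    Module.finrank ℂ (Submodule.span ℂ ((fun k => L (τ k)) '' (s : Set (Fin n)))) = s.card := by
  have h := (det_ne_zero_iff.mp hτ).comp (fun k : s => (k : Fin n)) Subtype.val_injective
  have := finrank_span_eq_card h
  rw [Set.image_eq_range]
  simpa [Function.comp_def] using this

theorem det_layerMat_eq_zero (hL : ∀ i, L i ≠ 0) {τ : Fin n → ι} (hτ : (tmat L τ).det ≠ 0)
    {q : ℕ} {K : Finset ι} (hKB : K ⊆ T.B) (hK : prefSpan L τ q = sp L K) {c : ι} (hc : c ∈ K)
    (hsub : ¬ T.sub c ⊆ K) : (layerMat L T.theta τ).det = 0 := by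
  classical
  by_contra hdet
  have hcB := hKB hc
  choose lay hlay using fun i => exists_layer hτ (hL i)
  set R := T.sub c \ K with hR
  have hRB : ∀ b ∈ R, b ∈ T.B := fun b hb => T.sub_sub c hcB (Finset.mem_sdiff.mp hb).1
  have hRK : ∀ b ∈ R, b ∉ K := fun b hb => (Finset.mem_sdiff.mp hb).2
  have hRρ : ∀ b ∈ R, b ≠ T.ρ ∧ T.par b ∈ T.sub c := by
    intro b hb
    refine T.par_of_mem c hcB b (Finset.mem_sdiff.mp hb).1 ?_
    rintro rfl
    exact hRK _ hb hc
  have hlarge : ∀ i, L i ∉ sp L K → q ≤ (lay i).val := by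
    intro i hi
    by_contra hlt
    apply hi
    rw [← hK]
    refine (mem_span_image_iff hτ i _).mpr fun k hk => (hlay i).2 k ?_
    simp only [Set.mem_ofPred_eq, not_lt] at hk
    rw [Fin.lt_def]
    omega
  set J := Finset.univ.filter fun k : Fin n => q ≤ k.val ∧ ∃ i, L i ∈ sp L (T.sub c) ∧ Layer L τ i k
  have hJb : ∀ b ∈ R, lay b ∈ J := fun b hb => by
    simp only [J, Finset.mem_filter, Finset.mem_univ, true_and]
    exact ⟨hlarge b (T.notMem_sp hKB (hRB b hb) (hRK b hb)), b,
      mem_sp (Finset.mem_sdiff.mp hb).1, hlay b⟩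
  have hJj : ∀ b ∈ R, lay (T.j b) ∈ J := fun b hb => by
    obtain ⟨h1, h2⟩ := hRρ b hb
    obtain ⟨l1, -, l3⟩ := T.link b (hRB b hb) h1
    simp only [J, Finset.mem_filter, Finset.mem_univ, true_and]
    exact ⟨hlarge _ fun h => l1 (T.sp_erase hKB (hRK b hb) h), T.j b,
      sp_mono (T.sub_trans c hcB _ h2) l3, hlay _⟩
  -- the number of columns is at most the number of rows
  have hcard : J.card ≤ R.card := by
    have hx : ∀ k, ∃ i, Layer L τ i k ∧ (k.val < q → i = τ k) ∧ (k ∈ J → L i ∈ sp L (T.sub c)) := by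
      intro k
      by_cases hk : k ∈ J
      · obtain ⟨h1, i, h2, h3⟩ := (Finset.mem_filter.mp hk).2
        exact ⟨i, h3, fun h => absurd h (by omega), fun _ => h2⟩
      · exact ⟨τ k, layer_self hτ k, fun _ => rfl, fun h => absurd h hk⟩
    choose x hx1 hx2 hx3 using hx
    have hxdet := det_ne_zero_of_layer hτ hx1
    set P := Finset.univ.filter fun k : Fin n => k.val < q
    have hPJ : Disjoint P J := by
      rw [Finset.disjoint_left]
      intro k hk hk'
      have h1 := (Finset.mem_filter.mp hk).2
      have h2 := (Finset.mem_filter.mp hk').2.1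
      omega
    have hP : P.card = K.card := by
      have h1 := finrank_span_tuple hτ P
      have h2 : Submodule.span ℂ ((fun k => L (τ k)) '' (P : Set (Fin n))) = sp L K := by
        rw [← hK, prefSpan]
        congr 2
        ext k
        simp [P]
      rw [h2, finrank_sp (T.base.1.mono hKB)] at h1
      exact h1.symm
    have hle : Submodule.span ℂ ((fun k => L (x k)) '' ((P ∪ J : Finset (Fin n)) : Set (Fin n))) ≤
        sp L (K ∪ R) := by
      rw [Submodule.span_le]
      rintro _ ⟨k, hk, rfl⟩
      rw [Finset.mem_coe, Finset.mem_union] at hk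
      rcases hk with hk | hk
      · have hkq := (Finset.mem_filter.mp hk).2
        refine sp_mono Finset.subset_union_left ?_
        rw [← hK]
        exact Submodule.subset_span ⟨k, hkq, by simp only [hx2 k hkq]⟩
      · refine sp_mono ?_ (hx3 k hk)
        intro b hb
        by_cases hbK : b ∈ K
        · exact Finset.mem_union_left _ hbK
        · exact Finset.mem_union_right _ (Finset.mem_sdiff.mpr ⟨hb, hbK⟩)
    have h3 := Submodule.finrank_mono hle
    rw [finrank_span_tuple hxdet, finrank_sp (T.base.1.mono (by
      intro b hb
      rcases Finset.mem_union.mp (Finset.mem_coe.mp hb) with h | h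
      exacts [hKB h, hRB b h])), Finset.card_union_of_disjoint hPJ,
      Finset.card_union_of_disjoint (s := K) (t := R) Finset.disjoint_sdiff, hP] at h3
    omega
  -- the rows lie in a small subspace
  obtain ⟨b0, hb0, hb0K⟩ := Finset.not_subset.mp hsub
  have hb0R : b0 ∈ R := Finset.mem_sdiff.mpr ⟨hb0, hb0K⟩
  set j0 := lay b0
  set Y := (J.erase j0).image fun k => (Pi.single k 1 - Pi.single j0 1 : Fin n → ℂ)
  have hY : ∀ k ∈ J, (Pi.single k 1 - Pi.single j0 1 : Fin n → ℂ) ∈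
      Submodule.span ℂ (Y : Set (Fin n → ℂ)) := by
    intro k hk
    by_cases hkj : k = j0
    · rw [hkj, sub_self]
      exact Submodule.zero_mem _
    · exact Submodule.subset_span (Finset.mem_coe.mpr (Finset.mem_image.mpr
        ⟨k, Finset.mem_erase.mpr ⟨hkj, hk⟩, rfl⟩))
  have hind : LinearIndependent ℂ (fun a => layerMat L T.theta τ a) :=
    Matrix.linearIndependent_rows_iff_isUnit.mpr
      ((Matrix.isUnit_iff_isUnit_det _).mpr (isUnit_iff_ne_zero.mpr hdet))
  have hindR := hind.comp (fun b : R => T.enum.symm ⟨b, hRB b b.2⟩) (fun b b' h => by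
    have := T.enum.symm.injective h
    exact Subtype.ext (by simpa using this))
  have hrow : ∀ b : R, layerMat L T.theta τ (T.enum.symm ⟨b, hRB b b.2⟩) ∈
      Submodule.span ℂ (Y : Set (Fin n → ℂ)) := by
    rintro ⟨b, hb⟩
    rw [layerMat_row (k := lay b) (k' := lay (T.j b)) (by simpa using hlay b)
      (by simpa using (hRρ b hb).1) (by simpa using hlay (T.j b))]
    have := Submodule.sub_mem _ (hY _ (hJb b hb)) (hY _ (hJj b hb))
    simpa using this
  have h5 := finrank_span_eq_card hindR
  have h6 : Submodule.span ℂ (Set.range ((fun a => layerMat L T.theta τ a) ∘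
      fun b : R => T.enum.symm ⟨b, hRB b b.2⟩)) ≤ Submodule.span ℂ (Y : Set (Fin n → ℂ)) := by
    rw [Submodule.span_le]
    rintro _ ⟨b, rfl⟩
    exact hrow b
  have h7 := Submodule.finrank_mono h6
  have h8 := finrank_span_finset_le_card (R := ℂ) Y
  have h9 : Y.card ≤ (J.erase j0).card := Finset.card_image_le
  rw [Finset.card_erase_of_mem (hJb b0 hb0R)] at h9
  have h10 : 0 < J.card := Finset.card_pos.mpr ⟨_, hJb b0 hb0R⟩
  rw [h5, Fintype.card_coe] at h7
  change _ ≤ _ at h8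
  unfold Set.finrank at h8
  omega

end BasisTree

end Trees

section Flats

variable {n : ℕ} {ι : Type} [Fintype ι] [DecidableEq ι] {L : ι → Fin n → ℂ}

open Classical in
variable (L) in
/-- The flat spanned by a set of indices. -/
def flat (K : Finset ι) : Finset ι := Finset.univ.filter fun i => L i ∈ sp L K

lemma mem_flat {K : Finset ι} {i : ι} : i ∈ flat L K ↔ L i ∈ sp L K := by
  simp [flat]

lemma sp_flat (K : Finset ι) : sp L (flat L K) = sp L K := by
  apply le_antisymm
  · rw [sp, Submodule.span_le]
    rintro _ ⟨i, hi, rfl⟩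
    exact mem_flat.mp hi
  · exact sp_mono fun i hi => mem_flat.mpr (mem_sp hi)

lemma flat_eq_of_sp_eq {X K : Finset ι} (hX : ∀ i, L i ∈ sp L X → i ∈ X) (h : sp L K = sp L X) :
    flat L K = X := by
  ext i
  rw [mem_flat, h]
  exact ⟨hX i, mem_sp⟩

lemma sp_cl {τ : Fin n → ι} (hτ : (tmat L τ).det ≠ 0) (k : Fin n) :
    sp L (cl L τ k) = BasisTree.prefSpan L τ (k.val + 1) := by
  have hset : {l : Fin n | l.val < k.val + 1} = {l | l ≤ k} := by
    ext l
    exact Nat.lt_succ_iff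
  apply le_antisymm
  · rw [sp, Submodule.span_le, BasisTree.prefSpan, hset]
    rintro _ ⟨i, hi, rfl⟩
    exact mem_span_tuple hτ hi
  · rw [BasisTree.prefSpan, hset, Submodule.span_le]
    rintro _ ⟨l, hl, rfl⟩
    exact mem_sp ((self_mem_cl hτ).mpr hl)

lemma flat_cl {τ : Fin n → ι} (hτ : (tmat L τ).det ≠ 0) (k : Fin n) {i : ι}
    (hi : L i ∈ sp L (cl L τ k)) : i ∈ cl L τ k := by
  rw [mem_cl]
  intro k' hk'
  rw [sp_cl hτ, BasisTree.prefSpan, mem_span_image_iff hτ] at hi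
  refine hi k' ?_
  simp only [Set.mem_ofPred_eq, not_lt]
  omega

end Flats

section Regularity

variable {n : ℕ} {ι : Type} [Fintype ι] [DecidableEq ι] {L : ι → Fin n → ℂ}

/-- The product of linear functions clearing the denominators attached to a tree. -/
def BasisTree.norm (T : BasisTree L) (m : ι → ℕ) : ℂ :=
  ∏ b ∈ T.B.erase T.ρ, ssum (flat L (T.sub b)) m

/-- Period systems whose values on bases are given by a tree. -/
structure IsTreeSystem (T : BasisTree L) (S : PeriodSystem L ((ι → ℕ) → ℂ)) : Prop where
  s_apply : ∀ i φ m, S.s i φ m = m i * φ m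
  q_apply : ∀ C, IsBase L C → ∀ m,
    S.q C 1 m = T.norm m * ∑ c, resVal L c C * wt L T.theta c m

variable {T : BasisTree L} {S : PeriodSystem L ((ι → ℕ) → ℂ)}

lemma BasisTree.norm_mem {X : Finset ι} {hX : X.Nonempty} : T.norm ∈ regAlg X hX := by
  have : T.norm = ∏ b ∈ T.B.erase T.ρ, ssum (flat L (T.sub b)) := by
    ext m
    simp [BasisTree.norm]
  rw [this]
  exact Subalgebra.prod_mem _ fun b _ => ssum_mem_regAlg _

namespace IsTreeSystem

lemma s_mem (hS : IsTreeSystem T S) {X : Finset ι} {hX : X.Nonempty} (i : ι) {φ : (ι → ℕ) → ℂ}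
    (h : φ ∈ regAlg X hX) :
    S.s i φ ∈ regAlg X hX := by
  have : S.s i φ = fun m => ssum {i} m * φ m := by
    ext m
    simp [hS.s_apply, ssum]
  rw [this]
  exact fun_mul_mem (ssum_mem_regAlg _) h

lemma q_eq (hS : IsTreeSystem T S) {C : Finset ι} (hC : IsBase L C) :
    S.q C 1 = fun m => T.norm m * ∑ c, resVal L c C * wt L T.theta c m :=
  funext (hS.q_apply C hC)

lemma insert_mem (hS : IsTreeSystem T S) (hL : ∀ i, L i ≠ 0) {X : Finset ι} {hX : X.Nonempty}
    {C : Finset ι}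
    (hC : LinearIndepOn ℂ L (C : Set ι)) (hn : C.card + 1 = n) {v : Fin n → ℂ}
    (hv : ∀ c ∈ C, L c ⬝ᵥ v = 0) :
    ∑ i ∈ X, (L i ⬝ᵥ v) • S.s i (S.q (insert i C) 1) ∈ regAlg X hX := by
  have h := fun_mul_mem (T.norm_mem (X := X) (hX := hX))
    (sum_resVal_insert_mem (L := L) hL (X := X) (hX := hX) (θ := T.theta) hn hv)
  convert h using 1
  ext m
  rw [Finset.sum_apply, Finset.mul_sum]
  refine Finset.sum_congr rfl fun i _ => ?_
  rw [Pi.smul_apply, hS.s_apply, smul_eq_mul]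
  by_cases hi : L i ∈ sp L C
  · have : L i ⬝ᵥ v = 0 := by
      rw [dot_eq_of_mem_sp (v' := 0) (fun c hc => by rw [hv c hc, dotProduct_zero]) hi,
        dotProduct_zero]
    simp [this]
  · rw [hS.q_apply]
    · ring
    · refine ⟨?_, ?_⟩
      · rw [Finset.coe_insert]
        exact hC.insert hi
      · rw [Finset.card_insert_of_notMem (fun h => hi (mem_sp h)), hn]

lemma regular (hS : IsTreeSystem T S) (hL : ∀ i, L i ≠ 0) {X : Finset ι} (hX : X.Nonempty) (N : ℕ) :
    SmallReg S (Subalgebra.toSubmodule (regAlg X hX)) X N ∧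
      FamilyReg S (Subalgebra.toSubmodule (regAlg X hX)) X N := by
  refine regular_of_bases (fun i j φ => ?_) _ (fun i φ h => hS.s_mem (hX := hX) i h) (fun C hC h => ?_)
    (fun C hC hn v hv => hS.insert_mem (hX := hX) hL hC hn hv) N
  · ext m
    simp only [hS.s_apply]
    ring
  · rw [hS.q_eq hC]
    exact fun_mul_mem T.norm_mem (fun_sum_mem fun c _ => resVal_wt_mem h)

lemma completion_mem (hS : IsTreeSystem T S) (hL : ∀ i, L i ≠ 0) {X : Finset ι} (hX : X.Nonempty)
    (hflat : ∀ i, L i ∈ sp L X → i ∈ X) (hne : X ≠ Finset.univ)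
    (hBX : sp L (T.B ∩ X) = sp L X) {C : Finset ι} (hC : LinearIndepOn ℂ L (C : Set ι))
    (hdis : Disjoint (sp L X) (sp L C)) (htop : sp L X ⊔ sp L C = ⊤) :
    S.q (T.B ∩ X ∪ C) 1 ∈ regAlg X hX := by
  classical
  set K := T.B ∩ X with hKdef
  have hKB : K ⊆ T.B := Finset.inter_subset_left
  have hKX : K ⊆ X := Finset.inter_subset_right
  have hKind : LinearIndepOn ℂ L (K : Set ι) := T.base.1.mono hKB
  have hbase : IsBase L (K ∪ C) := isBase_union hKind hC (by rwa [hBX]) (by rwa [hBX])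
  have hKne : K.Nonempty := by
    by_contra h
    rw [Finset.not_nonempty_iff_eq_empty] at h
    rw [h, sp_empty] at hBX
    obtain ⟨x, hx⟩ := hX
    have := mem_sp (L := L) hx
    rw [← hBX, Submodule.mem_bot] at this
    exact hL x this
  by_cases hdown : ∀ c ∈ K, T.sub c ⊆ K
  · obtain ⟨c, hc, hmax⟩ := Finset.exists_max_image K (fun c => (T.sub c).card) hKne
    have hcB := hKB hc
    by_cases hK1 : T.sub c = K
    · -- one maximal element
      rw [hS.q_eq hbase]
      have hcρ : c ≠ T.ρ := by
        rintro rfl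
        rw [T.sub_root] at hK1
        apply hne
        rw [Finset.eq_univ_iff_forall]
        intro i
        apply hflat
        rw [← hBX, ← hK1, sp, T.base.span_eq_top]
        trivial
      have hcf : flat L (T.sub c) = X := by
        rw [hK1]
        exact flat_eq_of_sp_eq hflat hBX
      have hnorm : ∀ m, T.norm m =
          (∏ b ∈ (T.B.erase T.ρ).erase c, ssum (flat L (T.sub b)) m) * ssum X m := by
        intro m
        rw [BasisTree.norm, ← Finset.prod_erase_mul _ _ (Finset.mem_erase.mpr ⟨hcρ, hcB⟩), hcf]
      have hprod : (fun m => ∏ b ∈ (T.B.erase T.ρ).erase c, ssum (flat L (T.sub b)) m) ∈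
          regAlg X hX := by
        have : (fun m => ∏ b ∈ (T.B.erase T.ρ).erase c, ssum (flat L (T.sub b)) m) =
            ∏ b ∈ (T.B.erase T.ρ).erase c, ssum (flat L (T.sub b)) := by
          ext m
          simp
        rw [this]
        exact Subalgebra.prod_mem _ fun b _ => ssum_mem_regAlg _
      have hsum : (fun m => ∑ t, resVal L t (K ∪ C) * (ssum X m * wt L T.theta t m)) ∈
          regAlg X hX := by
        refine fun_sum_mem fun t _ => const_mul_mem _ ?_
        by_cases ht : (tmat L t).det = 0
        · simp only [wt_eq_zero ht, Pi.zero_apply, mul_zero]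
          exact Subalgebra.zero_mem _
        · by_cases hp : ∃ p, cl L t p = X
          · obtain ⟨p, hp⟩ := hp
            exact ssum_mul_wt_mem ht hp
          · push Not at hp
            exact fun_mul_mem (ssum_mem_regAlg _) (wt_mem_regAlg hp)
      convert fun_mul_mem hprod hsum using 1
      ext m
      rw [hnorm, Finset.mul_sum, Finset.mul_sum]
      refine Finset.sum_congr rfl fun t _ => ?_
      ring
    · -- several maximal elements
      set K1 := T.sub c with hK1def
      have hK1K : K1 ⊆ K := hdown c hc
      have hK12 : K1 ∪ (K \ K1) = K := Finset.union_sdiff_of_subset hK1K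
      have hsplit : ∀ i ∈ X, L i ∈ sp L K1 ∨ L i ∈ sp L (K \ K1) := by
        intro i hi
        obtain ⟨b, hb, hb1, hb2⟩ := T.sep i
        have hbK : b ∈ K := by
          by_contra h
          have h3 := mem_sp (L := L) hi
          rw [← hBX] at h3
          exact hb1 (T.sp_erase hKB h h3)
        by_cases hb3 : b ∈ K1
        · exact Or.inl (sp_mono (T.sub_trans c hcB b hb3) hb2)
        · refine Or.inr (sp_mono (fun x hx => ?_) hb2)
          refine Finset.mem_sdiff.mpr ⟨hdown b hbK hx, fun hx1 => ?_⟩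
          rcases T.laminar b hb c hcB x hx hx1 with h | h
          · exact hb3 h
          · have h4 := Finset.eq_of_subset_of_card_le (T.sub_trans b hb c h) (hmax b hbK)
            exact hb3 (by rw [hK1def, h4]; exact T.mem_sub b hb)
      obtain ⟨v, hv⟩ := exists_dual hbase.1
      have hK1C : K1 ⊆ K ∪ C := hK1K.trans Finset.subset_union_left
      have hE : ∀ x ∈ K1, ∑ i ∈ X, (L i ⬝ᵥ v x) •
          S.s i (S.q (insert i ((K ∪ C).erase x)) 1) ∈ regAlg X hX := by
        intro x hx
        refine hS.insert_mem hL (hbase.1.mono (by simp)) ?_ ?_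
        · rw [Finset.card_erase_add_one (hK1C hx), hbase.2]
        · intro y hy
          rw [hv y (Finset.mem_of_mem_erase hy) x (hK1C hx), if_neg (Finset.ne_of_mem_erase hy)]
      have hcoef : ∀ i, L i ∈ sp L K1 → L i = ∑ x ∈ K1, (L i ⬝ᵥ v x) • L x := by
        intro i hi
        obtain ⟨β, hβ⟩ := exists_sum_of_mem_span hi
        rw [hβ]
        refine Finset.sum_congr rfl fun x hx => ?_
        congr 1
        rw [sum_dotProduct, Finset.sum_eq_single x]
        · rw [smul_dotProduct, hv x (hK1C hx) x (hK1C hx), if_pos rfl, smul_eq_mul, mul_one]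
        · intro y hy hyx
          rw [smul_dotProduct, hv y (hK1C hy) x (hK1C hx), if_neg hyx, smul_zero]
        · exact fun h => absurd hx h
      have hzero : ∀ i, L i ∈ sp L (K \ K1) → ∀ x ∈ K1, L i ⬝ᵥ v x = 0 := by
        intro i hi x hx
        rw [dot_eq_of_mem_sp (v' := 0) (fun y hy => ?_) hi, dotProduct_zero]
        rw [dotProduct_zero, hv y (Finset.mem_union_left _ (Finset.mem_sdiff.mp hy).1) x (hK1C hx),
          if_neg]
        rintro rfl
        exact (Finset.mem_sdiff.mp hy).2 hx
      set X1 := flat L K1 with hX1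
      have hX1X : X1 ⊆ X := fun i hi => hflat i (by
        rw [← hBX]; exact sp_mono hK1K (mem_flat.mp hi))
      have hX1ne : X1 ≠ X := by
        intro h
        have h1 : sp L K1 = sp L K := by rw [hBX, ← h, hX1, sp_flat]
        obtain ⟨y, hy, hy1⟩ := Finset.exists_of_ssubset (Finset.ssubset_iff_subset_ne.mpr
          ⟨hK1K, hK1⟩)
        exact T.notMem_sp (hK1K.trans hKB) (hKB hy) hy1 (by rw [h1]; exact mem_sp hy)
      have hex : ∀ i ∈ X1, ∑ x ∈ K1, (L i ⬝ᵥ v x) • S.q (insert i ((K ∪ C).erase x)) 1 =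
          S.q (K ∪ C) 1 := by
        intro i hi
        by_cases hiC : i ∈ K ∪ C
        · have hiK : i ∈ K1 := by
            by_contra h
            exact notMem_span_erase hbase.1 hiC (sp_mono (Finset.subset_erase.mpr ⟨hK1C, h⟩)
              (mem_flat.mp hi))
          rw [Finset.sum_eq_single i]
          · rw [hv i hiC i hiC, if_pos rfl, one_smul, Finset.insert_erase hiC]
          · intro y hy hyi
            rw [hv i hiC y (hK1C hy), if_neg (Ne.symm hyi), zero_smul]
          · exact fun h => absurd hiK h
        · have h1 : L i = ∑ x ∈ K ∪ C, (if x ∈ K1 then L i ⬝ᵥ v x else 0) • L x := by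
            simp only [ite_smul, zero_smul, Finset.sum_ite_mem]
            rw [Finset.inter_eq_right.mpr hK1C]
            exact hcoef i (mem_flat.mp hi)
          rw [S.exchange hiC h1]
          simp only [ite_smul, zero_smul, Finset.sum_ite_mem]
          rw [Finset.inter_eq_right.mpr hK1C]
      have hmain : (fun m => ssum X1 m * S.q (K ∪ C) 1 m) ∈ regAlg X hX := by
        have h1 := Subalgebra.sum_mem _ hE
        convert h1 using 1
        rw [Finset.sum_comm, ← Finset.sum_subset hX1X]
        · ext m
          rw [Finset.sum_apply, ssum, Finset.sum_mul]
          refine Finset.sum_congr rfl fun i hi => ?_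
          rw [← hS.s_apply, ← hex i hi, map_sum]
          simp only [map_smul]
        · intro i hi hi1
          refine Finset.sum_eq_zero fun x hx => ?_
          rcases hsplit i hi with h | h
          · exact absurd (mem_flat.mpr h) hi1
          · rw [hzero i h x hx, zero_smul]
      have hX1n : X1.Nonempty := ⟨c, mem_flat.mpr (mem_sp (T.mem_sub c hcB))⟩
      refine mem_fracAlg_congr (fun m hm => ?_)
        (fun_mul_mem (inv_ssum_mem_regAlg (hX := hX) hX1ne) hmain)
      rw [← mul_assoc, inv_mul_cancel₀ (ssum_ne_zero hX1n hm), one_mul]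
  · -- no term passes through the flat
    push Not at hdown
    obtain ⟨c, hc, hsub⟩ := hdown
    rw [hS.q_eq hbase]
    refine fun_mul_mem T.norm_mem ?_
    simp only [sum_resVal_wt]
    refine fun_sum_mem fun τ _ => ?_
    by_cases hτ : (tmat L τ).det = 0
    · simp only [hτ, inv_zero, zero_mul]
      exact Subalgebra.zero_mem _
    by_cases hk : ∃ k, cl L τ k = X
    · obtain ⟨k, hk⟩ := hk
      have := T.det_layerMat_eq_zero hL hτ (q := k + 1) hKB
        (by rw [← sp_cl hτ, hk, hBX]) hc hsub
      simp only [this, mul_zero, zero_mul]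
      exact Subalgebra.zero_mem _
    · push Not at hk
      exact const_mul_mem _ (prod_inv_ssum_mem fun k _ => hk k)

lemma base_mem (hS : IsTreeSystem T S) (hL : ∀ i, L i ≠ 0) {X : Finset ι} (hX : X.Nonempty)
    (hflat : ∀ i, L i ∈ sp L X → i ∈ X) (hne : X ≠ Finset.univ) (g : MvPolynomial (Fin n) ℂ) :
    S.q T.B g ∈ regAlg X hX := by
  refine mem_of_homogeneous (Subalgebra.toSubmodule (regAlg X hX)) (S.q T.B) (fun N g hg => ?_) g
  by_cases h : sp L (T.B ∩ X) = sp L X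
  · obtain ⟨x, hx⟩ := hX
    have hu : T.B ∩ X ∪ T.B \ X = T.B := by
      rw [Finset.union_comm, Finset.sdiff_union_inter]
    have h1 := (hS.regular hL ⟨x, hx⟩ N).2 {x} (fun _ => T.B ∩ X) (fun _ => LinearMap.id)
      (fun _ _ => Finset.inter_subset_right)
      (fun _ _ => T.base.1.mono Finset.inter_subset_left) (fun _ _ => h) (fun _ _ _ h => h)
      (fun _ _ _ _ => rfl) (fun C hC hd ht => by
        simp only [LinearMap.id_apply, Finset.sum_singleton]
        exact hS.completion_mem hL ⟨x, hx⟩ hflat hne h hC hd ht) (T.B \ X)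
      (T.base.1.mono (by simp)) (by
        rw [← h]
        refine disjoint_sp (by rw [hu]; exact T.base.1) ?_
        rw [Finset.disjoint_left]
        intro y hy hy'
        exact (Finset.mem_sdiff.mp hy').2 (Finset.mem_inter.mp hy).2) g hg
    simp only [LinearMap.id_apply, Finset.sum_singleton] at h1
    rwa [hu] at h1
  · exact (hS.regular hL hX N).1 T.B T.base.1 h g hg

lemma base_mem_univ (hS : IsTreeSystem T S) (hL : ∀ i, L i ≠ 0)
    (hX : (Finset.univ : Finset ι).Nonempty)
    {g : MvPolynomial (Fin n) ℂ} (hg : constantCoeff g = 0) :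
    S.q T.B g ∈ regAlg Finset.univ hX := by
  rw [← sum_homogeneousComponent g, map_sum]
  refine Subalgebra.sum_mem _ fun N _ => ?_
  obtain _ | N := N
  · rw [homogeneousComponent_zero, ← constantCoeff_eq, hg, map_zero, map_zero]
    exact Subalgebra.zero_mem _
  · obtain ⟨G, hG, h⟩ := lin_decomp T.base.span_eq_top
      (homogeneousComponent_isHomogeneous (N + 1) g)
    rw [h, map_sum]
    refine Subalgebra.sum_mem _ fun c hc => ?_
    rw [S.erase _ _ _ hc]
    refine (hS.regular hL hX N).1 _ (T.base.1.mono (by simp)) ?_ _ (hG c)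
    rw [Finset.inter_univ]
    intro h
    exact notMem_span_erase T.base.1 hc (by
      change L c ∈ sp L (T.B.erase c)
      rw [h]; exact mem_sp (Finset.mem_univ _))

end IsTreeSystem

end Regularity

section Nonvanishing

variable {n : ℕ} {ι : Type} [Fintype ι] [DecidableEq ι] {L : ι → Fin n → ℂ}

namespace BasisTree

variable (T : BasisTree L)

lemma eq_of_mem_sub {b c : ι} (hb : b ∈ T.B) (hc : c ∈ T.B) (h1 : b ∈ T.sub c) (h2 : c ∈ T.sub b) :
    b = c := by
  by_contra hne
  obtain ⟨h3, h4⟩ := T.par_of_mem c hc b h1 hne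
  exact (T.par_mem b hb h3).2.1 (T.sub_trans b hb c h2 h4)

/-- The orderings of the basis compatible with the tree. -/
def IsExt (τ : Fin n → ι) : Prop := ∀ k l, τ k ∈ T.sub (τ l) → k ≤ l

lemma exists_isExt : ∃ π : Equiv.Perm (Fin n), T.IsExt fun k => T.enum (π k) := by
  refine ⟨Tuple.sort fun k => (T.sub (T.enum k)).card, fun k l h => ?_⟩
  have hmono := Tuple.monotone_sort fun k => (T.sub (T.enum k)).card
  by_contra! hlt
  have h1 := hmono hlt.le
  simp only [Function.comp_apply] at h1
  set σ := Tuple.sort fun k => (T.sub (T.enum k)).card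
  have hk := (T.enum (σ k)).2
  have hl := (T.enum (σ l)).2
  have h2 := Finset.eq_of_subset_of_card_le (T.sub_trans _ hl _ h) h1
  have h3 := T.eq_of_mem_sub hk hl h (by rw [h2]; exact T.mem_sub _ hl)
  exact hlt.ne' (σ.injective (T.enum.injective (Subtype.ext h3)))

variable {T}

lemma det_enum_ne_zero : (tmat L fun k => T.enum k).det ≠ 0 :=
  det_ne_zero_iff.mpr (LinearIndependent.comp T.base.1 T.enum T.enum.injective)

lemma det_layerMat_of_isExt (hL : ∀ i, L i ≠ 0) {π : Equiv.Perm (Fin n)}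
    (hext : T.IsExt fun k => T.enum (π k)) :
    (layerMat L T.theta fun k => T.enum (π k)).det = Equiv.Perm.sign π := by
  classical
  set τ : Fin n → ι := fun k => T.enum (π k)
  have hτB : ∀ k, τ k ∈ T.B := fun k => (T.enum (π k)).2
  have hτinj : Function.Injective τ := fun k l h =>
    π.injective (T.enum.injective (Subtype.ext h))
  have hτ : (tmat L τ).det ≠ 0 :=
    det_ne_zero_iff.mpr (LinearIndependent.comp T.base.1 (T.enum ∘ π)
      (T.enum.injective.comp π.injective))
  have hpos : ∀ b ∈ T.B, ∃ k, τ k = b := fun b hb => ⟨π.symm (T.enum.symm ⟨b, hb⟩), by simp [τ]⟩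
  have hrow : ∀ k, (layerMat L T.theta τ (π k) = Pi.single k 1) ∨ ∃ k', k < k' ∧
      layerMat L T.theta τ (π k) = Pi.single k 1 - Pi.single k' 1 := by
    intro k
    by_cases hρ : τ k = T.ρ
    · left
      ext l
      have h1 : ∀ i, T.theta (π k) i = if i = τ k then 1 else 0 := by
        intro i
        simp only [theta]
        rw [if_neg (not_and_of_not_left _ (not_not.mpr hρ)), sub_zero]
      simp only [layerMat, Matrix.of_apply, h1, Finset.sum_ite_eq', Finset.mem_filter,
        Finset.mem_univ, true_and, Pi.single_apply]
      exact if_congr ⟨fun h => h.unique (layer_self hτ k), fun h => h ▸ layer_self hτ k⟩ rfl rfl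
    · right
      obtain ⟨k', hk'⟩ := exists_layer hτ (hL (T.j (τ k)))
      refine ⟨k', ?_, layerMat_row (layer_self hτ k) hρ hk'⟩
      obtain ⟨p1, p2, p3⟩ := T.par_mem _ (hτB k) hρ
      obtain ⟨l, hl⟩ := hpos _ p1
      have hkl : k < l := by
        refine lt_of_le_of_ne (hext k l (by rw [hl]; exact p3)) ?_
        rintro rfl
        rw [← hl] at p2
        exact p2 (T.mem_sub _ (hτB k))
      refine hkl.trans_le ?_
      by_contra! hlt
      refine (T.link _ (hτB k) hρ).2.1 ?_
      have h1 := (mem_span_image_iff hτ (T.j (τ k)) {l}ᶜ).mpr (by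
        intro l' hl'
        simp only [Set.mem_compl_iff, Set.mem_singleton_iff, not_not] at hl'
        rw [hl']
        exact hk'.2 l hlt)
      rw [← hl]
      refine Submodule.span_mono ?_ h1
      rintro _ ⟨k1, hk1, rfl⟩
      refine ⟨τ k1, ?_, rfl⟩
      simp only [Finset.coe_erase, Set.mem_sdiff, Finset.mem_coe, Set.mem_singleton_iff]
      exact ⟨hτB k1, fun h => hk1 (hτinj h)⟩
  have hdet : ((layerMat L T.theta τ).submatrix π id).det = 1 := by
    rw [Matrix.det_of_isUpperTriangular]
    · refine Finset.prod_eq_one fun k _ => ?_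
      rw [Matrix.submatrix_apply]
      rcases hrow k with h | ⟨k', hk', h⟩
      · simp [h]
      · simp [h, hk'.ne]
    · intro k l hlk
      simp only [id_eq] at hlk
      rw [Matrix.submatrix_apply]
      rcases hrow k with h | ⟨k', hk', h⟩
      · simp [h, hlk.ne]
      · simp [h, hlk.ne, (hlk.trans hk').ne]
  rw [Matrix.det_permute] at hdet
  have hsq : ((Equiv.Perm.sign π : ℤ) : ℂ) * ((Equiv.Perm.sign π : ℤ) : ℂ) = 1 := by
    rw [← Int.cast_mul, Int.units_coe_mul_self, Int.cast_one]
  calc _ = ((Equiv.Perm.sign π : ℤ) : ℂ) * (((Equiv.Perm.sign π : ℤ) : ℂ) *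
        (layerMat L T.theta τ).det) := by rw [← mul_assoc, hsq, one_mul]
    _ = _ := by rw [hdet, mul_one]

lemma det_layerMat_of_not_isExt (hL : ∀ i, L i ≠ 0) {τ : Fin n → ι} (hτB : ∀ k, τ k ∈ T.B)
    (hτ : (tmat L τ).det ≠ 0) (hext : ¬ T.IsExt τ) : (layerMat L T.theta τ).det = 0 := by
  have hinj : Function.Injective τ := fun k l h =>
    (det_ne_zero_iff.mp hτ).injective (congrArg L h)
  simp only [IsExt, not_forall, not_le] at hext
  obtain ⟨k, l, h, hlt⟩ := hext
  set K := (Finset.univ.filter fun k' : Fin n => k'.val < l.val + 1).image τ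
  refine T.det_layerMat_eq_zero hL hτ (q := l.val + 1) (K := K) (c := τ l) ?_ ?_ ?_ ?_
  · intro b hb
    obtain ⟨k', -, rfl⟩ := Finset.mem_image.mp hb
    exact hτB k'
  · rw [prefSpan, sp]
    congr 1
    ext w
    simp [K]
  · exact Finset.mem_image.mpr ⟨l, by simp, rfl⟩
  · intro hsub
    obtain ⟨k', hk', he⟩ := Finset.mem_image.mp (hsub h)
    rw [hinj he] at hk'
    have := (Finset.mem_filter.mp hk').2
    rw [Fin.lt_def] at hlt
    omega

lemma sum_ne_zero (hL : ∀ i, L i ≠ 0) (m : ι → ℕ) (hm : ∀ i, 0 < m i) :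
    ∑ c, resVal L c T.B * wt L T.theta c m ≠ 0 := by
  classical
  rw [sum_resVal_wt]
  set β : ℂ := (tmat L fun k => T.enum k).det⁻¹
  have hterm : ∀ τ ∈ Fintype.piFinset fun _ : Fin n => T.B,
      (tmat L τ).det⁻¹ * (layerMat L T.theta τ).det * ∏ k, (ssum (cl L τ k) m)⁻¹ =
      β * ((if (tmat L τ).det ≠ 0 ∧ T.IsExt τ then
        ∏ k, (∑ i ∈ cl L τ k, (m i : ℝ))⁻¹ else 0 : ℝ) : ℂ) := by
    intro τ hτB
    rw [Fintype.mem_piFinset] at hτB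
    by_cases hτ : (tmat L τ).det = 0
    · simp [hτ]
    by_cases hext : T.IsExt τ
    · have hinj : Function.Injective τ := fun k l h =>
        (det_ne_zero_iff.mp hτ).injective (congrArg L h)
      let π : Equiv.Perm (Fin n) := Equiv.ofBijective (fun k => T.enum.symm ⟨τ k, hτB k⟩)
        (Finite.injective_iff_bijective.mp fun k l h => hinj (by simpa using h))
      have hπ : τ = fun k => (T.enum (π k) : ι) := by
        ext k
        simp [π]
      rw [if_pos ⟨hτ, hext⟩]
      have h1 : (layerMat L T.theta τ).det = Equiv.Perm.sign π := by
        rw [hπ]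
        exact det_layerMat_of_isExt hL (by rwa [hπ] at hext)
      have h2 : (tmat L τ).det = Equiv.Perm.sign π * (tmat L fun k => T.enum k).det := by
        rw [← tmat_comp_perm, hπ]
        rfl
      have hs : ((Equiv.Perm.sign π : ℤ) : ℂ) ≠ 0 := by
        exact_mod_cast (Units.ne_zero _)
      rw [h1, h2, mul_inv]
      simp only [ssum]
      push_cast
      linear_combination β * (∏ k, (∑ i ∈ cl L τ k, (m i : ℂ))⁻¹) * mul_inv_cancel₀ hs
    · rw [det_layerMat_of_not_isExt hL hτB hτ hext, if_neg (fun h => hext h.2)]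
      simp
  rw [Finset.sum_congr rfl hterm, ← Finset.mul_sum]
  refine mul_ne_zero (inv_ne_zero det_enum_ne_zero) ?_
  rw [← Complex.ofReal_sum, Complex.ofReal_ne_zero]
  have hpos : ∀ τ : Fin n → ι, (tmat L τ).det ≠ 0 →
      0 < ∏ k, (∑ i ∈ cl L τ k, (m i : ℝ))⁻¹ := fun τ hτ =>
    Finset.prod_pos fun k _ => inv_pos.mpr (Finset.sum_pos (fun i _ => by exact_mod_cast hm i)
      ⟨τ k, (self_mem_cl hτ).mpr le_rfl⟩)
  obtain ⟨π, hπ⟩ := T.exists_isExt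
  have hdet : (tmat L fun k => T.enum (π k)).det ≠ 0 :=
    det_ne_zero_iff.mpr (LinearIndependent.comp T.base.1 (T.enum ∘ π)
      (T.enum.injective.comp π.injective))
  refine ne_of_gt (Finset.sum_pos' (fun τ _ => ?_) ⟨fun k => T.enum (π k), ?_, ?_⟩)
  · split_ifs with h
    · exact (hpos τ h.1).le
    · exact le_rfl
  · exact Fintype.mem_piFinset.mpr fun k => (T.enum (π k)).2
  · rw [if_pos ⟨hdet, hπ⟩]
    exact hpos _ hdet

end BasisTree

end Nonvanishing

section Polynomiality

variable {n : ℕ} {ι : Type} [Fintype ι] [DecidableEq ι] {L : ι → Fin n → ℂ}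

open Classical in
variable (L) in
/-- The nonempty flats. -/
def flats : Finset (Finset ι) :=
  Finset.univ.filter fun X => X.Nonempty ∧ ∀ i, L i ∈ sp L X → i ∈ X

variable (L) in
/-- The algebra of functions with denominators given by the flats. -/
abbrev flatAlg : Subalgebra ℂ ((ι → ℕ) → ℂ) :=
  fracAlg (Submonoid.powers (∏ X ∈ flats L, spol X))

lemma mem_flats {X : Finset ι} : X ∈ flats L ↔ X.Nonempty ∧ ∀ i, L i ∈ sp L X → i ∈ X := by
  simp [flats]

lemma inv_ssum_mem_flatAlg {X : Finset ι} (hX : X ∈ flats L) :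
    (fun m => (ssum X m)⁻¹) ∈ flatAlg L := by
  refine mem_fracAlg_of_mul (Submonoid.mem_powers _) (mem_fracAlg_congr (fun m hm => ?_)
    (pev_mem_fracAlg _ (∏ Y ∈ (flats L).erase X, spol Y)))
  rw [← Finset.mul_prod_erase _ _ hX, map_mul, Pi.mul_apply, Pi.mul_apply, pev_spol,
    mul_right_comm, mul_inv_cancel₀ (ssum_ne_zero (mem_flats.mp hX).1 hm), one_mul]

lemma wt_mem_flatAlg (θ : Fin n → ι → ℂ) (c : Fin n → ι) : wt L θ c ∈ flatAlg L := by
  by_cases hc : (tmat L c).det = 0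
  · rw [wt_eq_zero hc]
    exact Subalgebra.zero_mem _
  · have h1 : (∏ k, fun m => (ssum (cl L c k) m)⁻¹) ∈ flatAlg L :=
      Subalgebra.prod_mem _ fun k _ => inv_ssum_mem_flatAlg
        (mem_flats.mpr ⟨⟨c k, (self_mem_cl hc).mpr le_rfl⟩, fun i hi => flat_cl hc k hi⟩)
    have h2 := const_mul_mem ((Matrix.of fun a k => θ a (c k)).det * (tmat L c).det⁻¹) h1
    convert h2 using 1
    ext m
    simp [wt, Finset.prod_apply]

variable {T : BasisTree L} {S : PeriodSystem L ((ι → ℕ) → ℂ)}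

namespace IsTreeSystem

lemma mem_flatAlg (hS : IsTreeSystem T S) (g : MvPolynomial (Fin n) ℂ) : S.q T.B g ∈ flatAlg L := by
  refine S.mem_of_bases (Subalgebra.toSubmodule (flatAlg L)) (fun i φ h => ?_) (fun C hC => ?_)
    T.base.1 g
  · have : S.s i φ = fun m => pev (MvPolynomial.X i) m * φ m := by
      ext m
      simp [hS.s_apply, pev_apply]
    rw [this]
    exact fun_mul_mem (pev_mem_fracAlg _ _) h
  · rw [hS.q_eq hC]
    refine fun_mul_mem ?_ (fun_sum_mem fun c _ => const_mul_mem _ (wt_mem_flatAlg _ _))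
    have : T.norm = pev (∏ b ∈ T.B.erase T.ρ, spol (flat L (T.sub b))) := by
      ext m
      simp [BasisTree.norm, map_prod, pev_spol]
    rw [this]
    exact pev_mem_fracAlg _ _

/-- Periods of forms with positive degree numerator are polynomial in the exponents. -/
lemma exists_pev (hS : IsTreeSystem T S) (hL : ∀ i, L i ≠ 0) {g : MvPolynomial (Fin n) ℂ}
    (hg : constantCoeff g = 0) :
    ∃ P, ∀ m : ι → ℕ, (∀ i, 0 < m i) → S.q T.B g m = pev P m := by
  refine exists_pev_of_regular (fun X hX => (mem_flats.mp hX).1) (hS.mem_flatAlg g) fun X hX => ?_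
  by_cases hne : X = Finset.univ
  · subst hne
    exact hS.base_mem_univ hL _ hg
  · exact hS.base_mem hL _ (mem_flats.mp hX).2 hne g

lemma exists_pev_one (hS : IsTreeSystem T S) (hL : ∀ i, L i ≠ 0) :
    ∃ P, ∀ m : ι → ℕ, (∀ i, 0 < m i) → ssum Finset.univ m * S.q T.B 1 m = pev P m := by
  have key := exists_pev_of_regular (A := flats L) (fun X hX => (mem_flats.mp hX).1)
    (φ := fun m => ssum Finset.univ m * S.q T.B 1 m) ?_ fun X hX => ?_
  · exact key
  · exact fun_mul_mem (by rw [← pev_spol]; exact pev_mem_fracAlg _ _) (hS.mem_flatAlg 1)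
  · by_cases hne : X = Finset.univ
    · subst hne
      have hsum : (fun m => ∑ t, resVal L t T.B * (ssum Finset.univ m * wt L T.theta t m)) ∈
          regAlg Finset.univ (mem_flats.mp hX).1 := by
        refine fun_sum_mem fun t _ => const_mul_mem _ ?_
        by_cases ht : (tmat L t).det = 0
        · simp only [wt_eq_zero ht, Pi.zero_apply, mul_zero]
          exact Subalgebra.zero_mem _
        · by_cases hp : ∃ p, cl L t p = Finset.univ
          · obtain ⟨p, hp⟩ := hp
            exact ssum_mul_wt_mem ht hp
          · push Not at hp
            exact fun_mul_mem (ssum_mem_regAlg _) (wt_mem_regAlg hp)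
      convert fun_mul_mem T.norm_mem hsum using 1
      ext m
      rw [hS.q_apply _ T.base, Finset.mul_sum, Finset.mul_sum, Finset.mul_sum]
      refine Finset.sum_congr rfl fun t _ => ?_
      ring
    · exact fun_mul_mem (ssum_mem_regAlg _) (hS.base_mem hL _ (mem_flats.mp hX).2 hne 1)

lemma scale (hS : IsTreeSystem T S) (m : ι → ℕ) {t : ℕ} (ht : 0 < t) :
    ssum Finset.univ (t • m) * S.q T.B 1 (t • m) = ssum Finset.univ m * S.q T.B 1 m := by
  have ht' : (t : ℂ) ≠ 0 := by exact_mod_cast ht.ne'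
  have h1 : ∀ X : Finset ι, ssum X (t • m) = t * ssum X m := by
    intro X
    simp [ssum, Finset.mul_sum]
  have hn : (T.B.erase T.ρ).card + 1 = n := by
    rw [Finset.card_erase_add_one T.root_mem, T.base.2]
  have h2 : T.norm (t • m) = (t : ℂ) ^ (T.B.erase T.ρ).card * T.norm m := by
    simp only [BasisTree.norm, h1, Finset.prod_mul_distrib, Finset.prod_const]
  have h3 : ∀ c, wt L T.theta c (t • m) = ((t : ℂ) ^ n)⁻¹ * wt L T.theta c m := by
    intro c
    simp only [wt, h1, mul_inv, Finset.prod_mul_distrib, Finset.prod_const, Finset.card_univ,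
      Fintype.card_fin, inv_pow]
    ring
  rw [hS.q_apply _ T.base, hS.q_apply _ T.base, h1, h2]
  simp only [h3]
  have h4 : ∑ c, resVal L c T.B * (((t : ℂ) ^ n)⁻¹ * wt L T.theta c m) =
      ((t : ℂ) ^ n)⁻¹ * ∑ c, resVal L c T.B * wt L T.theta c m := by
    rw [Finset.mul_sum]
    exact Finset.sum_congr rfl fun c _ => by ring
  rw [h4]
  have h5 : (t : ℂ) * (t : ℂ) ^ (T.B.erase T.ρ).card * ((t : ℂ) ^ n)⁻¹ = 1 := by
    rw [← pow_succ', hn, mul_inv_cancel₀ (pow_ne_zero _ ht')]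
  linear_combination ssum Finset.univ m * T.norm m *
    (∑ c, resVal L c T.B * wt L T.theta c m) * h5

/-- The basic period is a nonzero constant divided by the sum of the exponents. -/
theorem exists_const (hS : IsTreeSystem T S) (hL : ∀ i, L i ≠ 0) : ∃ a : ℂ, a ≠ 0 ∧
    ∀ m : ι → ℕ, (∀ i, 0 < m i) → ssum Finset.univ m * S.q T.B 1 m = a := by
  obtain ⟨P, hP⟩ := hS.exists_pev_one hL
  have hconst : ∀ m : ι → ℕ, (∀ i, 0 < m i) → pev P m = constantCoeff P := by
    intro m hm
    let Q : Polynomial ℂ := aeval (fun i => Polynomial.C (m i : ℂ) * Polynomial.X) P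
    have hQ : ∀ t : ℂ, Q.eval t = eval (fun i => (m i : ℂ) * t) P := by
      intro t
      have : ((Polynomial.aeval t).comp (aeval fun i => Polynomial.C (m i : ℂ) * Polynomial.X) :
          MvPolynomial ι ℂ →ₐ[ℂ] ℂ) = aeval fun i => (m i : ℂ) * t := by
        ext i
        simp
      have h := congrArg (fun F : MvPolynomial ι ℂ →ₐ[ℂ] ℂ => F P) this
      rw [aeval_eq_eval] at h
      exact (Polynomial.coe_aeval_eq_eval t).symm ▸ h
    have hQ1 : Q = Polynomial.C (pev P m) := by
      refine Polynomial.eq_of_infinite_eval_eq _ _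
        (((Set.Ioi_infinite 0).image (Nat.cast_injective (R := ℂ)).injOn).mono ?_)
      rintro _ ⟨t, ht, rfl⟩
      rw [Set.mem_Ioi] at ht
      have h1 := hP (t • m) fun i => by simpa using ⟨ht, hm i⟩
      rw [hS.scale m ht, hP m hm] at h1
      simp only [Set.mem_ofPred_eq, Polynomial.eval_C, hQ, h1, pev_apply]
      congr 2
      ext i
      simp [mul_comm]
    have h2 := hQ 0
    rw [hQ1, Polynomial.eval_C] at h2
    rw [h2]
    simp [← Pi.zero_def, constantCoeff_eq]
  refine ⟨constantCoeff P, ?_, fun m hm => by rw [hP m hm, hconst m hm]⟩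
  have h1 : ∀ i : ι, 0 < (1 : ι → ℕ) i := fun _ => one_pos
  rw [← hconst 1 h1, ← hP 1 h1, hS.q_apply _ T.base]
  refine mul_ne_zero (ssum_ne_zero ⟨T.ρ, Finset.mem_univ _⟩ h1) (mul_ne_zero ?_ ?_)
  · rw [BasisTree.norm, Finset.prod_ne_zero_iff]
    intro b hb
    exact ssum_ne_zero ⟨b, mem_flat.mpr (mem_sp (T.mem_sub b (Finset.mem_of_mem_erase hb)))⟩ h1
  · exact BasisTree.sum_ne_zero hL 1 h1

end IsTreeSystem

end Polynomiality

section Specialization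

variable {n r : ℕ} {L : Fin r → Fin n → ℂ}
  {Rf : Type} [CommRing Rf] [Algebra ℂ Rf] [Algebra (MvPolynomial (Fin n) ℂ) Rf]
  [IsScalarTower ℂ (MvPolynomial (Fin n) ℂ) Rf] {f : MvPolynomial (Fin n) ℂ}
  {D : Fin n → Derivation ℂ Rf Rf} {pinv : Fin r → Rf} {d : Fin r → ℕ}

/-- Twisted periods whose values on the basic forms are governed by a tree. -/
lemma exists_treeSystem [IsLocalization.Away f Rf] (hL : ∀ i, L i ≠ 0)
    (hf : f = ∏ i, lin (L i) ^ d i)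
    (hD : ∀ k (a : MvPolynomial (Fin n) ℂ), D k (algebraMap _ Rf a) = algebraMap _ Rf (pderiv k a))
    (hp : ∀ i, algebraMap (MvPolynomial (Fin n) ℂ) Rf (lin (L i)) * pinv i = 1)
    (T : BasisTree L) :
    ∃ (h : Fin n → ℂ) (J : (Fin r → ℕ) → Rf →ₗ[ℂ] ℂ)
      (S : PeriodSystem L ((Fin r → ℕ) → ℂ)), IsTreeSystem T S ∧
      (∀ m w, J m (twistMap D h w) = 0) ∧
      ∀ C g m, S.q C g m = J m (uinv pinv m * (algebraMap _ Rf g * ∏ i ∈ C, pinv i)) := by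
  obtain ⟨h, hgen⟩ := exists_generic L
  choose J hJ0 hJ1 using fun m => exists_period hL hf hD hp hgen m
    (fun c => T.norm m * wt L T.theta c m) (fun c hc => by rw [wt_eq_zero hc]; simp)
  let S : PeriodSystem L ((Fin r → ℕ) → ℂ) :=
    { s := fun i => LinearMap.mulLeft ℂ fun m : Fin r → ℕ => (m i : ℂ)
      h := h
      q := fun C => LinearMap.pi fun m => J m ∘ₗ
        (LinearMap.mulLeft ℂ (uinv pinv m) ∘ₗ LinearMap.mulRight ℂ (∏ i ∈ C, pinv i)) ∘ₗ
          (IsScalarTower.toAlgHom ℂ (MvPolynomial (Fin n) ℂ) Rf).toLinearMap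
      gen := hgen
      rel := by
        intro C v g hv
        ext m
        have key := twist_dirDer (D := D) h v
          (uinv pinv m * (algebraMap _ Rf g * ∏ i ∈ C, pinv i))
        rw [dirDer_period hD hp hv] at key
        have h2 := hJ0 m (fun k => v k • (uinv pinv m * (algebraMap _ Rf g * ∏ i ∈ C, pinv i)))
        rw [key, map_sub, sub_eq_zero, map_sub, map_sum] at h2
        simp only [map_smul] at h2
        simp only [Pi.smul_apply, Pi.sub_apply, Finset.sum_apply]
        exact h2.symm
      erase := by
        intro C c g hc
        ext m
        simp only [LinearMap.pi_apply, LinearMap.comp_apply, LinearMap.mulLeft_apply,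
          LinearMap.mulRight_apply, AlgHom.toLinearMap_apply, IsScalarTower.coe_toAlgHom', map_mul]
        rw [← Finset.mul_prod_erase C pinv hc]
        congr 2
        linear_combination (algebraMap (MvPolynomial (Fin n) ℂ) Rf g) *
          (∏ i ∈ C.erase c, pinv i) * hp c }
  refine ⟨h, J, S, ⟨fun i φ m => rfl, fun C hC m => ?_⟩, hJ0, fun C g m => rfl⟩
  have h1 : S.q C 1 m = J m (uinv pinv m * (algebraMap (MvPolynomial (Fin n) ℂ) Rf 1 *
      ∏ i ∈ C, pinv i)) := rfl
  rw [h1, map_one, one_mul, hJ1 m C hC, Finset.mul_sum]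
  exact Finset.sum_congr rfl fun c _ => by ring

variable {h : Fin n → ℂ}

lemma apply_deriv {J : Rf →ₗ[ℂ] ℂ} (hJ : ∀ w, J (twistMap D h w) = 0) (k : Fin n) (x : Rf) :
    J (D k x) = h k * J x := by
  have h1 := hJ (Pi.single k x)
  rw [twistMap_apply, Finset.sum_eq_single k, Pi.single_eq_same, map_sub, map_smul, sub_eq_zero]
    at h1
  · exact h1
  · intro l _ hl
    simp [hl]
  · simp

/-- The exponents representing `f ^ (-k)` relative to the basis `B`. -/
def expo (d : Fin r → ℕ) (B : Finset (Fin r)) (k : ℕ) : Fin r → ℕ :=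
  fun i => k * d i - if i ∈ B then 1 else 0

variable {B : Finset (Fin r)} {k : ℕ}

lemma expo_add (hd : ∀ i, 1 ≤ d i) (hk : 2 ≤ k) (i : Fin r) :
    expo d B k i + (if i ∈ B then 1 else 0) = k * d i := by
  have := Nat.mul_le_mul hk (hd i)
  simp only [expo]
  split_ifs <;> omega

lemma expo_pos (hd : ∀ i, 1 ≤ d i) (hk : 2 ≤ k) (i : Fin r) : 0 < expo d B k i := by
  have := Nat.mul_le_mul hk (hd i)
  simp only [expo]
  split_ifs <;> omega

lemma expo_cast (hd : ∀ i, 1 ≤ d i) (hk : 2 ≤ k) (i : Fin r) :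
    (expo d B k i : ℂ) = k * d i - if i ∈ B then 1 else 0 := by
  rw [eq_sub_iff_add_eq]
  exact_mod_cast congrArg (Nat.cast (R := ℂ)) (expo_add (B := B) hd hk i)

lemma ssum_expo (hd : ∀ i, 1 ≤ d i) (hk : 2 ≤ k) :
    ssum Finset.univ (expo d B k) = k * ((∑ i, d i : ℕ) : ℂ) - B.card := by
  simp only [ssum, expo_cast hd hk, Finset.sum_sub_distrib, ← Finset.mul_sum]
  simp

lemma uinv_expo {finv : Rf} (hfinv : finv = ∏ i, pinv i ^ d i) (hd : ∀ i, 1 ≤ d i) (hk : 2 ≤ k) :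
    uinv pinv (expo d B k) * ∏ i ∈ B, pinv i = finv ^ k := by
  have h1 : ∏ i ∈ B, pinv i = ∏ i, pinv i ^ (if i ∈ B then 1 else 0) := by
    simp [Finset.prod_ite_mem]
  rw [uinv, h1, ← Finset.prod_mul_distrib, hfinv, ← Finset.prod_pow]
  refine Finset.prod_congr rfl fun i _ => ?_
  rw [← pow_add, expo_add hd hk, ← pow_mul, mul_comm]

/-- The operator `∇_k` at `s = -k` is the derivation of the localization, up to `f ^ (-k)`. -/
lemma eval_nabla {δ : Derivation ℂ Rf Rf} {φ finv : Rf} (hfinv : φ * finv = 1)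
    (w : Polynomial Rf) (k : ℕ) :
    (w.sum (fun j a => Polynomial.C (δ a) * Polynomial.X ^ j) +
      Polynomial.C (δ φ * finv) * (Polynomial.X * w)).eval (-(k : Rf)) * finv ^ k =
    δ (w.eval (-(k : Rf)) * finv ^ k) := by
  have hk : δ (-(k : Rf)) = 0 := by simp
  have h1 : δ (w.eval (-(k : Rf))) =
      (w.sum fun j a => Polynomial.C (δ a) * Polynomial.X ^ j).eval (-(k : Rf)) := by
    rw [Polynomial.eval_eq_sum, Polynomial.sum, Polynomial.sum, map_sum, Polynomial.eval_finsetSum]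
    refine Finset.sum_congr rfl fun j _ => ?_
    rw [Derivation.leibniz, Derivation.leibniz_pow, hk, smul_zero]
    rw [smul_zero, smul_zero, zero_add, Polynomial.eval_mul, Polynomial.eval_C,
      Polynomial.eval_pow, Polynomial.eval_X, smul_eq_mul, mul_comm]
  have h2 : δ finv = -(δ φ * finv) * finv := by
    have h3 := congrArg δ hfinv
    rw [Derivation.leibniz, Derivation.map_one_eq_zero, smul_eq_mul, smul_eq_mul] at h3
    linear_combination finv * h3 - δ finv * hfinv
  have h3 : δ (finv ^ k) = -(k : Rf) * (δ φ * finv) * finv ^ k := by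
    rw [Derivation.leibniz_pow, h2]
    cases k with
    | zero => simp
    | succ k =>
      simp only [Nat.add_sub_cancel, nsmul_eq_mul, smul_eq_mul]
      ring
  rw [Derivation.leibniz, h1, h3]
  simp only [Polynomial.eval_add, Polynomial.eval_mul, Polynomial.eval_C, Polynomial.eval_X,
    smul_eq_mul]
  ring

/-- Elements of `Rf[s]` whose specializations have periods depending polynomially on `s`. -/
def Good (I : ℕ → Rf →ₗ[ℂ] ℂ) (finv : Rf) (w : Polynomial Rf) : Prop :=
  ∀ g : MvPolynomial (Fin n) ℂ, ∃ G : Polynomial ℂ, ∀ k : ℕ, 2 ≤ k →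
    I k (algebraMap _ Rf g * w.eval (-(k : Rf)) * finv ^ k) = G.eval (k : ℂ)

section Good

variable {I : ℕ → Rf →ₗ[ℂ] ℂ} {finv : Rf}

lemma good_zero : Good (n := n) I finv 0 := fun g => ⟨0, fun k _ => by simp⟩

lemma Good.add {w w' : Polynomial Rf} (hw : Good (n := n) I finv w)
    (hw' : Good (n := n) I finv w') : Good (n := n) I finv (w + w') := by
  intro g
  obtain ⟨G, hG⟩ := hw g
  obtain ⟨G', hG'⟩ := hw' g
  refine ⟨G + G', fun k hk => ?_⟩
  rw [Polynomial.eval_add (p := G), ← hG k hk, ← hG' k hk, ← map_add, Polynomial.eval_add]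
  congr 1
  ring

lemma Good.C_mul {w : Polynomial Rf} (hw : Good (n := n) I finv w) (a : MvPolynomial (Fin n) ℂ) :
    Good (n := n) I finv (Polynomial.C (algebraMap _ Rf a) * w) := by
  intro g
  obtain ⟨G, hG⟩ := hw (g * a)
  refine ⟨G, fun k hk => ?_⟩
  rw [← hG k hk, Polynomial.eval_mul, Polynomial.eval_C, map_mul (algebraMap _ Rf),
    mul_assoc _ _ (w.eval _)]

lemma Good.X_mul {w : Polynomial Rf} (hw : Good (n := n) I finv w) :
    Good (n := n) I finv (Polynomial.X * w) := by
  intro g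
  obtain ⟨G, hG⟩ := hw g
  refine ⟨-(Polynomial.X * G), fun k hk => ?_⟩
  have h1 : algebraMap _ Rf g * (Polynomial.X * w).eval (-(k : Rf)) * finv ^ k =
      (-(k : ℂ)) • (algebraMap _ Rf g * w.eval (-(k : Rf)) * finv ^ k) := by
    rw [Algebra.smul_def, Polynomial.eval_mul, Polynomial.eval_X, map_neg, map_natCast]
    ring
  rw [h1, map_smul, hG k hk]
  simp

lemma Good.nabla (hI : ∀ k w, I k (twistMap D h w) = 0)
    (hD : ∀ k (a : MvPolynomial (Fin n) ℂ), D k (algebraMap _ Rf a) = algebraMap _ Rf (pderiv k a))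
    {φ : Rf} (hfinv : φ * finv = 1)
    {w : Polynomial Rf} (hw : Good (n := n) I finv w) (j : Fin n) :
    Good (n := n) I finv (w.sum (fun i a => Polynomial.C (D j a) * Polynomial.X ^ i) +
      Polynomial.C (D j φ * finv) * (Polynomial.X * w)) := by
  intro g
  obtain ⟨G, hG⟩ := hw g
  obtain ⟨G', hG'⟩ := hw (pderiv j g)
  refine ⟨Polynomial.C (h j) * G - G', fun k hk => ?_⟩
  rw [mul_assoc, eval_nabla hfinv, Polynomial.eval_sub, Polynomial.eval_mul, Polynomial.eval_C,
    ← hG k hk, ← hG' k hk, ← apply_deriv (hI k), ← map_sub, ← hD]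
  congr 1
  rw [mul_assoc, Derivation.leibniz (D j) (algebraMap _ Rf g)]
  simp only [smul_eq_mul]
  ring

end Good

lemma good_C [IsLocalization.Away f Rf] {T : BasisTree L} {S : PeriodSystem L ((Fin r → ℕ) → ℂ)}
    (hS : IsTreeSystem T S) (hL : ∀ i, L i ≠ 0) {J : (Fin r → ℕ) → Rf →ₗ[ℂ] ℂ}
    (hq : ∀ C g m, S.q C g m = J m (uinv pinv m * (algebraMap _ Rf g * ∏ i ∈ C, pinv i)))
    {finv : Rf} (hfinv : finv = ∏ i, pinv i ^ d i) (hd : ∀ i, 1 ≤ d i)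
    (hf : constantCoeff f = 0) :
    Good (n := n) (fun k => J (expo d T.B k)) finv (Polynomial.C (algebraMap _ Rf f)) := by
  intro g
  obtain ⟨P, hP⟩ := hS.exists_pev hL (g := g * f) (by rw [map_mul, hf, mul_zero])
  refine ⟨aeval (fun i => Polynomial.C (d i : ℂ) * Polynomial.X -
    Polynomial.C (if i ∈ T.B then 1 else 0)) P, fun k hk => ?_⟩
  have h1 := hP (expo d T.B k) (expo_pos hd hk)
  rw [hq, pev_apply] at h1
  have h2 : ((Polynomial.aeval (k : ℂ)).comp (aeval fun i => Polynomial.C (d i : ℂ) * Polynomial.X -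
      Polynomial.C (if i ∈ T.B then 1 else 0)) : MvPolynomial (Fin r) ℂ →ₐ[ℂ] ℂ) =
      aeval fun i => (expo d T.B k i : ℂ) := by
    ext i
    rw [AlgHom.comp_apply, aeval_X, aeval_X, Polynomial.coe_aeval_eq_eval, expo_cast hd hk]
    simp only [Polynomial.eval_sub, Polynomial.eval_mul, Polynomial.eval_C, Polynomial.eval_X]
    rw [mul_comm]
  have h3 := congrArg (fun F : MvPolynomial (Fin r) ℂ →ₐ[ℂ] ℂ => F P) h2
  rw [aeval_eq_eval] at h3
  rw [← Polynomial.coe_aeval_eq_eval (k : ℂ)]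
  refine Eq.trans ?_ (h1.trans h3.symm)
  rw [Polynomial.eval_C, ← uinv_expo hfinv hd hk, map_mul (algebraMap _ Rf)]
  congr 1
  ring

/-- An element of the Bernstein–Sato ideal vanishes at `-n/d`. -/
theorem eval_eq_zero_of_good (hr : 0 < r) {T : BasisTree L}
    {S : PeriodSystem L ((Fin r → ℕ) → ℂ)}
    (hS : IsTreeSystem T S) (hL : ∀ i, L i ≠ 0) {J : (Fin r → ℕ) → Rf →ₗ[ℂ] ℂ}
    (hq : ∀ C g m, S.q C g m = J m (uinv pinv m * (algebraMap _ Rf g * ∏ i ∈ C, pinv i)))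
    {finv : Rf} (hfinv : finv = ∏ i, pinv i ^ d i) (hd : ∀ i, 1 ≤ d i) {b : Polynomial ℂ}
    (hb : Good (n := n) (fun k => J (expo d T.B k)) finv (b.map (algebraMap ℂ Rf))) :
    b.eval (-((n : ℂ) / ((∑ i, d i : ℕ) : ℂ))) = 0 := by
  obtain ⟨a, ha, hconst⟩ := hS.exists_const hL
  obtain ⟨G, hG⟩ := hb 1
  set N := ∑ i, d i
  have hN : (N : ℂ) ≠ 0 := by
    have h1 := Finset.single_le_sum (f := d) (fun i _ => Nat.zero_le _)
      (Finset.mem_univ (⟨0, hr⟩ : Fin r))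
    have h2 := hd ⟨0, hr⟩
    exact Nat.cast_ne_zero.mpr (by omega)
  have key : b.comp (-Polynomial.X) * Polynomial.C a =
      G * (Polynomial.C (N : ℂ) * Polynomial.X - Polynomial.C (n : ℂ)) := by
    refine Polynomial.eq_of_infinite_eval_eq _ _
      (((Set.Ici_infinite 2).image (Nat.cast_injective (R := ℂ)).injOn).mono ?_)
    rintro _ ⟨k, hk, rfl⟩
    rw [Set.mem_Ici] at hk
    have h1 := hG k hk
    have h2 := hconst (expo d T.B k) (expo_pos hd hk)
    rw [ssum_expo hd hk, T.base.2, hq, map_one, one_mul, uinv_expo hfinv hd hk] at h2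
    have h3 : algebraMap (MvPolynomial (Fin n) ℂ) Rf 1 *
        (b.map (algebraMap ℂ Rf)).eval (-(k : Rf)) * finv ^ k =
        b.eval (-(k : ℂ)) • finv ^ k := by
      have : (-(k : Rf)) = algebraMap ℂ Rf (-(k : ℂ)) := by simp
      rw [this, Polynomial.eval_map_algebraMap, Polynomial.aeval_algebraMap_apply, map_one,
        one_mul, Algebra.smul_def, Polynomial.coe_aeval_eq_eval]
    rw [h3, map_smul, smul_eq_mul] at h1
    simp only [Set.mem_ofPred_eq, Polynomial.eval_mul, Polynomial.eval_comp, Polynomial.eval_neg,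
      Polynomial.eval_X, Polynomial.eval_sub, Polynomial.eval_C]
    rw [← h1, ← h2]
    ring
  have h1 := congrArg (Polynomial.eval ((n : ℂ) / N)) key
  simp only [Polynomial.eval_mul, Polynomial.eval_comp, Polynomial.eval_neg,
    Polynomial.eval_X, Polynomial.eval_sub, Polynomial.eval_C, mul_div_cancel₀ _ hN] at h1
  rw [sub_self, mul_zero] at h1
  exact (mul_eq_zero.mp h1).resolve_right ha

end Specialization

section Forms

variable {n : ℕ}

/-- `lin` as a linear map. -/
def linMap (n : ℕ) : (Fin n → ℂ) →ₗ[ℂ] MvPolynomial (Fin n) ℂ where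
  toFun := lin
  map_add' := lin_add
  map_smul' a v := by rw [lin_smul, RingHom.id_apply, smul_eq_C_mul]

lemma linMap_apply (v : Fin n → ℂ) : linMap n v = lin v := rfl

lemma linMap_injective : Function.Injective (linMap n) := by
  intro v w hvw
  ext k
  rw [← coeff_lin k v, ← coeff_lin k w]
  exact congrArg (coeff (Finsupp.single k 1)) hvw

lemma constantCoeff_lin (v : Fin n → ℂ) : constantCoeff (lin v) = 0 := by
  simp [lin]

lemma eq_lin {p : MvPolynomial (Fin n) ℂ} (hp : p.IsHomogeneous 1) :
    p = lin fun k => p.coeff (Finsupp.single k 1) := by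
  ext e
  by_cases he : e.degree = 1
  · obtain ⟨k, rfl⟩ : e ∈ Set.range fun k : Fin n => Finsupp.single k 1 := by
      rw [Finsupp.range_single_one]
      exact he
    rw [coeff_lin]
  · have h1 : (lin fun k => p.coeff (Finsupp.single k 1)).IsHomogeneous 1 := by
      refine IsHomogeneous.sum _ _ _ fun k _ => ?_
      simpa using (isHomogeneous_C _ _).mul (isHomogeneous_X ℂ k)
    rw [hp.coeff_eq_zero he, h1.coeff_eq_zero he]

variable {ι : Type} [Fintype ι] [DecidableEq ι] {L : ι → Fin n → ℂ}

lemma map_sp (I : Finset ι) : (sp L I).map (linMap n) =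
    Submodule.span ℂ ((fun i => lin (L i)) '' (I : Set ι)) := by
  rw [sp, Submodule.map_span, ← Set.image_comp]
  rfl

lemma sp_univ_eq_top
    (h : ∀ k : Fin n, (X k : MvPolynomial (Fin n) ℂ) ∈
      Submodule.span ℂ (Set.range fun i => lin (L i))) :
    sp L Finset.univ = ⊤ := by
  rw [eq_top_iff, ← (Pi.basisFun ℂ (Fin n)).span_eq, Submodule.span_le]
  rintro _ ⟨k, rfl⟩
  have h1 := h k
  rw [← Set.image_univ, ← Finset.coe_univ, ← map_sp] at h1
  obtain ⟨v, hv, hvk⟩ := h1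
  rw [← lin_single, ← linMap_apply] at hvk
  rw [Pi.basisFun_apply, ← linMap_injective hvk]
  exact hv

lemma conn_univ
    (h : ∀ I : Set ι, I.Nonempty → Iᶜ.Nonempty →
      Submodule.span ℂ ((fun i => lin (L i)) '' I) ⊓
        Submodule.span ℂ ((fun i => lin (L i)) '' Iᶜ) ≠ ⊥) :
    Conn L Finset.univ := by
  intro I _ hI hI' hdis
  have h1 : ((Finset.univ \ I : Finset ι) : Set ι) = (I : Set ι)ᶜ := by
    ext i
    simp
  refine h I hI (by rw [← h1]; exact hI') ?_
  rw [← h1, ← map_sp, ← map_sp, ← Submodule.map_inf _ linMap_injective, hdis.eq_bot,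
    Submodule.map_bot]

end Forms

end NDConj

/-- **The n/d conjecture of Budur–Mustaţă–Teitler.**
Let `f = ∏ i, ℓ i ^ d i ∈ ℂ[x₁,…,x_n]` define a central, essential, indecomposable hyperplane
arrangement of degree `d = ∑ i, d i`.  The partial derivatives extend uniquely to derivations
`D k` of `R_f = Localization.Away f`; on the module `R_f[s]` (a model of `R_f[s]·f^s` via
`m ↔ m·f^s`) one has the operators `∇_k (m) = ∂m/∂x_k + s·(∂f/∂x_k)·f⁻¹·m` acting
coefficientwise in the first term.  Let `N_f` be the smallest `R[s]`-submodule of `R_f[s]`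
containing `f` and stable under all `∇_k` (so `N_f = 𝒟[s]·f^{s+1}`).  Then every `b ∈ ℂ[s]`
with `b·1 ∈ N_f` (i.e. every element of the Bernstein–Sato ideal of `f`) satisfies
`b(-n/d) = 0`; equivalently `-n/d` is a root of the Bernstein–Sato polynomial of `f`. -/
theorem nd_conjecture
    (n r : ℕ) (hn : 1 ≤ n)
    (ℓ : Fin r → MvPolynomial (Fin n) ℂ)
    (d : Fin r → ℕ)
    (f : MvPolynomial (Fin n) ℂ)
    -- the `ℓ i` are pairwise non-proportional nonzero homogeneous linear forms
    (hhom : ∀ i, (ℓ i).IsHomogeneous 1)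
    (hℓ : ∀ i, ℓ i ≠ 0)
    (hprop : ∀ i j, i ≠ j → ∀ c : ℂ, ℓ i ≠ c • ℓ j)
    (hd : ∀ i, 1 ≤ d i)
    (hf : f = ∏ i, ℓ i ^ d i)
    -- essential: the `ℓ i` span the space of linear forms on `ℂⁿ`
    (hess : ∀ k : Fin n, (X k : MvPolynomial (Fin n) ℂ) ∈ Submodule.span ℂ (Set.range ℓ))
    -- indecomposable
    (hindec : ∀ I : Set (Fin r), I.Nonempty → Iᶜ.Nonempty →
      Submodule.span ℂ (ℓ '' I) ⊓ Submodule.span ℂ (ℓ '' Iᶜ) ≠ ⊥)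
    -- the inverse of `f` in `R_f`
    (finv : Localization.Away f)
    (hfinv : algebraMap (MvPolynomial (Fin n) ℂ) (Localization.Away f) f * finv = 1)
    -- the partial derivatives, (uniquely) extended to derivations of `R_f`
    (D : Fin n → Localization.Away f → Localization.Away f)
    (hDadd : ∀ k x y, D k (x + y) = D k x + D k y)
    (hDleibniz : ∀ k x y, D k (x * y) = x * D k y + y * D k x)
    (hDext : ∀ k a, D k (algebraMap (MvPolynomial (Fin n) ℂ) (Localization.Away f) a) =
      algebraMap (MvPolynomial (Fin n) ℂ) (Localization.Away f) (pderiv k a))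
    -- the operators `∇_k` on `R_f[s] = R_f[s]·f^s`
    (nabla : Fin n → Polynomial (Localization.Away f) → Polynomial (Localization.Away f))
    (hnabla : ∀ k m, nabla k m =
      m.sum (fun j a => Polynomial.C (D k a) * Polynomial.X ^ j) +
        Polynomial.C (D k (algebraMap (MvPolynomial (Fin n) ℂ) (Localization.Away f) f) * finv) *
          (Polynomial.X * m))
    -- `N_f`: the smallest `R[s]`-submodule of `R_f[s]` containing `f` and stable under the `∇_k`
    (N : Set (Polynomial (Localization.Away f)))
    (hN : N = ⋂₀ {N' : Set (Polynomial (Localization.Away f)) |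
      Polynomial.C (algebraMap (MvPolynomial (Fin n) ℂ) (Localization.Away f) f) ∈ N' ∧
      (0 : Polynomial (Localization.Away f)) ∈ N' ∧
      (∀ x ∈ N', ∀ y ∈ N', x + y ∈ N') ∧
      (∀ a : MvPolynomial (Fin n) ℂ, ∀ x ∈ N',
        Polynomial.C (algebraMap (MvPolynomial (Fin n) ℂ) (Localization.Away f) a) * x ∈ N') ∧
      (∀ x ∈ N', Polynomial.X * x ∈ N') ∧
      (∀ k, ∀ x ∈ N', nabla k x ∈ N')})
    -- any `b ∈ ℂ[s]` in the Bernstein–Sato ideal, i.e. with `b·1 ∈ N_f`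
    (b : Polynomial ℂ)
    (hb : Polynomial.map
        ((algebraMap (MvPolynomial (Fin n) ℂ) (Localization.Away f)).comp
          (MvPolynomial.C : ℂ →+* MvPolynomial (Fin n) ℂ)) b ∈ N) :
    Polynomial.eval (-((n : ℂ) / ((∑ i, d i : ℕ) : ℂ))) b = 0 := by
  classical
  have hr : 0 < r := by
    rw [Nat.pos_iff_ne_zero]
    rintro rfl
    have h1 := hess ⟨0, hn⟩
    rw [Set.range_eq_empty, Submodule.span_empty, Submodule.mem_bot] at h1
    exact X_ne_zero _ h1
  have : Nonempty (Fin r) := ⟨⟨0, hr⟩⟩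
  obtain ⟨L, rfl⟩ : ∃ L : Fin r → Fin n → ℂ, ℓ = fun i => NDConj.lin (L i) :=
    ⟨fun i k => (ℓ i).coeff (Finsupp.single k 1), funext fun i => NDConj.eq_lin (hhom i)⟩
  have hL : ∀ i, L i ≠ 0 := fun i h => hℓ i (by simp only [h, NDConj.lin_zero])
  obtain ⟨T⟩ := NDConj.exists_basisTree (NDConj.sp_univ_eq_top hess) hL (NDConj.conn_univ hindec)
  have hf0 : constantCoeff f = 0 := by
    rw [hf, map_prod]
    refine Finset.prod_eq_zero (Finset.mem_univ ⟨0, hr⟩) ?_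
    rw [map_pow, NDConj.constantCoeff_lin, zero_pow (by have := hd ⟨0, hr⟩; omega)]
  have hunit : ∀ i, ∃ y,
      algebraMap (MvPolynomial (Fin n) ℂ) (Localization.Away f) (NDConj.lin (L i)) * y = 1 := by
    intro i
    obtain ⟨g, hg⟩ : NDConj.lin (L i) ∣ f := by
      rw [hf]
      exact (dvd_pow_self _ (by have := hd i; omega)).trans
        (Finset.dvd_prod_of_mem _ (Finset.mem_univ i))
    refine ⟨algebraMap _ _ g * finv, ?_⟩
    rw [← mul_assoc, ← map_mul, ← hg, hfinv]
  choose pinv hp using hunit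
  have hfinv' : finv = ∏ i, pinv i ^ d i := by
    have h1 : algebraMap (MvPolynomial (Fin n) ℂ) (Localization.Away f) f * ∏ i, pinv i ^ d i =
        1 := by
      rw [congrArg (algebraMap (MvPolynomial (Fin n) ℂ) (Localization.Away f)) hf, map_prod,
        ← Finset.prod_mul_distrib]
      refine Finset.prod_eq_one fun i _ => ?_
      rw [map_pow, ← mul_pow, hp, one_pow]
    linear_combination finv * h1.symm + (∏ i, pinv i ^ d i) * hfinv
  let D' : Fin n → Derivation ℂ (Localization.Away f) (Localization.Away f) := fun k =>
    Derivation.mk'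
      { toFun := D k
        map_add' := hDadd k
        map_smul' := fun a x => by
          rw [Algebra.smul_def, IsScalarTower.algebraMap_apply ℂ (MvPolynomial (Fin n) ℂ),
            hDleibniz, hDext, algebraMap_eq, pderiv_C, map_zero, mul_zero, add_zero,
            RingHom.id_apply, Algebra.smul_def,
            IsScalarTower.algebraMap_apply ℂ (MvPolynomial (Fin n) ℂ), algebraMap_eq] }
      (hDleibniz k)
  obtain ⟨h, J, S, hS, hJ, hq⟩ := NDConj.exists_treeSystem (D := D') hL hf hDext hp T
  refine NDConj.eval_eq_zero_of_good (finv := finv) hr hS hL hq hfinv' hd ?_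
  have hmap : algebraMap ℂ (Localization.Away f) =
      (algebraMap (MvPolynomial (Fin n) ℂ) (Localization.Away f)).comp C := by
    rw [IsScalarTower.algebraMap_eq ℂ (MvPolynomial (Fin n) ℂ), algebraMap_eq]
  rw [hmap]
  rw [hN] at hb
  refine hb {w | NDConj.Good (n := n) (fun k => J (NDConj.expo d T.B k)) finv w}
    ⟨NDConj.good_C hS hL hq hfinv' hd hf0, NDConj.good_zero, fun x hx y hy => hx.add hy,
      fun a x hx => hx.C_mul a, fun x hx => hx.X_mul, fun k x hx => ?_⟩
  rw [hnabla]
  exact hx.nabla (D := D') (fun k => hJ _) hDext hfinv k
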